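/- Let n ≥ 5 and let G be a finite group with A_n ≤ G ≤ Aut(A_n), i.e., G has a normal subgroup isomorphic to the alternating group A_n with trivial centralizer in G. Then the fundamental group of every connected component of the geometric realization of K(A_2(G)) is a free group. -/

import Mathlib

open Function

/-- The geometric realization of the order complex of the subposet `S` of `X`,
realized as a subspace of `X → ℝ`: convex combinations supported on finite
nonempty chains contained in `S`. -/
def geomRealOn {X : Type*} [Preorder X] (S : Set X) : Set (X → ℝ) :=
  {f | (∀ x, 0 ≤ f x) ∧ Function.support f ⊆ S ∧ IsChain (· ≤ ·) (Function.support f) ∧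
    ∃ s : Finset X, Function.support f ⊆ ↑s ∧ ∑ x ∈ s, f x = 1}

/-- A group is elementary abelian for the prime `p` if it is abelian and
every element has order dividing `p`. -/
def IsElementaryAbelian (p : ℕ) (G : Type*) [Group G] : Prop :=
  (∀ a b : G, a * b = b * a) ∧ ∀ a : G, a ^ p = 1

/-- The Quillen poset `A_p(G)`: nontrivial elementary abelian `p`-subgroups of `G`. -/
def apSet (p : ℕ) (G : Type*) [Group G] : Set (Subgroup G) :=
  {H | H ≠ ⊥ ∧ IsElementaryAbelian p ↥H}

section Topology

open Path.Homotopic (Quotient)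

namespace GeomReal

variable {X : Type} [PartialOrder X] {S : Set X}

theorem support_comb {Y : Type} {f g : Y → ℝ} {a b : ℝ} :
    support (a • f + b • g) ⊆ support f ∪ support g := by
  intro x hx
  by_contra h
  simp only [Set.mem_union, mem_support, not_or, not_not] at h
  simp [h.1, h.2] at hx

/-- The closed star of an element of the poset. -/
def closedStar (S : Set X) (a : X) : Set (X → ℝ) :=
  {f | f ∈ geomRealOn S ∧ ∀ b ∈ support f, b ≤ a ∨ a ≤ b}

theorem closedStar_subset (a : X) : closedStar S a ⊆ geomRealOn S := fun _ h => h.1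

theorem homotopic_of_starConvex {W : Set (X → ℝ)} (hW : W ⊆ geomRealOn S) {p : X → ℝ}
    (hp : StarConvex ℝ p W) {x y : ↥(geomRealOn S)} (γ δ : Path x y)
    (hγ : ∀ t, (γ t).1 ∈ W) (hδ : ∀ t, (δ t).1 ∈ W) : γ.Homotopic δ := by
  have := hp.contractibleSpace ⟨_, hγ 0⟩
  have hx : x.1 ∈ W := by simpa using hγ 0
  have hy : y.1 ∈ W := by simpa using hγ 1
  let lift (γ : Path x y) (hγ : ∀ t, (γ t).1 ∈ W) : Path (⟨x.1, hx⟩ : W) ⟨y.1, hy⟩ :=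
    { toFun := fun t => ⟨(γ t).1, hγ t⟩
      continuous_toFun := by fun_prop
      source' := by simp
      target' := by simp }
  have h := SimplyConnectedSpace.paths_homotopic (lift γ hγ) (lift δ hδ)
  have hc : Continuous (fun w : W => (⟨w.1, hW w.2⟩ : ↥(geomRealOn S))) := by fun_prop
  have := h.map ⟨_, hc⟩
  have e1 : ∀ γ hγ, (lift γ hγ).map hc = γ := fun γ hγ => by ext t; rfl
  simpa [e1] using this

/-- A homotopy class of paths has a representative inside `W`. -/
def InSet (W : Set (X → ℝ)) {x y : ↥(geomRealOn S)} (γ : Quotient x y) : Prop :=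
  ∃ p : Path x y, Path.Homotopic.Quotient.mk p = γ ∧ ∀ t, (p t).1 ∈ W

theorem InSet.trans {W : Set (X → ℝ)} {x y z : ↥(geomRealOn S)} {γ : Quotient x y}
    {δ : Quotient y z} (hγ : InSet W γ) (hδ : InSet W δ) : InSet W (γ.trans δ) := by
  obtain ⟨p, rfl, hp⟩ := hγ
  obtain ⟨q, rfl, hq⟩ := hδ
  refine ⟨p.trans q, rfl, fun t => ?_⟩
  rw [Path.trans_apply]
  split_ifs
  · exact hp _
  · exact hq _

theorem InSet.symm {W : Set (X → ℝ)} {x y : ↥(geomRealOn S)} {γ : Quotient x y}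
    (hγ : InSet W γ) : InSet W γ.symm := by
  obtain ⟨p, rfl, hp⟩ := hγ
  exact ⟨p.symm, rfl, fun t => hp _⟩

theorem inSet_refl {W : Set (X → ℝ)} {x : ↥(geomRealOn S)} (h : x.1 ∈ W) :
    InSet W (Path.Homotopic.Quotient.refl x) :=
  ⟨Path.refl x, rfl, fun _ => h⟩

variable [Fintype X]

theorem mem_iff {f : X → ℝ} : f ∈ geomRealOn S ↔ (∀ x, 0 ≤ f x) ∧ support f ⊆ S ∧
    IsChain (· ≤ ·) (support f) ∧ ∑ x, f x = 1 := by
  unfold geomRealOn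
  constructor
  · rintro ⟨h0, h1, h2, s, hs, hs1⟩
    refine ⟨h0, h1, h2, ?_⟩
    rw [← hs1]
    refine (Finset.sum_subset (Finset.subset_univ s) fun x _ hx => ?_).symm
    by_contra h
    exact hx (hs h)
  · rintro ⟨h0, h1, h2, h3⟩
    exact ⟨h0, h1, h2, Finset.univ, by simp, h3⟩

theorem comb_mem {f g : X → ℝ} (hf : f ∈ geomRealOn S) (hg : g ∈ geomRealOn S)
    (hc : IsChain (· ≤ ·) (support f ∪ support g)) {a b : ℝ} (ha : 0 ≤ a) (hb : 0 ≤ b)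
    (hab : a + b = 1) : a • f + b • g ∈ geomRealOn S := by
  rw [mem_iff] at *
  refine ⟨fun x => ?_, support_comb.trans (Set.union_subset hf.2.1 hg.2.1), hc.mono support_comb,
    ?_⟩
  · have := hf.1 x; have := hg.1 x
    simp only [Pi.add_apply, Pi.smul_apply, smul_eq_mul]; positivity
  · simp [Finset.sum_add_distrib, ← Finset.mul_sum, hf.2.2.2, hg.2.2.2, hab]

open Classical in
/-- The vertex of the realization given by an element of the poset. -/
noncomputable def vertex (a : S) : ↥(geomRealOn S) :=
  ⟨Pi.single a.1 1, by
    rw [mem_iff]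
    have hs : support (Pi.single a.1 (1 : ℝ)) ⊆ {a.1} := Pi.support_single_subset
    refine ⟨fun x => ?_, hs.trans (by simp), Set.Subsingleton.isChain ?_, by simp⟩
    · by_cases h : x = a.1
      · subst h; simp
      · simp [h]
    · exact Set.subsingleton_singleton.anti hs⟩

theorem support_vertex (a : S) : support (vertex a).1 = {a.1} := by
  classical
  unfold vertex
  exact Pi.support_single_of_ne one_ne_zero

theorem starConvex_closedStar (a : S) : StarConvex ℝ (vertex a).1 (closedStar S a.1) := by
  intro f hf s t hs ht hst
  refine ⟨comb_mem (vertex a).2 hf.1 ?_ hs ht hst, fun b hb => ?_⟩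
  · rw [support_vertex]
    have h1 := (mem_iff.1 hf.1).2.2.1
    rw [Set.singleton_union]
    exact h1.insert fun b hb _ => (hf.2 b hb).symm
  · rcases support_comb hb with h | h
    · rw [support_vertex] at h
      rw [Set.mem_singleton_iff] at h
      exact Or.inl h.le
    · exact hf.2 b h

theorem InSet.eq {a : S} {x y : ↥(geomRealOn S)} {γ δ : Quotient x y}
    (hγ : InSet (closedStar S a.1) γ) (hδ : InSet (closedStar S a.1) δ) : γ = δ := by
  obtain ⟨p, rfl, hp⟩ := hγ
  obtain ⟨q, rfl, hq⟩ := hδ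
  exact Path.Homotopic.Quotient.eq.2 (homotopic_of_starConvex (closedStar_subset _)
    (starConvex_closedStar a) p q hp hq)

/-- The straight path between two points whose supports lie in a common chain. -/
noncomputable def segment (x y : ↥(geomRealOn S))
    (h : IsChain (· ≤ ·) (support x.1 ∪ support y.1)) : Path x y where
  toFun t := ⟨(1 - t.1) • x.1 + t.1 • y.1,
    comb_mem x.2 y.2 h (by have := t.2.2; linarith) t.2.1 (by ring)⟩
  continuous_toFun := by fun_prop
  source' := by ext; simp
  target' := by ext; simp

theorem inSet_segment {x y : ↥(geomRealOn S)}
    (h : IsChain (· ≤ ·) (support x.1 ∪ support y.1)) {a : X}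
    (hx : x.1 ∈ closedStar S a) (hy : y.1 ∈ closedStar S a) :
    InSet (closedStar S a) (Path.Homotopic.Quotient.mk (segment x y h)) :=
  ⟨_, rfl, fun t => ⟨Subtype.coe_prop _, fun b hb => by
    rcases support_comb hb with hb | hb
    exacts [hx.2 b hb, hy.2 b hb]⟩⟩

theorem vertex_mem_closedStar {a : S} {b : X} (h : a.1 ≤ b ∨ b ≤ a.1) :
    (vertex a).1 ∈ closedStar S b :=
  ⟨(vertex a).2, fun c hc => by
    rw [support_vertex, Set.mem_singleton_iff] at hc
    rwa [hc]⟩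

theorem mem_closedStar_of_mem_support {x : ↥(geomRealOn S)} {a : X} (h : a ∈ support x.1) :
    x.1 ∈ closedStar S a :=
  ⟨x.2, fun _ hb => (mem_iff.1 x.2).2.2.1.total hb h⟩

theorem exists_inSet_vertex {a b c : S} (h : a.1 ≤ b.1) (hb : b.1 ≤ c.1) :
    ∃ γ : Quotient (vertex a) (vertex b),
      InSet (closedStar S b.1) γ ∧ InSet (closedStar S c.1) γ := by
  have hc : IsChain (· ≤ ·) (support (vertex a).1 ∪ support (vertex b).1) := by
    rw [support_vertex, support_vertex]
    intro x hx y hy _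
    rcases hx with rfl | rfl <;> rcases hy with rfl | rfl <;> simp [h]
  exact ⟨_, inSet_segment hc (vertex_mem_closedStar (.inl h)) (vertex_mem_closedStar (.inl le_rfl)),
    inSet_segment hc (vertex_mem_closedStar (.inl (h.trans hb))) (vertex_mem_closedStar (.inl hb))⟩

theorem exists_inSet_vertex_pair {a a' b c : S} (h : a.1 ≤ b.1) (h' : a'.1 ≤ b.1) (hb : b.1 ≤ c.1) :
    ∃ γ : Quotient (vertex a) (vertex a'),
      InSet (closedStar S b.1) γ ∧ InSet (closedStar S c.1) γ := by
  obtain ⟨γ, h1, h2⟩ := exists_inSet_vertex h hb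
  obtain ⟨δ, h3, h4⟩ := exists_inSet_vertex h' hb
  exact ⟨γ.trans δ.symm, h1.trans h3.symm, h2.trans h4.symm⟩

end GeomReal
end Topology

section Topology

open Path.Homotopic (Quotient)
open unitInterval

namespace GeomReal

variable {X : Type} [PartialOrder X] [Fintype X] {S : Set X} {ι : Type}

/-- A family of minimal elements of the poset `S` dominating everything from below,
such that bounded pairs have joins and pairwise bounded triples are bounded. -/
structure PointSystem (S : Set X) (ι : Type) where
  ofPoints ::
  pt : ι → S
  eq_of_le : ∀ s t, (pt s).1 ≤ (pt t).1 → s = t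
  exists_le : ∀ a : S, ∃ s, (pt s).1 ≤ a.1
  exists_join : ∀ s t (a : S), (pt s).1 ≤ a.1 → (pt t).1 ≤ a.1 →
    ∃ j : S, (pt s).1 ≤ j.1 ∧ (pt t).1 ≤ j.1 ∧
      ∀ b : S, (pt s).1 ≤ b.1 → (pt t).1 ≤ b.1 → j.1 ≤ b.1
  rel : ι → ι → Prop
  rel_iff : ∀ s t, rel s t ↔ ∃ a : S, (pt s).1 ≤ a.1 ∧ (pt t).1 ≤ a.1
  flag : ∀ s t u, rel s t → rel t u → rel s u →
    ∃ a : S, (pt s).1 ≤ a.1 ∧ (pt t).1 ≤ a.1 ∧ (pt u).1 ≤ a.1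

variable (P : PointSystem S ι)

namespace PointSystem

/-- The vertex of the realization attached to a point. -/
noncomputable def vert (s : ι) : ↥(geomRealOn S) := vertex (P.pt s)

/-- Homotopy classes of paths staying in the closed star of a common upper bound. -/
def IsEdge {s t : ι} (γ : Quotient (P.vert s) (P.vert t)) : Prop :=
  ∃ a : S, (P.pt s).1 ≤ a.1 ∧ (P.pt t).1 ≤ a.1 ∧ InSet (closedStar S a.1) γ

variable {P}

theorem IsEdge.rel {s t : ι} {γ : Quotient (P.vert s) (P.vert t)} (h : P.IsEdge γ) : P.rel s t :=
  (P.rel_iff s t).2 (let ⟨a, h1, h2, _⟩ := h; ⟨a, h1, h2⟩)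

theorem exists_edge_inSet {s t : ι} {a : S} (h1 : (P.pt s).1 ≤ a.1) (h2 : (P.pt t).1 ≤ a.1) :
    ∃ γ : Quotient (P.vert s) (P.vert t), InSet (closedStar S a.1) γ :=
  let ⟨γ, h, _⟩ := exists_inSet_vertex_pair h1 h2 le_rfl
  ⟨γ, h⟩

theorem IsEdge.inSet {s t : ι} {γ : Quotient (P.vert s) (P.vert t)} (h : P.IsEdge γ)
    {b : S} (h1 : (P.pt s).1 ≤ b.1) (h2 : (P.pt t).1 ≤ b.1) : InSet (closedStar S b.1) γ := by
  obtain ⟨a, ha1, ha2, ha⟩ := h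
  obtain ⟨j, hj1, hj2, hj⟩ := P.exists_join s t a ha1 ha2
  obtain ⟨δ, hδ, hδa⟩ := exists_inSet_vertex_pair hj1 hj2 (hj a ha1 ha2)
  obtain ⟨ε, hε, hεb⟩ := exists_inSet_vertex_pair hj1 hj2 (hj b h1 h2)
  have e1 := hδa.eq ha
  have e2 := hδ.eq hε
  rw [← e1, e2]
  exact hεb

theorem IsEdge.eq {s t : ι} {γ δ : Quotient (P.vert s) (P.vert t)} (hγ : P.IsEdge γ)
    (hδ : P.IsEdge δ) : γ = δ := by
  obtain ⟨a, h1, h2, h⟩ := id hγ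
  exact h.eq (hδ.inSet h1 h2)

theorem exists_isEdge {s t : ι} (h : P.rel s t) :
    ∃ γ : Quotient (P.vert s) (P.vert t), P.IsEdge γ := by
  obtain ⟨a, h1, h2⟩ := (P.rel_iff s t).1 h
  obtain ⟨γ, hγ⟩ := exists_edge_inSet h1 h2
  exact ⟨γ, a, h1, h2, hγ⟩

theorem IsEdge.trans {s t u : ι} {γ : Quotient (P.vert s) (P.vert t)}
    {δ : Quotient (P.vert t) (P.vert u)} (hγ : P.IsEdge γ) (hδ : P.IsEdge δ) (h : P.rel s u) :
    P.IsEdge (γ.trans δ) := by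
  obtain ⟨a, h1, h2, h3⟩ := P.flag s t u hγ.rel hδ.rel h
  exact ⟨a, h1, h3, (hγ.inSet h1 h2).trans (hδ.inSet h2 h3)⟩

variable (P) in
/-- Composites of edges. -/
inductive Word : ∀ {s t : ι}, Quotient (P.vert s) (P.vert t) → Prop
  | refl (s : ι) : Word (Path.Homotopic.Quotient.refl (P.vert s))
  | snoc {s t u : ι} {γ : Quotient (P.vert s) (P.vert t)} {δ : Quotient (P.vert t) (P.vert u)} :
      Word γ → P.IsEdge δ → Word (γ.trans δ)

variable (P) in
/-- Classes joining a point below the support of `x` to `x`. -/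
def IsConn {s : ι} {x : ↥(geomRealOn S)} (α : Quotient (P.vert s) x) : Prop :=
  ∀ a ∈ support x.1, (P.pt s).1 ≤ a ∧ InSet (closedStar S a) α

theorem support_nonempty (x : ↥(geomRealOn S)) : (support x.1).Nonempty := by
  rw [support_nonempty_iff]
  intro h
  have := (mem_iff.1 x.2).2.2.2
  simp [h] at this

variable (P) in
theorem exists_isConn (x : ↥(geomRealOn S)) :
    ∃ (s : ι) (α : Quotient (P.vert s) x), P.IsConn α := by
  obtain ⟨b, hb, hmin⟩ := (Set.toFinite (support x.1)).exists_minimal (support_nonempty x)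
  have hx := mem_iff.1 x.2
  have hle : ∀ a ∈ support x.1, b ≤ a := fun a ha => by
    rcases hx.2.2.1.total hb ha with h | h
    · exact h
    · exact hmin ha h
  obtain ⟨s, hs⟩ := P.exists_le ⟨b, hx.2.1 hb⟩
  have hs' : ∀ a ∈ support x.1, (P.pt s).1 ≤ a := fun a ha => le_trans hs (hle a ha)
  have hc : IsChain (· ≤ ·) (support (P.vert s).1 ∪ support x.1) := by
    rw [vert, support_vertex, Set.singleton_union]
    exact hx.2.2.1.insert fun a ha _ => .inl (hs' a ha)
  exact ⟨s, _, fun a ha => ⟨hs' a ha, inSet_segment hc (vertex_mem_closedStar (.inl (hs' a ha)))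
    (mem_closedStar_of_mem_support ha)⟩⟩

variable (P) in
theorem isConn_refl (s : ι) : P.IsConn (Path.Homotopic.Quotient.refl (P.vert s)) := by
  intro a ha
  refine ⟨?_, inSet_refl (mem_closedStar_of_mem_support ha)⟩
  rw [vert, support_vertex, Set.mem_singleton_iff] at ha
  exact ha.ge

open Path.Homotopic.Quotient in
theorem word_conj {x y : ↥(geomRealOn S)} (γ : Path x y) {s t : ι} {α : Quotient (P.vert s) x}
    {β : Quotient (P.vert t) y} (hα : P.IsConn α) (hβ : P.IsConn β) :
    P.Word ((α.trans (mk γ)).trans β.symm) := by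
  have ho : ∀ a : S, IsOpen {t : I | a.1 ∈ support (γ t).1} := fun a => by
    have hc : Continuous fun t : I => (γ t).1 a.1 :=
      (continuous_apply a.1).comp (continuous_subtype_val.comp γ.continuous)
    exact isOpen_ne.preimage hc
  have hcov : Set.univ ⊆ ⋃ a : S, {t : I | a.1 ∈ support (γ t).1} := fun t _ => by
    obtain ⟨a, ha⟩ := support_nonempty (γ t)
    exact Set.mem_iUnion.2 ⟨⟨a, (mem_iff.1 (γ t).2).2.1 ha⟩, ha⟩
  obtain ⟨τ, h0, hm, ⟨N, hN⟩, hτ⟩ := exists_monotone_Icc_subset_open_cover_unitInterval ho hcov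
  have key : ∀ n, ∀ {s' t' : ι} (α : Quotient (P.vert s') (γ (τ 0)))
      (β : Quotient (P.vert t') (γ (τ n))),
      P.IsConn α → P.IsConn β → P.Word ((α.trans (mk (γ.subpath (τ 0) (τ n)))).trans β.symm) := by
    intro n
    induction n with
    | zero =>
      intro s' t' α β hα hβ
      rw [Path.subpath_self, mk_refl, trans_refl, ← refl_trans (α.trans β.symm)]
      obtain ⟨a, ha⟩ := support_nonempty (γ (τ 0))
      exact (Word.refl s').snoc ⟨⟨a, (mem_iff.1 (γ (τ 0)).2).2.1 ha⟩, (hα a ha).1, (hβ a ha).1,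
        (hα a ha).2.trans (hβ a ha).2.symm⟩
    | succ n ih =>
      intro s' t' α β hα hβ
      obtain ⟨u, δ, hδ⟩ := P.exists_isConn (γ (τ n))
      obtain ⟨a, ha⟩ := hτ n
      have h1 : a.1 ∈ support (γ (τ n)).1 := ha ⟨le_rfl, hm n.le_succ⟩
      have h2 : a.1 ∈ support (γ (τ (n + 1))).1 := ha ⟨hm n.le_succ, le_rfl⟩
      have e : (α.trans (mk (γ.subpath (τ 0) (τ (n + 1))))).trans β.symm =
          ((α.trans (mk (γ.subpath (τ 0) (τ n)))).trans δ.symm).trans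
            ((δ.trans (mk (γ.subpath (τ n) (τ (n + 1))))).trans β.symm) := by
        rw [← Path.Homotopic.Quotient.eq.2 ⟨Path.Homotopy.subpathTransSubpath γ (τ 0) (τ n)
          (τ (n + 1))⟩,
          mk_trans]
        simp only [trans_assoc]
        rw [← trans_assoc δ.symm, symm_trans, refl_trans]
      rw [e]
      refine (ih α δ hα hδ).snoc ⟨a, (hδ _ h1).1, (hβ _ h2).1,
        ((hδ _ h1).2.trans ⟨_, rfl, fun r => ?_⟩).trans (hβ _ h2).2.symm⟩
      have hr : γ.subpath (τ n) (τ (n + 1)) r ∈ Set.range (γ.subpath (τ n) (τ (n + 1))) := ⟨r, rfl⟩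
      rw [Path.range_subpath_of_le _ _ _ (hm n.le_succ)] at hr
      obtain ⟨r', hr', e⟩ := hr
      rw [← e]
      exact mem_closedStar_of_mem_support (ha hr')
  have hx : γ (τ 0) = x := by rw [h0, γ.source]
  have hy : γ (τ N) = y := by rw [hN N le_rfl, γ.target]
  have e2 : mk γ = (mk (γ.subpath (τ 0) (τ N))).cast hx.symm hy.symm := by
    rw [← mk_cast]
    congr 1
    ext r
    simp [h0, hN N le_rfl, Path.subpath]
  have := key N (α.cast rfl hx) (β.cast rfl hy)
  rw [e2]
  revert this α β
  generalize mk (γ.subpath (τ 0) (τ N)) = ε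
  revert ε
  clear e2 key
  generalize γ (τ 0) = x' at hx
  generalize γ (τ N) = y' at hy
  subst hx hy
  intro ε α β hα hβ h
  simpa using h (by simpa using hα) (by simpa using hβ)

theorem word {s t : ι} (γ : Quotient (P.vert s) (P.vert t)) : P.Word γ := by
  induction γ using Path.Homotopic.Quotient.ind with
  | mk γ => ?_
  have e : (Path.Homotopic.Quotient.refl (P.vert t)).symm = .refl _ := by
    rw [← Path.Homotopic.Quotient.mk_refl, ← Path.Homotopic.Quotient.mk_symm, Path.refl_symm]
  simpa [e] using word_conj γ (P.isConn_refl s) (P.isConn_refl t)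

end PointSystem
end GeomReal
end Topology

section Topology

open Path.Homotopic (Quotient)
open unitInterval Bundle

namespace GeomReal
namespace PointSystem

variable {X : Type} [PartialOrder X] {S : Set X} {ι : Type} {P : PointSystem S ι}
  {Γ : Type} [Group Γ] {c : ι → ι → Γ}

variable (P) in
/-- A chosen point below an element of the poset. -/
noncomputable def low (a : S) : ι := (P.exists_le a).choose

theorem low_le (a : S) : (P.pt (P.low a)).1 ≤ a.1 := (P.exists_le a).choose_spec

theorem low_pt (s : ι) : P.low (P.pt s) = s := P.eq_of_le _ _ (low_le _)

theorem rel_low {a b : S} (h : a.1 ≤ b.1 ∨ b.1 ≤ a.1) : P.rel (P.low a) (P.low b) := by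
  rw [P.rel_iff]
  rcases h with h | h
  · exact ⟨b, (low_le a).trans h, low_le b⟩
  · exact ⟨a, low_le a, (low_le b).trans h⟩

theorem cocycle_low (hc : ∀ s t u, P.rel s t → P.rel t u → P.rel s u → c s t * c t u = c s u)
    {a b d : S} (h1 : a.1 ≤ b.1 ∨ b.1 ≤ a.1) (h2 : b.1 ≤ d.1 ∨ d.1 ≤ b.1)
    (h3 : a.1 ≤ d.1 ∨ d.1 ≤ a.1) :
    c (P.low a) (P.low b) * c (P.low b) (P.low d) = c (P.low a) (P.low d) :=
  hc _ _ _ (rel_low h1) (rel_low h2) (rel_low h3)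

variable [Fintype X]

theorem total_of_mem_support {x : ↥(geomRealOn S)} {a b : X} (ha : a ∈ support x.1)
    (hb : b ∈ support x.1) : a ≤ b ∨ b ≤ a :=
  (mem_iff.1 x.2).2.2.1.total ha hb

/-- An element of the support of a point. -/
noncomputable def carrier (x : ↥(geomRealOn S)) : S :=
  ⟨(support_nonempty x).choose, (mem_iff.1 x.2).2.1 (support_nonempty x).choose_spec⟩

theorem carrier_mem (x : ↥(geomRealOn S)) : (carrier x).1 ∈ support x.1 :=
  (support_nonempty x).choose_spec

theorem carrier_vert (s : ι) : carrier (P.vert s) = P.pt s := by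
  have := carrier_mem (P.vert s)
  rw [vert, support_vertex] at this
  exact Subtype.ext this

/-- The principal bundle attached to a cocycle. -/
noncomputable def bundleCore [TopologicalSpace Γ] [DiscreteTopology Γ]
    (hc : ∀ s t u, P.rel s t → P.rel t u → P.rel s u → c s t * c t u = c s u) :
    FiberBundleCore S ↥(geomRealOn S) Γ where
  baseSet a := {x | a.1 ∈ support x.1}
  isOpen_baseSet a :=
    isOpen_ne.preimage ((continuous_apply a.1).comp continuous_subtype_val)
  indexAt := carrier
  mem_baseSet_at := carrier_mem
  coordChange a b _ g := g * c (P.low a) (P.low b)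
  coordChange_self a x _ g := by
    have := cocycle_low hc (a := a) (b := a) (d := a) (.inl le_rfl) (.inl le_rfl) (.inl le_rfl)
    simpa using this
  continuousOn_coordChange a b := by
    have : Continuous fun g : Γ => g * c (P.low a) (P.low b) := continuous_of_discreteTopology
    exact (this.comp continuous_snd).continuousOn
  coordChange_comp a b d x hx g := by
    rw [mul_assoc, cocycle_low hc (total_of_mem_support hx.1.1 hx.1.2)
      (total_of_mem_support hx.1.2 hx.2) (total_of_mem_support hx.1.1 hx.2)]

theorem continuous_lift [TopologicalSpace Γ] [DiscreteTopology Γ]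
    (hc : ∀ s t u, P.rel s t → P.rel t u → P.rel s u → c s t * c t u = c s u) {a : S}
    (p : C(I, ↥(geomRealOn S))) (hp : ∀ r, (p r).1 ∈ closedStar S a.1) (g : Γ) :
    Continuous fun r => (⟨p r, g * c (P.low a) (P.low (carrier (p r)))⟩ :
        (bundleCore hc).TotalSpace) := by
  rw [continuous_iff_continuousAt]
  intro r
  set b := carrier (p r) with hb
  set Z := bundleCore hc
  have hopen : IsOpen {r' | b.1 ∈ support (p r').1} :=
    ((bundleCore hc).isOpen_baseSet b).preimage p.continuous
  have hev : ∀ᶠ r' in nhds r, b.1 ∈ support (p r').1 := hopen.mem_nhds (carrier_mem _)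
  have hcont : ContinuousAt (fun r' => (Z.localTriv b).toOpenPartialHomeomorph.symm
      (p r', g * c (P.low a) (P.low b))) r := by
    refine ContinuousAt.comp (g := (Z.localTriv b).toOpenPartialHomeomorph.symm)
      (f := fun r' => (p r', g * c (P.low a) (P.low b))) ?_
      (p.continuous.prodMk continuous_const).continuousAt
    apply OpenPartialHomeomorph.continuousAt_symm
    exact (Z.mem_localTriv_target b _).2 (carrier_mem (p r))
  refine hcont.congr ?_
  filter_upwards [hev] with r' hr'
  rw [FiberBundleCore.localTriv_symm_apply]
  congr 1
  change g * c (P.low a) (P.low b) * c (P.low b) (P.low (carrier (p r'))) = _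
  rw [mul_assoc, cocycle_low hc ((hp r').2 _ hr').symm
    (total_of_mem_support hr' (carrier_mem _)) ((hp r').2 _ (carrier_mem _)).symm]

theorem monodromy_eq [TopologicalSpace Γ] [DiscreteTopology Γ]
    (hc : ∀ s t u, P.rel s t → P.rel t u → P.rel s u → c s t * c t u = c s u) {a : S}
    {x y : ↥(geomRealOn S)} {γ : Quotient x y} (hγ : InSet (closedStar S a.1) γ) (g : Γ) :
    (FiberBundle.isCoveringMap (F := Γ) (E := (bundleCore hc).Fiber)).monodromy γ
      ⟨⟨x, g * c (P.low a) (P.low (carrier x))⟩, rfl⟩ =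
      ⟨⟨y, g * c (P.low a) (P.low (carrier y))⟩, rfl⟩ := by
  obtain ⟨p, rfl, hp⟩ := hγ
  have key : ∀ z w : ↥(geomRealOn S), z = w →
      (⟨z, g * c (P.low a) (P.low (carrier z))⟩ : (bundleCore hc).TotalSpace) =
        ⟨w, g * c (P.low a) (P.low (carrier w))⟩ := by
    rintro z _ rfl
    rfl
  let q : Path (⟨x, g * c (P.low a) (P.low (carrier x))⟩ : (bundleCore hc).TotalSpace)
      ⟨y, g * c (P.low a) (P.low (carrier y))⟩ :=
    { toFun := fun r => ⟨p r, g * c (P.low a) (P.low (carrier (p r)))⟩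
      continuous_toFun := continuous_lift hc p.toContinuousMap hp g
      source' := key _ _ p.source
      target' := key _ _ p.target }
  refine IsCoveringMap.monodromy_eq_of_map_eq _ (.mk q) ?_
  exact (Path.Homotopic.Quotient.mk_cast p rfl rfl)

/-- A cocycle determines a multiplicative function on homotopy classes of paths between
vertices. -/
theorem exists_functor
    (hc : ∀ s t u, P.rel s t → P.rel t u → P.rel s u → c s t * c t u = c s u) :
    ∃ F : ∀ {s t : ι}, Quotient (P.vert s) (P.vert t) → Γ,
      (∀ {s t u} (γ : Quotient (P.vert s) (P.vert t)) (δ : Quotient (P.vert t) (P.vert u)),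
        F (γ.trans δ) = F γ * F δ) ∧
      ∀ {s t} (γ : Quotient (P.vert s) (P.vert t)), P.IsEdge γ → F γ = c s t := by
  let : TopologicalSpace Γ := ⊥
  have : DiscreteTopology Γ := ⟨rfl⟩
  have cov := FiberBundle.isCoveringMap (F := Γ) (E := (bundleCore hc).Fiber)
  let m {s t : ι} (γ : Quotient (P.vert s) (P.vert t)) (g : Γ) : Γ :=
    (cov.monodromy γ ⟨⟨P.vert s, g⟩, rfl⟩).1.2
  have hm : ∀ {s t : ι} (γ : Quotient (P.vert s) (P.vert t)) (g : Γ),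
      cov.monodromy γ ⟨⟨P.vert s, g⟩, rfl⟩ = ⟨⟨P.vert t, m γ g⟩, rfl⟩ := by
    intro s t γ g
    have h := (cov.monodromy γ ⟨⟨P.vert s, g⟩, rfl⟩).2
    simp only [m]
    generalize cov.monodromy γ ⟨⟨P.vert s, g⟩, rfl⟩ = e at h
    obtain ⟨⟨y, e⟩, he⟩ := e
    obtain rfl : y = P.vert t := he
    rfl
  have htrans : ∀ {s t u : ι} (γ : Quotient (P.vert s) (P.vert t))
      (δ : Quotient (P.vert t) (P.vert u)) (g : Γ), m (γ.trans δ) g = m δ (m γ g) := by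
    intro s t u γ δ g
    simp only [m]
    rw [cov.monodromy_trans_apply, hm γ g]
  have hedge : ∀ {s t : ι} (γ : Quotient (P.vert s) (P.vert t)), P.IsEdge γ →
      ∀ g, m γ g = g * c s t := by
    intro s t γ hγ g
    obtain ⟨a, h1, h2, h⟩ := id hγ
    have hsa : P.rel s (P.low a) := (P.rel_iff _ _).2 ⟨a, h1, low_le a⟩
    have hta : P.rel (P.low a) t := (P.rel_iff _ _).2 ⟨a, low_le a, h2⟩
    have has : P.rel (P.low a) s := (P.rel_iff _ _).2 ⟨a, low_le a, h1⟩
    have hss : P.rel s s := (P.rel_iff _ _).2 ⟨a, h1, h1⟩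
    have e1 : c s s = 1 := by simpa using hc s s s hss hss hss
    have e2 := hc _ _ _ hsa has hss
    have e3 := hc _ _ _ hsa hta hγ.rel
    have := monodromy_eq hc h (g * c s (P.low a))
    rw [carrier_vert, carrier_vert, low_pt, low_pt, mul_assoc, mul_assoc, e2, e3, e1,
      mul_one] at this
    simp only [m]
    rw [this]
  have hword : ∀ {s t : ι} (γ : Quotient (P.vert s) (P.vert t)), P.Word γ →
      ∀ g, m γ g = g * m γ 1 := by
    intro s t γ h
    induction h with
    | refl =>
      intro g
      simp only [m]
      rw [cov.monodromy_refl]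
      simp
    | snoc _ h ih =>
      intro g
      rw [htrans, htrans, hedge _ h, hedge _ h, ih, mul_assoc]
  refine ⟨fun γ => m γ 1, fun γ δ => ?_, fun γ hγ => ?_⟩
  · simp only
    rw [htrans, hword δ (word δ)]
  · simp only
    rw [hedge γ hγ, one_mul]

/-- Multiplicative functions are determined by their values on edges. -/
theorem functor_ext {F F' : ∀ s t : ι, Quotient (P.vert s) (P.vert t) → Γ}
    (hF : ∀ s t u (γ : Quotient (P.vert s) (P.vert t)) (δ : Quotient (P.vert t) (P.vert u)),
        F s u (γ.trans δ) = F s t γ * F t u δ)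
    (hF' : ∀ s t u (γ : Quotient (P.vert s) (P.vert t)) (δ : Quotient (P.vert t) (P.vert u)),
        F' s u (γ.trans δ) = F' s t γ * F' t u δ)
    (h : ∀ s t (γ : Quotient (P.vert s) (P.vert t)), P.IsEdge γ → F s t γ = F' s t γ) {s t : ι}
    (γ : Quotient (P.vert s) (P.vert t)) : F s t γ = F' s t γ := by
  have hone : ∀ {F : ∀ s t : ι, Quotient (P.vert s) (P.vert t) → Γ},
      (∀ s t u (γ : Quotient (P.vert s) (P.vert t)) (δ : Quotient (P.vert t) (P.vert u)),
        F s u (γ.trans δ) = F s t γ * F t u δ) → ∀ s, F s s (.refl _) = 1 := by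
    intro F hF s
    have := hF s s s (.refl _) (.refl _)
    rwa [Path.Homotopic.Quotient.trans_refl, left_eq_mul] at this
  induction word γ with
  | refl => rw [hone hF, hone hF']
  | snoc _ hδ ih => rw [hF, hF', ih, h _ _ _ hδ]

end PointSystem
end GeomReal
end Topology

section Cocycles

variable {V : Type}

/-- Group-valued 1-cocycles on the clique complex of a relation. -/
def IsCocycle (R : V → V → Prop) {Γ : Type} [Group Γ] (c : V → V → Γ) : Prop :=
  ∀ s t u, R s t → R t u → R s u → c s t * c t u = c s u

/-- Every cocycle with values in a group is a coboundary. -/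
def SimplyConn (R : V → V → Prop) : Prop :=
  ∀ (Γ : Type) [Group Γ] (c : V → V → Γ), IsCocycle R c →
    ∃ h : V → Γ, ∀ s t, R s t → c s t = (h s)⁻¹ * h t

/-- Cocycles correspond bijectively to arbitrary labellings of a set of edges. -/
def FreeDatum (R : V → V → Prop) : Prop :=
  ∃ Q : V → V → Prop, (∀ s t, Q s t → R s t) ∧ ∀ (Γ : Type) [Group Γ],
    (∀ l : V → V → Γ, ∃ c, IsCocycle R c ∧ ∀ s t, Q s t → c s t = l s t) ∧
    ∀ c c' : V → V → Γ, IsCocycle R c → IsCocycle R c' → (∀ s t, Q s t → c s t = c' s t) →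
      ∀ s t, R s t → c s t = c' s t

theorem IsCocycle.comap {W : Type} {R : V → V → Prop} {R' : W → W → Prop} {f : W → V}
    (hf : ∀ i j, R' i j → R (f i) (f j)) {Γ : Type} [Group Γ] {c : V → V → Γ}
    (hc : IsCocycle R c) : IsCocycle R' fun i j => c (f i) (f j) :=
  fun _ _ _ h1 h2 h3 => hc _ _ _ (hf _ _ h1) (hf _ _ h2) (hf _ _ h3)

theorem SimplyConn.comap {W : Type} {R : V → V → Prop} {R' : W → W → Prop} (f : W → V) (g : V → W)
    (hf : ∀ i j, R' i j → R (f i) (f j)) (hg : ∀ v w, R v w → R' (g v) (g w))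
    (hgf : ∀ i j, R' i j → g (f i) = i ∧ g (f j) = j) (h : SimplyConn R) : SimplyConn R' := by
  intro Γ _ c hc
  obtain ⟨k, hk⟩ := h Γ _ (hc.comap hg)
  refine ⟨fun i => k (f i), fun i j hij => ?_⟩
  have := hk _ _ (hf i j hij)
  rwa [(hgf i j hij).1, (hgf i j hij).2] at this

theorem FreeDatum.comap {W : Type} {R : V → V → Prop} {R' : W → W → Prop} (f : W → V) (g : V → W)
    (hf : ∀ i j, R' i j ↔ R (f i) (f j)) (hg : ∀ v w, R v w → R' (g v) (g w))
    (hgf : ∀ i j, R' i j → g (f i) = i ∧ g (f j) = j)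
    (hfg : ∀ v w, R v w → f (g v) = v ∧ f (g w) = w) (h : FreeDatum R) : FreeDatum R' := by
  obtain ⟨Q, hQ, h⟩ := h
  refine ⟨fun i j => Q (f i) (f j), fun s t h => (hf s t).2 (hQ _ _ h), fun Γ _ =>
    ⟨fun l => ?_, ?_⟩⟩
  · obtain ⟨c, hc, hcl⟩ := (h Γ).1 fun v w => l (g v) (g w)
    refine ⟨fun i j => c (f i) (f j), hc.comap fun i j => (hf i j).1, fun s t hst => ?_⟩
    have := hgf s t ((hf s t).2 (hQ _ _ hst))
    simp only [hcl _ _ hst, this.1, this.2]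
  · intro c c' hc hc' hcc i j hij
    have := (h Γ).2 _ _ (hc.comap hg) (hc'.comap hg) (fun s t hst => ?_) (f i) (f j)
      ((hf i j).1 hij)
    · simpa only [(hgf i j hij).1, (hgf i j hij).2] using this
    · refine hcc _ _ ?_
      have := hfg s t (hQ _ _ hst)
      change Q (f (g s)) (f (g t))
      rwa [this.1, this.2]

end Cocycles

section Topology

open Path.Homotopic (Quotient)
open CategoryTheory

namespace GeomReal
namespace PointSystem

variable {X : Type} [PartialOrder X] [Fintype X] {S : Set X} {ι : Type} (P : PointSystem S ι)

/-- The vertices in the path component of a given vertex. -/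
def Comp (r : ι) : Type := {s : ι // Nonempty (Quotient (P.vert r) (P.vert s))}

noncomputable instance (r : ι) : Groupoid.{0} (P.Comp r) where
  Hom s t := Quotient (P.vert s.1) (P.vert t.1)
  id _ := .refl _
  comp := .trans
  inv := .symm
  id_comp := Path.Homotopic.Quotient.refl_trans
  comp_id := Path.Homotopic.Quotient.trans_refl
  assoc := Path.Homotopic.Quotient.trans_assoc
  inv_comp := Path.Homotopic.Quotient.symm_trans
  comp_inv := Path.Homotopic.Quotient.trans_symm

instance (r : ι) : IsConnected (P.Comp r) := by
  have : Nonempty (P.Comp r) := ⟨⟨r, ⟨.refl _⟩⟩⟩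
  refine zigzag_isConnected fun s t => Zigzag.of_hom ?_
  exact Path.Homotopic.Quotient.trans s.2.some.symm t.2.some

/-- The base vertex of its component. -/
def base (r : ι) : P.Comp r := ⟨r, ⟨.refl _⟩⟩

/-- The chosen edge class between two related points. -/
noncomputable def edge {s t : ι} (h : P.rel s t) : Quotient (P.vert s) (P.vert t) :=
  (exists_isEdge h).choose

theorem edge_isEdge {s t : ι} (h : P.rel s t) : P.IsEdge (P.edge h) := (exists_isEdge h).choose_spec

variable {P}

theorem isCocycle_of_functor {Γ : Type} [Group Γ] {r : ι} {F : ∀ s t : P.Comp r, (s ⟶ t) → Γ}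
    (hF : ∀ s t u (γ : s ⟶ t) (δ : t ⟶ u), F s u (γ ≫ δ) = F s t γ * F t u δ)
    {c c' : ι → ι → Γ} (hc' : IsCocycle P.rel c')
    (hc : ∀ (s t : P.Comp r) (h : P.rel s.1 t.1), c s.1 t.1 = F s t (P.edge h))
    (hcc : ∀ s t, IsEmpty (Quotient (P.vert r) (P.vert s)) → c s t = c' s t) :
    IsCocycle P.rel c := by
  intro s t u h1 h2 h3
  by_cases hs : Nonempty (Quotient (P.vert r) (P.vert s))
  · have ht : Nonempty (Quotient (P.vert r) (P.vert t)) := ⟨hs.some.trans (P.edge h1)⟩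
    have hu : Nonempty (Quotient (P.vert r) (P.vert u)) := ⟨hs.some.trans (P.edge h3)⟩
    have e1 := hc ⟨s, hs⟩ ⟨t, ht⟩ h1
    have e2 := hc ⟨t, ht⟩ ⟨u, hu⟩ h2
    have e3 := hc ⟨s, hs⟩ ⟨u, hu⟩ h3
    simp only at e1 e2 e3
    rw [e1, e2, e3]
    refine (hF ⟨s, hs⟩ ⟨t, ht⟩ ⟨u, hu⟩ (P.edge h1) (P.edge h2)).symm.trans ?_
    congr 1
    exact ((P.edge_isEdge h1).trans (P.edge_isEdge h2) h3).eq (P.edge_isEdge h3)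
  · rw [not_nonempty_iff] at hs
    have ht : IsEmpty (Quotient (P.vert r) (P.vert t)) := ⟨fun α => hs.1 (α.trans (P.edge h1).symm)⟩
    rw [hcc s t hs, hcc t u ht, hcc s u hs]
    exact hc' s t u h1 h2 h3

theorem comp_functor_ext {Γ : Type} [Group Γ] {r : ι} {F F' : ∀ s t : P.Comp r, (s ⟶ t) → Γ}
    (hF : ∀ s t u (γ : s ⟶ t) (δ : t ⟶ u), F s u (γ ≫ δ) = F s t γ * F t u δ)
    (hF' : ∀ s t u (γ : s ⟶ t) (δ : t ⟶ u), F' s u (γ ≫ δ) = F' s t γ * F' t u δ)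
    (h : ∀ (s t : P.Comp r) (h : P.rel s.1 t.1), F s t (P.edge h) = F' s t (P.edge h))
    {s t : P.Comp r} (γ : s ⟶ t) : F s t γ = F' s t γ := by
  classical
  let E (F : ∀ s t : P.Comp r, (s ⟶ t) → Γ) (s t : ι) (γ : Quotient (P.vert s) (P.vert t)) : Γ :=
    if hs : Nonempty (Quotient (P.vert r) (P.vert s)) then
      F ⟨s, hs⟩ ⟨t, ⟨hs.some.trans γ⟩⟩ γ else 1
  have hE : ∀ F : ∀ s t : P.Comp r, (s ⟶ t) → Γ,
      (∀ s t u (γ : s ⟶ t) (δ : t ⟶ u), F s u (γ ≫ δ) = F s t γ * F t u δ) →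
      ∀ s t u (γ : Quotient (P.vert s) (P.vert t)) (δ : Quotient (P.vert t) (P.vert u)),
        E F s u (γ.trans δ) = E F s t γ * E F t u δ := by
    intro F hF s t u γ δ
    by_cases hs : Nonempty (Quotient (P.vert r) (P.vert s))
    · have ht : Nonempty (Quotient (P.vert r) (P.vert t)) := ⟨hs.some.trans γ⟩
      have hu : Nonempty (Quotient (P.vert r) (P.vert u)) := ⟨ht.some.trans δ⟩
      simp only [E, dif_pos hs, dif_pos ht]
      exact hF ⟨s, hs⟩ ⟨t, ht⟩ ⟨u, hu⟩ γ δ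
    · have ht : ¬ Nonempty (Quotient (P.vert r) (P.vert t)) := fun ⟨α⟩ => hs ⟨α.trans γ.symm⟩
      simp only [E, dif_neg hs, dif_neg ht, one_mul]
  have := functor_ext (hE F hF) (hE F' hF') (fun s t γ hγ => ?_) γ
  · simp only [E, dif_pos s.2] at this
    exact this
  · simp only [E]
    split_ifs with hs
    · rw [hγ.eq (P.edge_isEdge hγ.rel)]
      exact h ⟨s, hs⟩ ⟨t, ⟨hs.some.trans γ⟩⟩ hγ.rel
    · rfl

/-- The vertex group of the component groupoid is the fundamental group. -/
def endEquiv (r : ι) : End (P.base r) ≃*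
    FundamentalGroup ↥(geomRealOn S) (P.vert r) where
  toFun γ := (γ : Quotient _ _)
  invFun γ := (γ : Quotient _ _)
  left_inv _ := rfl
  right_inv _ := rfl
  map_mul' _ _ := rfl

theorem exists_mulEquiv_vert (x : ↥(geomRealOn S)) :
    ∃ r : ι, Nonempty (FundamentalGroup ↥(geomRealOn S) x ≃*
      End (P.base r)) := by
  obtain ⟨r, α, -⟩ := P.exists_isConn x
  obtain ⟨p, -⟩ := Path.Homotopic.Quotient.mk_surjective α
  exact ⟨r, ⟨(FundamentalGroup.fundamentalGroupMulEquivOfPath p.symm).trans (endEquiv r).symm⟩⟩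

theorem free_of_simplyConn (h : SimplyConn P.rel) (x : ↥(geomRealOn S)) :
    ∃ S' : Type, Nonempty (FundamentalGroup ↥(geomRealOn S) x ≃* FreeGroup S') := by
  classical
  obtain ⟨r, ⟨e⟩⟩ := exists_mulEquiv_vert (P := P) x
  let r' : P.Comp r := P.base r
  let p : ∀ s : P.Comp r, r' ⟶ s := fun s => s.2.some
  let F : ∀ s t : P.Comp r, (s ⟶ t) → (End r')ᵐᵒᵖ := fun s t γ => .op (p s ≫ γ ≫ Groupoid.inv (p t))
  have hF : ∀ s t u (γ : s ⟶ t) (δ : t ⟶ u), F s u (γ ≫ δ) = F s t γ * F t u δ := by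
    intro s t u γ δ
    simp only [F, ← MulOpposite.op_mul]
    congr 1
    change _ = (p s ≫ γ ≫ Groupoid.inv (p t)) ≫ (p t ≫ δ ≫ Groupoid.inv (p u))
    simp
  let c : ι → ι → (End r')ᵐᵒᵖ := fun s t =>
    if h : ∃ (hs : Nonempty (Quotient (P.vert r) (P.vert s)))
      (ht : Nonempty (Quotient (P.vert r) (P.vert t))), P.rel s t then
      F ⟨s, h.choose⟩ ⟨t, h.choose_spec.choose⟩ (P.edge h.choose_spec.choose_spec) else 1
  have hcF : ∀ (s t : P.Comp r) (h : P.rel s.1 t.1), c s.1 t.1 = F s t (P.edge h) := by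
    intro s t hst
    simp only [c]
    rw [dif_pos ⟨s.2, t.2, hst⟩]
    rfl
  have hc : IsCocycle P.rel c := by
    refine isCocycle_of_functor hF (c' := fun _ _ => 1) (fun _ _ _ _ _ _ => by simp) hcF ?_
    intro s t hs
    simp only [c]
    rw [dif_neg]
    rintro ⟨h, -⟩
    exact hs.false h.some
  obtain ⟨k, hk⟩ := h _ c hc
  have key := fun γ : End r' => comp_functor_ext (F := F)
    (F' := fun s t _ => (k s.1)⁻¹ * k t.1) hF (fun s t u γ δ => by group)
    (fun s t h => by rw [← hcF s t h, hk _ _ h]) γ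
  have hsub : Subsingleton (End r') := by
    refine ⟨fun γ δ => ?_⟩
    have := (key γ).trans (key δ).symm
    simp only [F] at this
    have := MulOpposite.op_injective this
    exact (cancel_mono _).1 ((cancel_epi _).1 this)
  have hu : Unique (End r') := ⟨⟨1⟩, fun _ => Subsingleton.elim _ _⟩
  have hv : Unique (FreeGroup Empty) := inferInstance
  exact ⟨Empty, ⟨e.trans MulEquiv.ofUnique⟩⟩

/-- A datum exhibiting cocycles as labellings makes the component groupoid free. -/
theorem nonempty_isFreeGroupoid (h : FreeDatum P.rel) (r : ι) :
    Nonempty (IsFreeGroupoid (P.Comp r)) := by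
  classical
  obtain ⟨Q, hQ, h⟩ := h
  refine ⟨{ quiverGenerators := ⟨fun s t => PLift (Q s.1 t.1)⟩
            of := fun q => P.edge (hQ _ _ q.down)
            unique_lift := ?_ }⟩
  intro Γ _ f
  let f' : ∀ s t : P.Comp r, Q s.1 t.1 → Γ := fun s t h => f (a := s) (b := t) (PLift.up h)
  let l : ι → ι → Γᵐᵒᵖ := fun s t =>
    if h : ∃ (hs : Nonempty (Quotient (P.vert r) (P.vert s)))
      (ht : Nonempty (Quotient (P.vert r) (P.vert t))), Q s t then
      .op (f' ⟨s, h.choose⟩ ⟨t, h.choose_spec.choose⟩ h.choose_spec.choose_spec) else 1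
  obtain ⟨c, hc, hcl⟩ := (h Γᵐᵒᵖ).1 l
  have hcl' : ∀ (s t : P.Comp r) (h : Q s.1 t.1), c s.1 t.1 = .op (f' s t h) := by
    intro s t hst
    rw [hcl _ _ hst]
    simp only [l]
    rw [dif_pos ⟨s.2, t.2, hst⟩]
    rfl
  obtain ⟨F, hF, hFc⟩ := exists_functor hc
  have hF1 : ∀ s, F (.refl (P.vert s)) = 1 := fun s => by
    have := hF (.refl (P.vert s)) (.refl (P.vert s))
    rwa [Path.Homotopic.Quotient.trans_refl, left_eq_mul] at this
  let Φ : P.Comp r ⥤ SingleObj Γ :=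
    { obj := fun _ => SingleObj.star Γ
      map := fun {s t} γ => (F (s := s.1) (t := t.1) γ).unop
      map_id := fun s => by
        change (F (.refl (P.vert s.1))).unop = 1
        rw [hF1]; rfl
      map_comp := fun {s t u} γ δ => by
        change (F (Path.Homotopic.Quotient.trans _ _)).unop = _
        exact congrArg MulOpposite.unop (hF _ _) }
  refine ⟨Φ, fun s t q => ?_, fun Ψ hΨ => ?_⟩
  · change (F (P.edge _)).unop = _
    rw [hFc _ (P.edge_isEdge _), hcl' s t q.down]
    rfl
  · let F' : ∀ s t : P.Comp r, (s ⟶ t) → Γᵐᵒᵖ := fun s t γ => .op (Ψ.map γ : Γ)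
    have hF' : ∀ s t u (γ : s ⟶ t) (δ : t ⟶ u), F' s u (γ ≫ δ) = F' s t γ * F' t u δ := by
      intro s t u γ δ
      simp only [F', Ψ.map_comp]
      rfl
    let c' : ι → ι → Γᵐᵒᵖ := fun s t =>
      if h : ∃ (hs : Nonempty (Quotient (P.vert r) (P.vert s)))
        (ht : Nonempty (Quotient (P.vert r) (P.vert t))), P.rel s t then
        F' ⟨s, h.choose⟩ ⟨t, h.choose_spec.choose⟩ (P.edge h.choose_spec.choose_spec) else c s t
    have hcF : ∀ (s t : P.Comp r) (h : P.rel s.1 t.1), c' s.1 t.1 = F' s t (P.edge h) := by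
      intro s t hst
      simp only [c']
      rw [dif_pos ⟨s.2, t.2, hst⟩]
      rfl
    have hout : ∀ s t, ¬ (∃ (hs : Nonempty (Quotient (P.vert r) (P.vert s)))
        (ht : Nonempty (Quotient (P.vert r) (P.vert t))), P.rel s t) → c' s t = c s t :=
      fun s t h => dif_neg h
    have hc' : IsCocycle P.rel c' := by
      refine isCocycle_of_functor hF' hc hcF fun s t hs => hout s t ?_
      rintro ⟨h, -⟩
      exact hs.false h.some
    have hcc := (h Γᵐᵒᵖ).2 c' c hc' hc fun s t hst => by
      by_cases hx : ∃ (hs : Nonempty (Quotient (P.vert r) (P.vert s)))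
        (ht : Nonempty (Quotient (P.vert r) (P.vert t))), P.rel s t
      · obtain ⟨hs, ht, hr⟩ := hx
        have e1 := hcF ⟨s, hs⟩ ⟨t, ht⟩ hr
        have e2 := hcl' ⟨s, hs⟩ ⟨t, ht⟩ hst
        simp only at e1 e2
        rw [e1, e2]
        exact congrArg MulOpposite.op (hΨ ⟨s, hs⟩ ⟨t, ht⟩ ⟨hst⟩)
      · exact hout s t hx
    refine CategoryTheory.Functor.ext (fun _ => rfl) fun s t γ => ?_
    have := comp_functor_ext (F := F') (F' := fun s t γ => F (s := s.1) (t := t.1) γ) hF'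
      (fun s t u γ δ => hF _ _)
      (fun s t h => by rw [← hcF s t h, hcc _ _ h, hFc _ (P.edge_isEdge _)]) γ
    have := congrArg MulOpposite.unop this
    simp only [eqToHom_refl, Category.comp_id, Category.id_comp]
    exact this

theorem free_of_freeDatum (h : FreeDatum P.rel) (x : ↥(geomRealOn S)) :
    ∃ S' : Type, Nonempty (FundamentalGroup ↥(geomRealOn S) x ≃* FreeGroup S') := by
  obtain ⟨r, ⟨e⟩⟩ := exists_mulEquiv_vert (P := P) x
  obtain ⟨hf⟩ := nonempty_isFreeGroupoid h r
  have := IsFreeGroupoid.endIsFreeOfConnectedFree (P.base r)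
  exact ⟨_, ⟨e.trans (IsFreeGroup.mulEquiv _).symm⟩⟩

end PointSystem
end GeomReal
end Topology

/-- Involutions of a group. -/
def IsInvol {G : Type} [Group G] (s : G) : Prop := s ≠ 1 ∧ s * s = 1

/-- The commuting relation on the involutions in a set. -/
def invRel {G : Type} [Group G] (K : Set G) (s t : G) : Prop :=
  (s ∈ K ∧ IsInvol s) ∧ (t ∈ K ∧ IsInvol t) ∧ s * t = t * s

section Quillen

variable {G : Type} [Group G]

theorem isElementaryAbelian_closure {T : Set G} (h1 : ∀ a ∈ T, a * a = 1)
    (h2 : ∀ a ∈ T, ∀ b ∈ T, a * b = b * a) :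
    IsElementaryAbelian 2 ↥(Subgroup.closure T) := by
  have hc : ∀ a ∈ Subgroup.closure T, ∀ b ∈ Subgroup.closure T, a * b = b * a := by
    have := Subgroup.isMulCommutative_closure (k := T) h2
    intro a ha b hb
    exact congrArg Subtype.val (this.is_comm.comm ⟨a, ha⟩ ⟨b, hb⟩)
  suffices h : ∀ a ∈ Subgroup.closure T, a * a = 1 from
    ⟨fun a b => Subtype.ext (hc _ a.2 _ b.2), fun a => Subtype.ext <| by
      rw [pow_two]; exact h _ a.2⟩
  intro a ha
  induction ha using Subgroup.closure_induction with
  | mem x hx => exact h1 x hx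
  | one => simp
  | mul x y hx hy h h' =>
    rw [mul_assoc, ← mul_assoc y, ← hc x hx y hy, mul_assoc, h', mul_one, h]
  | inv x hx h => rw [← mul_inv_rev, h, inv_one]

theorem closure_mem_apSet {T : Set G} {s : G} (hs : s ∈ T) (hs1 : s ≠ 1) (h1 : ∀ a ∈ T, a * a = 1)
    (h2 : ∀ a ∈ T, ∀ b ∈ T, a * b = b * a) : Subgroup.closure T ∈ apSet 2 G := by
  refine ⟨fun h => hs1 ?_, isElementaryAbelian_closure h1 h2⟩
  exact Subgroup.mem_bot.1 (h ▸ Subgroup.subset_closure hs)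

theorem IsElementaryAbelian.comm_of_mem {H : Subgroup G} (h : IsElementaryAbelian 2 ↥H) {a b : G}
    (ha : a ∈ H) (hb : b ∈ H) : a * b = b * a :=
  congrArg Subtype.val (h.1 ⟨a, ha⟩ ⟨b, hb⟩)

theorem IsElementaryAbelian.mul_self_of_mem {H : Subgroup G} (h : IsElementaryAbelian 2 ↥H) {a : G}
    (ha : a ∈ H) : a * a = 1 := by
  have := congrArg Subtype.val (h.2 ⟨a, ha⟩)
  simpa [pow_two] using this

/-- The point system of the subgroups of order two. -/
noncomputable def involSystem (G : Type) [Group G] [Fintype (Subgroup G)] :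
    GeomReal.PointSystem (apSet 2 G) {s : G // IsInvol s} where
  pt s := ⟨Subgroup.closure {s.1}, closure_mem_apSet rfl s.2.1 (by simp [s.2.2]) (by simp)⟩
  eq_of_le s t h := by
    have hs : s.1 ∈ Subgroup.zpowers t.1 := by
      rw [Subgroup.zpowers_eq_closure]; exact h (Subgroup.subset_closure rfl)
    obtain ⟨k, hk⟩ := hs
    have ht : t.1 ^ (2 : ℤ) = 1 := by
      rw [zpow_two]; exact t.2.2
    apply Subtype.ext
    simp only at hk
    rcases Int.even_or_odd' k with ⟨m, rfl | rfl⟩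
    · rw [zpow_mul, ht, one_zpow] at hk
      exact absurd hk.symm s.2.1
    · rw [zpow_add, zpow_mul, ht, one_zpow, one_mul, zpow_one] at hk
      exact hk.symm
  exists_le a := by
    obtain ⟨s, hs⟩ := Subgroup.ne_bot_iff_exists_ne_one.1 a.2.1
    refine ⟨⟨s, fun h => hs (Subtype.ext h), a.2.2.mul_self_of_mem s.2⟩, ?_⟩
    simp
  exists_join s t a hs ht := by
    have hs' : s.1 ∈ a.1 := hs (Subgroup.subset_closure rfl)
    have ht' : t.1 ∈ a.1 := ht (Subgroup.subset_closure rfl)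
    refine ⟨⟨Subgroup.closure {s.1, t.1}, closure_mem_apSet (s := s.1) (by simp) s.2.1
      (by simp [s.2.2, t.2.2]) ?_⟩, ?_, ?_, fun b hb hb' => ?_⟩
    · have := a.2.2.comm_of_mem hs' ht'
      simp [this]
    · exact Subgroup.closure_mono (by simp)
    · exact Subgroup.closure_mono (by simp)
    · simp only [Subgroup.closure_le, Set.singleton_subset_iff, Set.insert_subset_iff] at hb hb' ⊢
      exact ⟨hb, hb'⟩
  rel s t := s.1 * t.1 = t.1 * s.1
  rel_iff s t := by
    constructor
    · intro h
      refine ⟨⟨Subgroup.closure {s.1, t.1}, closure_mem_apSet (s := s.1) (by simp) s.2.1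
        (by simp [s.2.2, t.2.2]) (by simp [h])⟩, ?_, ?_⟩
      · exact Subgroup.closure_mono (by simp)
      · exact Subgroup.closure_mono (by simp)
    · rintro ⟨a, hs, ht⟩
      exact a.2.2.comm_of_mem (hs (Subgroup.subset_closure rfl)) (ht (Subgroup.subset_closure rfl))
  flag s t u h1 h2 h3 := by
    refine ⟨⟨Subgroup.closure {s.1, t.1, u.1}, closure_mem_apSet (s := s.1) (by simp) s.2.1
      (by simp [s.2.2, t.2.2, u.2.2]) (by simp [h1, h2, h3])⟩, ?_, ?_, ?_⟩
    · exact Subgroup.closure_mono (by simp)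
    · exact Subgroup.closure_mono (by simp)
    · exact Subgroup.closure_mono (by simp)

theorem exists_freeGroup_of_invRel [Finite G]
    (h : SimplyConn (invRel (Set.univ : Set G)) ∨ FreeDatum (invRel (Set.univ : Set G)))
    (x : ↥(geomRealOn (apSet 2 G))) :
    ∃ S : Type, Nonempty (FundamentalGroup ↥(geomRealOn (apSet 2 G)) x ≃* FreeGroup S) := by
  classical
  have := Fintype.ofFinite (Subgroup G)
  obtain ⟨r, -⟩ := (involSystem G).exists_isConn x
  let g : G → {s : G // IsInvol s} := fun s => if h : IsInvol s then ⟨s, h⟩ else r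
  have hg : ∀ s (h : IsInvol s), g s = ⟨s, h⟩ := fun s h => dif_pos h
  have h1 : ∀ i j : {s : G // IsInvol s}, (involSystem G).rel i j ↔
      invRel (Set.univ : Set G) i.1 j.1 := fun i j =>
    ⟨fun h => ⟨⟨trivial, i.2⟩, ⟨trivial, j.2⟩, h⟩, fun h => h.2.2⟩
  have h2 : ∀ s t : G, invRel Set.univ s t → (involSystem G).rel (g s) (g t) := fun s t h => by
    rw [hg s h.1.2, hg t h.2.1.2]; exact h.2.2
  rcases h with h | h
  · exact GeomReal.PointSystem.free_of_simplyConn (P := involSystem G)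
      (h.comap (fun i => i.1) g (fun i j => (h1 i j).1) h2 fun i j _ => ⟨hg _ i.2, hg _ j.2⟩) x
  · exact GeomReal.PointSystem.free_of_freeDatum (P := involSystem G)
      (h.comap (fun i => i.1) g h1 h2 (fun i j _ => ⟨hg _ i.2, hg _ j.2⟩)
        fun v w h => by simp [hg v h.1.2, hg w h.2.1.2]) x

end Quillen

section CocycleTools

variable {V : Type} {R : V → V → Prop} {Γ : Type} [Group Γ] {c : V → V → Γ}

/-- A group-valued function on edges is a coboundary. -/
def IsCobound (R : V → V → Prop) (c : V → V → Γ) : Prop :=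
  ∃ h : V → Γ, ∀ s t, R s t → c s t = (h s)⁻¹ * h t

theorem IsCocycle.gauge (hc : IsCocycle R c) (h : V → Γ) :
    IsCocycle R fun s t => h s * c s t * (h t)⁻¹ := fun s t u h1 h2 h3 => by
  simp only [← hc s t u h1 h2 h3]; group

theorem isCobound_of_gauge (h : V → Γ)
    (hc : IsCobound R fun s t => h s * c s t * (h t)⁻¹) : IsCobound R c := by
  obtain ⟨k, hk⟩ := hc
  refine ⟨fun s => (k s) * h s, fun s t hst => ?_⟩
  have := hk s t hst
  calc c s t = (h s)⁻¹ * (h s * c s t * (h t)⁻¹) * h t := by group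
    _ = (h s)⁻¹ * ((k s)⁻¹ * k t) * h t := by rw [← this]
    _ = _ := by group

theorem IsCocycle.self (hc : IsCocycle R c) {s : V} (h : R s s) : c s s = 1 :=
  mul_eq_left.1 (hc s s s h h h)

theorem IsCocycle.inv (hc : IsCocycle R c) {s t : V} (hs : R s s) (h : R s t) (h' : R t s) :
    c t s = (c s t)⁻¹ :=
  (inv_eq_of_mul_eq_one_right ((hc s t s h h' hs).trans (hc.self hs))).symm

theorem IsCocycle.square_eq (hc : IsCocycle R c) {a b x y : V} (hax : R a x) (hxb : R x b)
    (hay : R a y) (hyb : R y b) (hxy : R x y) : c a x * c x b = c a y * c y b := by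
  rw [← hc x y b hxy hyb hxb, ← mul_assoc, hc a x y hax hxy hay]

theorem IsCocycle.isCobound_of_square (hc : IsCocycle R c) (hrefl : ∀ s, R s s)
    (hsymm : ∀ s t, R s t → R t s)
    (hsq : ∀ a b x y, R a x → R x b → R a y → R y b → c a x * c x b = c a y * c y b)
    (hcov : ∀ a v w, R v w → ∃ u, R u a ∧ R u v ∧ R u w) : IsCobound R c := by
  rcases isEmpty_or_nonempty V with hV | ⟨⟨r⟩⟩
  · exact ⟨fun _ => 1, fun s => hV.elim s⟩
  choose u hur huv _ using fun v => hcov r v v (hrefl v)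
  have key : ∀ v x, R x r → R x v → c r (u v) * c (u v) v = c r x * c x v := fun v x h1 h2 =>
    hsq _ _ _ _ (hsymm _ _ (hur v)) (huv v) (hsymm _ _ h1) h2
  refine ⟨fun v => c r (u v) * c (u v) v, fun v w hvw => ?_⟩
  obtain ⟨x, hr, hv, hw⟩ := hcov r v w hvw
  simp only [key v x hr hv, key w x hr hw, ← hc x v w hv hvw hw]
  group

theorem IsCocycle.isCobound_of_retract (hc : IsCocycle R c)
    (hsymm : ∀ s t, R s t → R t s) (hself : ∀ s t, R s t → R s s) (T : Set V)
    (hT : IsCobound (fun s t => s ∈ T ∧ t ∈ T ∧ R s t) c) (a : V → V)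
    (ha : ∀ s, R s s → a s ∈ T ∧ R s (a s) ∧ ∀ b ∈ T, R s b → R b (a s))
    (hfill : ∀ s s', R s s' → ∃ d, R s d ∧ R d s' ∧ (∃ b ∈ T, R b s ∧ R b d) ∧
      ∃ b ∈ T, R b d ∧ R b s') : IsCobound R c := by
  obtain ⟨k, hk⟩ := hT
  refine isCobound_of_gauge k ?_
  set e : V → V → Γ := fun s t => k s * c s t * (k t)⁻¹ with he
  have hec : IsCocycle R e := hc.gauge k
  have heT : ∀ s ∈ T, ∀ t ∈ T, R s t → e s t = 1 := fun s hs t ht hst => by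
    simp only [he, hk s t ⟨hs, ht, hst⟩]; group
  have h1 : ∀ s b, b ∈ T → R s b → e s b = e s (a s) := fun s b hb hsb => by
    obtain ⟨h1, h2, h3⟩ := ha s (hself _ _ hsb)
    rw [← hec s b (a s) hsb (h3 b hb hsb) h2, heT b hb _ h1 (h3 b hb hsb), mul_one]
  have h2 : ∀ s s', R s s' → (∃ b ∈ T, R b s ∧ R b s') → e s s' = e s (a s) * (e s' (a s'))⁻¹ := by
    rintro s s' hs ⟨b, hb, hbs, hbs'⟩
    rw [← hec s b s' (hsymm _ _ hbs) hbs' hs, ← h1 s b hb (hsymm _ _ hbs),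
      ← h1 s' b hb (hsymm _ _ hbs'), hec.inv (hself _ _ (hsymm _ _ hbs')) (hsymm _ _ hbs') hbs']
  refine ⟨fun s => (e s (a s))⁻¹, fun s s' hs => ?_⟩
  obtain ⟨d, hsd, hds, hb, hb'⟩ := hfill s s' hs
  rw [← hec s d s' hsd hds hs, h2 s d hsd hb, h2 d s' hds hb']
  group

end CocycleTools

section InvRel

variable {G : Type} [Group G]

theorem invRel.symm {K : Set G} {s t : G} (h : invRel K s t) : invRel K t s :=
  ⟨h.2.1, h.1, h.2.2.symm⟩

theorem invRel.self_left {K : Set G} {s t : G} (h : invRel K s t) : invRel K s s :=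
  ⟨h.1, h.1, rfl⟩

theorem invRel.mono {K K' : Set G} (hK : K ⊆ K') {s t : G} (h : invRel K s t) : invRel K' s t :=
  ⟨⟨hK h.1.1, h.1.2⟩, ⟨hK h.2.1.1, h.2.1.2⟩, h.2.2⟩

theorem IsInvol.mul {s t : G} (hs : IsInvol s) (ht : IsInvol t) (h : s * t = t * s)
    (hne : s ≠ t) : IsInvol (s * t) := by
  refine ⟨fun h1 => hne ?_, ?_⟩
  · rw [← mul_left_inj t, h1, ht.2]
  · calc s * t * (s * t) = s * t * (t * s) := by rw [h]
      _ = s * (t * t) * s := by group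
      _ = 1 := by rw [ht.2, mul_one, hs.2]

theorem IsInvol.inv_eq {s : G} (hs : IsInvol s) : s⁻¹ = s := inv_eq_of_mul_eq_one_left hs.2

/-- A nontrivial elementary abelian 2-subset normalized by all involutions of a set. -/
structure IsNormalEA (O K : Set G) : Prop where
  subset : O ⊆ K
  sq : ∀ o ∈ O, o * o = 1
  comm : ∀ o ∈ O, ∀ o' ∈ O, o * o' = o' * o
  mul_mem : ∀ o ∈ O, ∀ o' ∈ O, o * o' ∈ O
  exists_ne : ∃ o ∈ O, o ≠ 1
  conj_mem : ∀ s ∈ K, s * s = 1 → ∀ o ∈ O, s * o * s ∈ O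

theorem IsNormalEA.exists_comm {O K : Set G} (h : IsNormalEA O K) {s t : G}
    (hs : s ∈ K) (hs2 : s * s = 1) (ht : t ∈ K) (ht2 : t * t = 1) (hst : s * t = t * s) :
    ∃ o ∈ O, IsInvol o ∧ s * o = o * s ∧ t * o = o * t := by
  have step : ∀ s, s ∈ K → s * s = 1 → ∀ o ∈ O, o ≠ 1 → ∃ o' ∈ O, o' ≠ 1 ∧ s * o' = o' * s ∧
      ∀ t, t * o = o * t → t * s = s * t → t * o' = o' * t := by
    intro s hs hs2 o ho ho1
    by_cases h1 : o * (s * o * s) = 1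
    · refine ⟨o, ho, ho1, ?_, fun t h _ => h⟩
      have : o * (o * (s * o * s)) = o := by rw [h1, mul_one]
      rw [← mul_assoc, h.sq o ho, one_mul] at this
      nth_rw 2 [← this]
      rw [mul_assoc, hs2, mul_one]
    · refine ⟨_, h.mul_mem o ho _ (h.conj_mem s hs hs2 o ho), h1, ?_, fun t h1 h2 => ?_⟩
      · have := h.comm o ho _ (h.conj_mem s hs hs2 o ho)
        calc s * (o * (s * o * s)) = s * (s * o * s * o) := by rw [this]
          _ = s * s * (o * s * o) := by group
          _ = o * s * o * (s * s) := by rw [hs2, one_mul, mul_one]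
          _ = o * (s * o * s) * s := by group
      · have h3 : Commute t o := h1
        have h4 : Commute t s := h2
        exact (h3.mul_right ((h4.mul_right h3).mul_right h4)).eq
  obtain ⟨o, ho, ho1⟩ := h.exists_ne
  obtain ⟨o1, h1, h1', h1s, -⟩ := step s hs hs2 o ho ho1
  obtain ⟨o2, h2, h2', h2t, h2s⟩ := step t ht ht2 o1 h1 h1'
  exact ⟨o2, h2, ⟨h2', h.sq _ h2⟩, h2s s h1s hst, h2t⟩

theorem IsNormalEA.simplyConn {O K : Set G} (h : IsNormalEA O K) : SimplyConn (invRel K) := by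
  classical
  intro Γ _ c hc
  obtain ⟨o, ho, ho1⟩ := h.exists_ne
  have hO : ∀ x ∈ O, x ≠ 1 → ∀ y ∈ O, y ≠ 1 → invRel K x y := fun x hx hx1 y hy hy1 =>
    ⟨⟨h.subset hx, hx1, h.sq x hx⟩, ⟨h.subset hy, hy1, h.sq y hy⟩, h.comm x hx y hy⟩
  have ex : ∀ s : G, ∃ a, invRel K s s → a ∈ {x | x ∈ O ∧ x ≠ 1} ∧ invRel K s a := by
    intro s
    by_cases hs : invRel K s s
    · obtain ⟨a, ha, ha1, has, -⟩ := h.exists_comm hs.1.1 hs.1.2.2 hs.1.1 hs.1.2.2 rfl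
      exact ⟨a, fun _ => ⟨⟨ha, ha1.1⟩, ⟨hs.1, ⟨h.subset ha, ha1⟩, has⟩⟩⟩
    · exact ⟨1, fun h => absurd h hs⟩
  choose a ha using ex
  refine hc.isCobound_of_retract (fun _ _ => invRel.symm) (fun _ _ => invRel.self_left)
    {x | x ∈ O ∧ x ≠ 1} ⟨fun x => c o x, fun x y hxy => ?_⟩ a
      (fun s hs => ⟨(ha s hs).1, (ha s hs).2,
      fun b hb _ => hO _ hb.1 hb.2 _ (ha s hs).1.1 (ha s hs).1.2⟩) fun s t hst => ?_
  · simp only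
    rw [← hc o x y (hO _ ho ho1 _ hxy.1.1 hxy.1.2) hxy.2.2 (hO _ ho ho1 _ hxy.2.1.1 hxy.2.1.2)]
    group
  · obtain ⟨b, hb, hb1, hbs, hbt⟩ := h.exists_comm hst.1.1 hst.1.2.2 hst.2.1.1 hst.2.1.2.2 hst.2.2
    have h1 : invRel K b s := ⟨⟨h.subset hb, hb1⟩, hst.1, hbs.symm⟩
    exact ⟨s, hst.self_left, hst, ⟨b, ⟨hb, hb1.1⟩, h1, h1⟩,
      ⟨b, ⟨hb, hb1.1⟩, h1, ⟨⟨h.subset hb, hb1⟩, hst.2.1, hbt.symm⟩⟩⟩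

theorem exists_cocycle_extension {L : Subgroup G} (hL : ∀ t t', t ∉ L → t' ∉ L → IsInvol t →
    IsInvol t' → t * t' = t' * t → t * t' ∈ L) {Γ : Type} [Group Γ] {c : G → G → Γ}
    (hc : IsCocycle (invRel (L : Set G)) c) (h : G → G → Γ)
    (hh : ∀ t, t ∉ L → IsInvol t → ∀ s s', invRel (L : Set G) s s' → t * s = s * t →
      t * s' = s' * t → h t s * c s s' = h t s') :
    ∃ c' : G → G → Γ, IsCocycle (invRel Set.univ) c' ∧
      (∀ s s', invRel (L : Set G) s s' → c' s s' = c s s') ∧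
      ∀ t s, t ∉ L → s ∈ L → c' t s = h t s := by
  classical
  let c' : G → G → Γ := fun x y =>
    if x ∈ L then if y ∈ L then c x y else (h y x)⁻¹
    else if y ∈ L then h x y else if x = y then 1 else h x (x * y) * (h y (x * y))⁻¹
  have cLL : ∀ x y, x ∈ L → y ∈ L → c' x y = c x y := fun x y hx hy => by simp [c', hx, hy]
  have cLO : ∀ x y, x ∈ L → y ∉ L → c' x y = (h y x)⁻¹ := fun x y hx hy => by simp [c', hx, hy]
  have cOL : ∀ x y, x ∉ L → y ∈ L → c' x y = h x y := fun x y hx hy => by simp [c', hx, hy]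
  have cOO : ∀ x z w, x ∉ L → z ∉ L → IsInvol x → IsInvol z → x * z = z * x →
      w ∈ L → IsInvol w → x * w = w * x → z * w = w * z → c' x z = h x w * (h z w)⁻¹ := by
    intro x z w hx hz hx2 hz2 hxz hw hw2 hxw hzw
    by_cases e : x = z
    · subst e; simp [c', hx]
    · simp only [c', hx, hz, e, if_false]
      have hr : invRel (L : Set G) (x * z) w :=
        ⟨⟨hL x z hx hz hx2 hz2 hxz, hx2.mul hz2 hxz e⟩, ⟨hw, hw2⟩, by
          rw [mul_assoc, hzw, ← mul_assoc, hxw, mul_assoc]⟩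
      rw [← hh x hx hx2 _ _ hr (by rw [hxz, ← mul_assoc, hxz]) hxw,
        ← hh z hz hz2 _ _ hr (by rw [← mul_assoc, hxz]) hzw]
      group
  refine ⟨c', ?_, fun s s' hs => cLL _ _ hs.1.1 hs.2.1.1, fun t s ht hs => cOL t s ht hs⟩
  rintro x y z ⟨⟨-, hx⟩, ⟨-, hy⟩, hxy⟩ ⟨-, ⟨-, hz⟩, hyz⟩ ⟨-, -, hxz⟩
  by_cases hxL : x ∈ L <;> by_cases hyL : y ∈ L <;> by_cases hzL : z ∈ L
  · rw [cLL _ _ hxL hyL, cLL _ _ hyL hzL, cLL _ _ hxL hzL]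
    exact hc _ _ _ ⟨⟨hxL, hx⟩, ⟨hyL, hy⟩, hxy⟩ ⟨⟨hyL, hy⟩, ⟨hzL, hz⟩, hyz⟩
      ⟨⟨hxL, hx⟩, ⟨hzL, hz⟩, hxz⟩
  · rw [cLL _ _ hxL hyL, cLO _ _ hyL hzL, cLO _ _ hxL hzL,
      ← hh z hzL hz x y ⟨⟨hxL, hx⟩, ⟨hyL, hy⟩, hxy⟩ hxz.symm hyz.symm]
    group
  · rw [cLO _ _ hxL hyL, cOL _ _ hyL hzL, cLL _ _ hxL hzL,
      ← hh y hyL hy x z ⟨⟨hxL, hx⟩, ⟨hzL, hz⟩, hxz⟩ hxy.symm hyz]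
    group
  · rw [cLO _ _ hxL hyL, cOO y z x hyL hzL hy hz hyz hxL hx hxy.symm hxz.symm, cLO _ _ hxL hzL]
    group
  · rw [cOL _ _ hxL hyL, cOL _ _ hxL hzL, cLL _ _ hyL hzL]
    exact hh x hxL hx y z ⟨⟨hyL, hy⟩, ⟨hzL, hz⟩, hyz⟩ hxy hxz
  · rw [cOL _ _ hxL hyL, cLO _ _ hyL hzL, cOO x z y hxL hzL hx hz hxz hyL hy hxy hyz.symm]
  · rw [cOL _ _ hxL hzL, cOL _ _ hyL hzL, cOO x y z hxL hyL hx hy hxy hzL hz hxz hyz]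
    group
  · by_cases e1 : x = y
    · subst e1; simp [c', hxL]
    by_cases e2 : y = z
    · subst e2; simp [c', hyL]
    have hc1 : ∀ a b d : G, a * d = d * a → b * d = d * b → (a * b) * d = d * (a * b) :=
      fun a b d h1 h2 => (Commute.mul_left (show Commute a d from h1) h2).eq
    have w1 := hL x y hxL hyL hx hy hxy
    have w2 := hL y z hyL hzL hy hz hyz
    have i1 := hx.mul hy hxy e1
    have i2 := hy.mul hz hyz e2
    have r : invRel (L : Set G) (x * y) (y * z) :=
      ⟨⟨w1, i1⟩, ⟨w2, i2⟩, hc1 _ _ _ (hc1 _ _ _ hxy.symm hxz.symm).symm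
        (hc1 _ _ _ rfl hyz.symm).symm⟩
    have x1 := (hc1 x y x rfl hxy.symm).symm
    have x2 := (hc1 y z x hxy.symm hxz.symm).symm
    have y1 := (hc1 x y y hxy rfl).symm
    have y2 := (hc1 y z y rfl hyz.symm).symm
    have z2 := (hc1 y z z hyz rfl).symm
    rw [cOO x y _ hxL hyL hx hy hxy w1 i1 x1 y1, cOO y z _ hyL hzL hy hz hyz w2 i2 y2 z2,
      cOO x z _ hxL hzL hx hz hxz w2 i2 x2 z2, ← hh x hxL hx _ _ r x1 x2, ← hh y hyL hy _ _ r y1 y2]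
    group

end InvRel

section InvRel

variable {G : Type} [Group G]

theorem freeDatum_of_rank_le_two {L : Subgroup G} (hL : ∀ s t u, invRel (L : Set G) s t →
    invRel (L : Set G) t u → invRel (L : Set G) s u → s ≠ t → t ≠ u → s ≠ u → u = s * t) :
    FreeDatum (invRel (L : Set G)) := by
  classical
  obtain ⟨hlin, -⟩ := exists_wellFoundedLT G
  let m : G → G → G := fun s t => min (min s t) (s * t)
  have m_comm : ∀ s t : G, s * t = t * s → m s t = m t s := fun s t h => by
    simp only [m, min_comm s t, h]
  have mem : ∀ s t, m s t = s ∨ m s t = t ∨ m s t = s * t := fun s t => by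
    simp only [m]
    rcases min_choice (min s t) (s * t) with h | h <;> rw [h]
    · rcases min_choice s t with h | h <;> rw [h] <;> simp
    · simp
  have m_mul : ∀ s t : G, IsInvol s → m s (s * t) = m s t := fun s t hs => by
    simp only [m, ← mul_assoc, hs.2, one_mul]
    rw [min_assoc, min_assoc, min_comm t]
  have m_mul' : ∀ s t : G, IsInvol t → s * t = t * s → m t (s * t) = m s t := fun s t ht h => by
    rw [h, m_mul t s ht, m_comm _ _ h.symm]
  have hmul : ∀ {s t : G}, invRel (L : Set G) s t → s ≠ t → invRel (L : Set G) s (s * t) :=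
    fun {s t} h hne => ⟨h.1, ⟨mul_mem h.1.1 h.2.1.1, h.1.2.mul h.2.1.2 h.2.2 hne⟩, by
      rw [h.2.2, ← mul_assoc, h.2.2]⟩
  have key : ∀ s t u, invRel (L : Set G) s t → invRel (L : Set G) t u → invRel (L : Set G) s u →
      s ≠ t → t ≠ u → s ≠ u → m s t = m t u ∧ m s t = m s u := by
    intro s t u h1 h2 h3 e1 e2 e3
    obtain rfl := hL s t u h1 h2 h3 e1 e2 e3
    exact ⟨(m_mul' s t h1.2.1.2 h1.2.2).symm, (m_mul s t h1.1.2).symm⟩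
  refine ⟨fun s t => invRel (L : Set G) s t ∧ s ≠ t ∧ m s t = s, fun _ _ h => h.1,
    fun Γ _ => ⟨fun l => ?_, fun c c' hc hc' hcc s t hst => ?_⟩⟩
  · let k : G → G → Γ := fun a x => if x = a then 1 else l a x
    refine ⟨fun s t => (k (m s t) s)⁻¹ * k (m s t) t, fun s t u h1 h2 h3 => ?_, fun s t h => ?_⟩
    · simp only
      by_cases e1 : s = t
      · subst e1; simp
      by_cases e2 : t = u
      · subst e2; simp
      by_cases e3 : s = u
      · subst e3
        rw [m_comm _ _ h1.2.2]; group
      obtain ⟨e4, e5⟩ := key s t u h1 h2 h3 e1 e2 e3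
      rw [← e4, ← e5]; group
    · simp [k, h.2.2, h.2.1.symm]
  · by_cases e : s = t
    · subst e; rw [hc.self hst, hc'.self hst]
    have aux : ∀ a x, invRel (L : Set G) a x → (a ≠ x → m a x = a) → c a x = c' a x := by
      intro a x h1 h2
      by_cases e : a = x
      · subst e; rw [hc.self h1, hc'.self h1]
      · exact hcc _ _ ⟨h1, e, h2 e⟩
    have ⟨h1, h2, h3, h4⟩ : invRel (L : Set G) (m s t) s ∧ invRel (L : Set G) (m s t) t ∧
        (m s t ≠ s → m (m s t) s = m s t) ∧ (m s t ≠ t → m (m s t) t = m s t) := by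
      rcases mem s t with h | h | h
      · rw [h]; exact ⟨hst.self_left, hst, fun h => absurd rfl h, fun _ => h⟩
      · rw [h]; exact ⟨hst.symm, hst.symm.self_left, fun _ => by rw [← m_comm _ _ hst.2.2, h],
          fun h => absurd rfl h⟩
      · have h1 := hmul hst e
        have h2 := hmul hst.symm (Ne.symm e)
        rw [← hst.2.2] at h2
        rw [h]
        refine ⟨h1.symm, h2.symm, fun _ => ?_, fun _ => ?_⟩
        · rw [← m_comm _ _ h1.2.2, m_mul _ _ hst.1.2, h]
        · rw [← m_comm _ _ h2.2.2, m_mul' _ _ hst.2.1.2 hst.2.2, h]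
    rw [← hc s _ t h1.symm h2 hst, ← hc' s _ t h1.symm h2 hst,
      hc.inv h1.self_left h1 h1.symm, hc'.inv h1.self_left h1 h1.symm, aux _ _ h1 h3, aux _ _ h2 h4]

/-- The centralizer of an element in a subgroup, as a set. -/
def centIn (L : Subgroup G) (t : G) : Set G := {s | s ∈ L ∧ t * s = s * t}

theorem freeDatum_of_extension {L : Subgroup G} (hmul : ∀ t t', t ∉ L → t' ∉ L → IsInvol t →
    IsInvol t' → t * t' = t' * t → t * t' ∈ L) (hL : FreeDatum (invRel (L : Set G)))
    (hcent : ∀ t, t ∉ L → IsInvol t →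
      (SimplyConn (invRel (centIn L t)) ∧ ∃ s₀, invRel (centIn L t) s₀ s₀ ∧
        ∀ s, invRel (centIn L t) s s → Relation.ReflTransGen (invRel (centIn L t)) s₀ s) ∨
      ∀ s s', invRel (centIn L t) s s' → s = s') :
    FreeDatum (invRel (Set.univ : Set G)) := by
  classical
  obtain ⟨Q, hQ, hL⟩ := hL
  have ex : ∀ t, ∃ s₀, t ∉ L → IsInvol t →
      (SimplyConn (invRel (centIn L t)) ∧ invRel (centIn L t) s₀ s₀ ∧
        ∀ s, invRel (centIn L t) s s → Relation.ReflTransGen (invRel (centIn L t)) s₀ s) ∨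
      ∀ s s', invRel (centIn L t) s s' → s = s' := by
    intro t
    by_cases h : t ∉ L ∧ IsInvol t
    · rcases hcent t h.1 h.2 with ⟨h1, s₀, h2⟩ | h1
      · exact ⟨s₀, fun _ _ => .inl ⟨h1, h2⟩⟩
      · exact ⟨1, fun _ _ => .inr h1⟩
    · exact ⟨1, fun h1 h2 => absurd ⟨h1, h2⟩ h⟩
  choose b hb using ex
  have hin : ∀ {t s s'}, invRel (L : Set G) s s' → t * s = s * t → t * s' = s' * t →
      invRel (centIn L t) s s' := fun h h1 h2 => ⟨⟨⟨h.1.1, h1⟩, h.1.2⟩, ⟨⟨h.2.1.1, h2⟩, h.2.1.2⟩,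
        h.2.2⟩
  refine ⟨fun s t => Q s t ∨ (s ∉ L ∧ IsInvol s ∧ invRel (centIn L s) t t ∧
    ((∀ x y, invRel (centIn L s) x y → x = y) ∨ t = b s)), fun s t h => ?_, fun Γ _ =>
    ⟨fun l => ?_, fun c c' hc hc' hcc => ?_⟩⟩
  · rcases h with h | ⟨h1, h2, h3, -⟩
    · exact (hQ _ _ h).mono (Set.subset_univ _)
    · exact ⟨⟨trivial, h2⟩, ⟨trivial, h3.1.2⟩, h3.1.1.2⟩
  · obtain ⟨c, hc, hcl⟩ := (hL Γ).1 l
    have ex : ∀ t, ∃ f : G → Γ, t ∉ L → IsInvol t →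
        (∀ s s', invRel (centIn L t) s s' → f s * c s s' = f s') ∧
        ∀ s, invRel (centIn L t) s s →
          ((∀ x y, invRel (centIn L t) x y → x = y) ∨ s = b t) → f s = l t s := by
      intro t
      by_cases h : t ∉ L ∧ IsInvol t
      · have hct : IsCocycle (invRel (centIn L t)) c := fun x y z h1 h2 h3 =>
          hc x y z (h1.mono fun _ h => h.1) (h2.mono fun _ h => h.1) (h3.mono fun _ h => h.1)
        by_cases h' : ∀ s s', invRel (centIn L t) s s' → s = s'
        · refine ⟨l t, fun _ _ => ⟨fun s s' hs => ?_, fun _ _ _ => rfl⟩⟩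
          obtain rfl := h' s s' hs
          rw [hct.self hs, mul_one]
        · obtain ⟨h1, -⟩ := (hb t h.1 h.2).resolve_right h'
          obtain ⟨k, hk⟩ := h1 Γ c hct
          refine ⟨fun s => l t (b t) * (k (b t))⁻¹ * k s, fun _ _ => ⟨fun s s' hs => ?_, ?_⟩⟩
          · rw [hk s s' hs]; group
          · rintro s - (h | rfl)
            · exact absurd h h'
            · group
      · exact ⟨1, fun h1 h2 => absurd ⟨h1, h2⟩ h⟩
    choose f hf using ex
    obtain ⟨c', hc', h1, h2⟩ := exists_cocycle_extension hmul hc f fun t ht ht2 s s' hs h1 h2 =>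
      (hf t ht ht2).1 s s' (hin hs h1 h2)
    refine ⟨c', hc', ?_⟩
    rintro s t (h | ⟨h3, h4, h5, h6⟩)
    · rw [h1 _ _ (hQ _ _ h), hcl _ _ h]
    · rw [h2 _ _ h3 h5.1.1.1, (hf s h3 h4).2 t h5 h6]
  · have hLL : ∀ s t, invRel (L : Set G) s t → c s t = c' s t :=
      (hL Γ).2 c c' (fun x y z h1 h2 h3 => hc x y z (h1.mono (Set.subset_univ _))
        (h2.mono (Set.subset_univ _)) (h3.mono (Set.subset_univ _)))
        (fun x y z h1 h2 h3 => hc' x y z (h1.mono (Set.subset_univ _))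
        (h2.mono (Set.subset_univ _)) (h3.mono (Set.subset_univ _))) fun s t h => hcc s t (.inl h)
    have hto : ∀ {t s}, IsInvol t → invRel (centIn L t) s s → invRel Set.univ t s :=
      fun ht hs => ⟨⟨trivial, ht⟩, ⟨trivial, hs.1.2⟩, hs.1.1.2⟩
    have hOL : ∀ t s, t ∉ L → IsInvol t → invRel (centIn L t) s s → c t s = c' t s := by
      intro t s ht ht2 hs
      by_cases h' : ∀ s s', invRel (centIn L t) s s' → s = s'
      · exact hcc t s (.inr ⟨ht, ht2, hs, .inl h'⟩)
      · obtain ⟨-, h1, h2⟩ := (hb t ht ht2).resolve_right h'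
        have := h2 s hs
        clear hs
        induction this with
        | refl => exact hcc t _ (.inr ⟨ht, ht2, h1, .inr rfl⟩)
        | tail h3 h4 ih =>
          rw [← hc _ _ _ (hto ht2 h4.self_left) (h4.mono (Set.subset_univ _))
            (hto ht2 h4.symm.self_left), ← hc' _ _ _ (hto ht2 h4.self_left)
            (h4.mono (Set.subset_univ _)) (hto ht2 h4.symm.self_left), ih,
            hLL _ _ (h4.mono fun _ h => h.1)]
    have hO : ∀ t s, t ∉ L → IsInvol t → s ∈ L → invRel Set.univ t s → c t s = c' t s :=
      fun t s h1 h2 h3 h4 => hOL t s h1 h2 ⟨⟨⟨h3, h4.2.2⟩, h4.2.1.2⟩, ⟨⟨h3, h4.2.2⟩, h4.2.1.2⟩, rfl⟩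
    have hO' : ∀ t s, t ∉ L → IsInvol t → s ∈ L → invRel Set.univ t s → c s t = c' s t :=
      fun t s h1 h2 h3 h4 => by
        rw [hc.inv h4.self_left h4 h4.symm, hc'.inv h4.self_left h4 h4.symm, hO t s h1 h2 h3 h4]
    intro s t hst
    by_cases hs : s ∈ L <;> by_cases ht : t ∈ L
    · exact hLL _ _ ⟨⟨hs, hst.1.2⟩, ⟨ht, hst.2.1.2⟩, hst.2.2⟩
    · exact hO' t s ht hst.2.1.2 hs hst.symm
    · exact hO s t hs hst.1.2 ht hst
    · by_cases e : s = t
      · subst e; rw [hc.self hst, hc'.self hst]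
      have hw := hst.1.2.mul hst.2.1.2 hst.2.2 e
      have hwL := hmul s t hs ht hst.1.2 hst.2.1.2 hst.2.2
      have h1 : invRel Set.univ s (s * t) :=
        ⟨hst.1, ⟨trivial, hw⟩, by rw [hst.2.2, ← mul_assoc, hst.2.2]⟩
      have h2 : invRel Set.univ t (s * t) :=
        ⟨hst.2.1, ⟨trivial, hw⟩, by rw [← mul_assoc, hst.2.2]⟩
      rw [← hc _ _ _ h1 h2.symm hst, ← hc' _ _ _ h1 h2.symm hst, hO s _ hs hst.1.2 hwL h1,
        hO' t _ ht hst.2.1.2 hwL h2]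

variable {H : Type} [Group H]

theorem isInvol_map_iff {φ : H →* G} (hφ : Injective φ) {s : H} : IsInvol (φ s) ↔ IsInvol s := by
  simp only [IsInvol, ← map_mul, Ne, map_eq_one_iff φ hφ]

theorem invRel_image_iff {φ : H →* G} (hφ : Injective φ) {K : Set H} {s t : H} :
    invRel (φ '' K) (φ s) (φ t) ↔ invRel K s t := by
  simp only [invRel, isInvol_map_iff hφ, hφ.mem_set_image, ← map_mul, hφ.eq_iff]

theorem simplyConn_image {φ : H →* G} (hφ : Injective φ) {K : Set H} :
    SimplyConn (invRel (φ '' K)) ↔ SimplyConn (invRel K) := by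
  have h1 : ∀ v w, invRel (φ '' K) v w → φ (invFun φ v) = v ∧ φ (invFun φ w) = w := by
    rintro v w ⟨⟨⟨v, hv, rfl⟩, -⟩, ⟨⟨w, hw, rfl⟩, -⟩, -⟩
    simp only [leftInverse_invFun hφ _, and_self]
  have h2 : ∀ v w, invRel (φ '' K) v w → invRel K (invFun φ v) (invFun φ w) := by
    intro v w h
    rwa [← invRel_image_iff hφ, (h1 v w h).1, (h1 v w h).2]
  have h3 : ∀ i j, invRel K i j → invRel (φ '' K) (φ i) (φ j) := fun _ _ => (invRel_image_iff hφ).2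
  exact ⟨fun h => h.comap φ (invFun φ) h3 h2 fun i j _ =>
    ⟨leftInverse_invFun hφ i, leftInverse_invFun hφ j⟩, fun h => h.comap (invFun φ) φ h2 h3 h1⟩

theorem freeDatum_of_image {φ : H →* G} (hφ : Injective φ) {K : Set H}
    (h : FreeDatum (invRel (φ '' K))) : FreeDatum (invRel K) := by
  have h1 : ∀ v w, invRel (φ '' K) v w → φ (invFun φ v) = v ∧ φ (invFun φ w) = w := by
    rintro v w ⟨⟨⟨v, hv, rfl⟩, -⟩, ⟨⟨w, hw, rfl⟩, -⟩, -⟩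
    simp only [leftInverse_invFun hφ _, and_self]
  exact h.comap φ (invFun φ) (fun _ _ => (invRel_image_iff hφ).symm) (fun v w h => by
    rwa [← invRel_image_iff hφ, (h1 v w h).1, (h1 v w h).2])
    (fun i j _ => ⟨leftInverse_invFun hφ i, leftInverse_invFun hφ j⟩) h1

end InvRel

section Symmetric

open Equiv Equiv.Perm

variable {α : Type} [DecidableEq α]

theorem isInvol_swap {i j : α} (h : i ≠ j) : IsInvol (swap i j) :=
  ⟨fun h1 => h (swap_eq_one_iff.1 h1), swap_mul_self i j⟩

theorem mul_swap_of_fix {g : Perm α} {i j : α} (hi : g i = i) (hj : g j = j) :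
    g * swap i j = swap i j * g := by
  rw [mul_swap_eq_swap_mul, hi, hj]

theorem mul_swap_of_flip {g : Perm α} {i j : α} (hi : g i = j) (hj : g j = i) :
    g * swap i j = swap i j * g := by
  rw [mul_swap_eq_swap_mul, hi, hj, swap_comm]

theorem mul_double_of_map {g : Perm α} {i j k l : α} (hi : g i = k) (hj : g j = l) (hk : g k = i)
    (hl : g l = j) (h : swap i j * swap k l = swap k l * swap i j) :
    g * (swap i j * swap k l) = swap i j * swap k l * g := by
  have h1 : g * swap i j = swap k l * g := by rw [mul_swap_eq_swap_mul, hi, hj]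
  have h2 : g * swap k l = swap i j * g := by rw [mul_swap_eq_swap_mul, hk, hl]
  rw [← mul_assoc, h1, mul_assoc, h2, ← mul_assoc, h]

theorem swap_comm_of_ne {i j k l : α} (h1 : i ≠ k) (h2 : i ≠ l) (h3 : j ≠ k) (h4 : j ≠ l) :
    swap i j * swap k l = swap k l * swap i j :=
  mul_swap_of_fix (swap_apply_of_ne_of_ne h1.symm h3.symm) (swap_apply_of_ne_of_ne h2.symm h4.symm)

theorem isInvol_double {i j k l : α} (hij : i ≠ j) (h1 : i ≠ k) (h2 : i ≠ l) (h3 : j ≠ k)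
    (h4 : j ≠ l) (hkl : k ≠ l) : IsInvol (swap i j * swap k l) :=
  (isInvol_swap hij).mul (isInvol_swap hkl) (swap_comm_of_ne h1 h2 h3 h4) fun h => by
    have := congrArg (· i) h
    simp only [swap_apply_left, swap_apply_of_ne_of_ne h1 h2] at this
    exact hij this.symm

theorem IsInvol.apply_apply {β : Type} {s : Perm β} (h : IsInvol s) (i : β) : s (s i) = i := by
  have := congrArg (· i) h.2
  simpa using this

theorem IsInvol.exists_ne {β : Type} {s : Perm β} (h : IsInvol s) : ∃ i, s i ≠ i := by
  by_contra! h'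
  exact h.1 (Equiv.ext h')

theorem apply_comm {β : Type} {s t : Perm β} (h : s * t = t * s) (i : β) : s (t i) = t (s i) :=
  congrArg (· i) h

theorem swap_eq_of_flip {b : Perm α} (hb : b.IsSwap) {i : α} (h : b i ≠ i) : b = swap i (b i) := by
  obtain ⟨j, k, hjk, rfl⟩ := hb
  rcases eq_or_ne i j with rfl | hj
  · rw [swap_apply_left]
  rcases eq_or_ne i k with rfl | hk
  · rw [swap_apply_right, swap_comm]
  · exact absurd (swap_apply_of_ne_of_ne hj hk) h

/-- Two swaps which do not commute share exactly one point. -/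
theorem exists_of_not_comm {a b : Perm α} (ha : a.IsSwap) (hb : b.IsSwap) (h : a * b ≠ b * a) :
    ∃ p q r, p ≠ q ∧ p ≠ r ∧ q ≠ r ∧ a = Equiv.swap p q ∧ b = Equiv.swap p r := by
  obtain ⟨i, j, hij, rfl⟩ := ha
  have : b i ≠ i ∨ b j ≠ j := by
    by_contra! h'
    exact h (mul_swap_of_fix h'.1 h'.2).symm
  rcases this with h1 | h1
  · refine ⟨i, j, b i, hij, h1.symm, ?_, rfl, swap_eq_of_flip hb h1⟩
    rintro rfl
    exact h (by rw [← swap_eq_of_flip hb h1])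
  · refine ⟨j, i, b j, hij.symm, h1.symm, ?_, swap_comm _ _, swap_eq_of_flip hb h1⟩
    rintro h2
    have := swap_eq_of_flip hb h1
    rw [← h2, swap_comm] at this
    exact h (by rw [this])

theorem not_mem_of_comm {b : Perm α} {i j : α} (hij : i ≠ j) (hb : b.IsSwap)
    (h : b * swap i j = swap i j * b) (hne : b ≠ swap i j) : b i = i ∧ b j = j := by
  have key : b i = i := by
    by_contra h1
    have h2 := swap_eq_of_flip hb h1
    rcases eq_or_ne (b i) j with h3 | h3
    · exact hne (by rw [h2, h3])
    · have := apply_comm h i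
      rw [swap_apply_left, swap_apply_of_ne_of_ne h1 h3, h2,
        swap_apply_of_ne_of_ne hij.symm (Ne.symm h3), swap_apply_left] at this
      exact h3 this.symm
  refine ⟨key, ?_⟩
  have := apply_comm h i
  rwa [key, swap_apply_left] at this

theorem exists_notMem [Fintype α] {k : ℕ} (hα : k ≤ Fintype.card α) (l : List α)
    (hl : l.length < k) : ∃ m, m ∉ l := by
  by_contra! h
  have h1 : (Finset.univ : Finset α) ⊆ l.toFinset := fun x _ => by simpa using h x
  have := (Finset.card_le_card h1).trans (List.toFinset_card_le l)
  rw [Finset.card_univ] at this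
  omega

variable [Fintype α]

theorem isCobound_swaps (hα : 7 ≤ Fintype.card α) {Γ : Type} [Group Γ] {c : Perm α → Perm α → Γ}
    (hc : IsCocycle (invRel Set.univ) c) :
    IsCobound (fun s t => s ∈ {σ : Perm α | σ.IsSwap} ∧ t ∈ {σ : Perm α | σ.IsSwap} ∧
      invRel Set.univ s t) c := by
  have hrel : ∀ {s t : Perm α}, s.IsSwap → t.IsSwap → s * t = t * s → invRel Set.univ s t := by
    rintro _ _ ⟨i, j, hij, rfl⟩ ⟨k, l, hkl, rfl⟩ h
    exact ⟨⟨trivial, isInvol_swap hij⟩, ⟨trivial, isInvol_swap hkl⟩, h⟩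
  let R : {σ : Perm α // σ.IsSwap} → {σ : Perm α // σ.IsSwap} → Prop := fun s t =>
    s.1 * t.1 = t.1 * s.1
  have hR : IsCocycle R fun s t => c s.1 t.1 := fun s t u h1 h2 h3 =>
    hc _ _ _ (hrel s.2 t.2 h1) (hrel t.2 u.2 h2) (hrel s.2 u.2 h3)
  suffices main : IsCobound R fun s t => c s.1 t.1 by
    obtain ⟨h, hh⟩ := main
    classical
    refine ⟨fun s => if hs : s.IsSwap then h ⟨s, hs⟩ else 1, fun s t hst => ?_⟩
    simp only
    rw [dif_pos (show s.IsSwap from hst.1), dif_pos (show t.IsSwap from hst.2.1)]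
    exact hh ⟨s, hst.1⟩ ⟨t, hst.2.1⟩ hst.2.2.2.2
  refine hR.isCobound_of_square (fun _ => rfl) (fun _ _ => Eq.symm) ?_ ?_
  · rintro ⟨a, ha⟩ ⟨b, hb⟩ ⟨x, hx⟩ ⟨y, hy⟩ hax hxb hay hyb
    simp only [R] at hax hxb hay hyb ⊢
    by_cases hxy : x * y = y * x
    · exact hc.square_eq (hrel ha hx hax) (hrel hx hb hxb) (hrel ha hy hay) (hrel hy hb hyb)
        (hrel hx hy hxy)
    by_cases hab : a * b = b * a
    · rw [hc _ _ _ (hrel ha hx hax) (hrel hx hb hxb) (hrel ha hb hab),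
        hc _ _ _ (hrel ha hy hay) (hrel hy hb hyb) (hrel ha hb hab)]
    have n1 : a ≠ x := by rintro rfl; exact hab hxb
    have n2 : a ≠ y := by rintro rfl; exact hab hyb
    have n3 : b ≠ x := by rintro rfl; exact hab hax
    have n4 : b ≠ y := by rintro rfl; exact hab hay
    have Ra := hrel ha hx hax
    have Rb := hrel hx hb hxb
    have Rc := hrel ha hy hay
    have Rd := hrel hy hb hyb
    obtain ⟨i, j, k, hij, hik, hjk, rfl, rfl⟩ := exists_of_not_comm hx hy hxy
    obtain ⟨m, hm⟩ : ∃ m, m ∉ [i, j, k] ∧ a m = m ∧ b m = m := by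
      obtain ⟨p, q, r, hpq, hpr, hqr, rfl, rfl⟩ := exists_of_not_comm ha hb hab
      obtain ⟨m, hm⟩ := exists_notMem hα [i, j, k, p, q, r] (by simp)
      simp only [List.mem_cons, List.not_mem_nil, or_false, not_or] at hm
      refine ⟨m, by simp [hm], swap_apply_of_ne_of_ne hm.2.2.2.1 hm.2.2.2.2.1,
        swap_apply_of_ne_of_ne hm.2.2.2.1 hm.2.2.2.2.2⟩
    obtain ⟨hm, ham, hbm⟩ := hm
    simp only [List.mem_cons, List.not_mem_nil, or_false, not_or] at hm
    obtain ⟨hmi, hmj, hmk⟩ : m ≠ i ∧ m ≠ j ∧ m ≠ k := hm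
    obtain ⟨hai, haj⟩ := not_mem_of_comm hij ha hax n1
    obtain ⟨-, hak⟩ := not_mem_of_comm hik ha hay n2
    obtain ⟨hbi, hbj⟩ := not_mem_of_comm hij hb hxb.symm n3
    obtain ⟨-, hbk⟩ := not_mem_of_comm hik hb hyb.symm n4
    have hd := isInvol_double hij hik hmi.symm hjk hmj.symm hmk.symm
    have hd' := isInvol_double hik hij hmi.symm hjk.symm hmk.symm hmj.symm
    have fixd : ∀ g : Perm α, ∀ i j k m, g i = i → g j = j → g k = k → g m = m →
        g * (swap i j * swap k m) = swap i j * swap k m * g := fun g i j k m h1 h2 h3 h4 => by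
      rw [← mul_assoc, mul_swap_of_fix h1 h2, mul_assoc, mul_swap_of_fix h3 h4, mul_assoc]
    have ad : invRel Set.univ a (swap i j * swap k m) :=
      ⟨Ra.1, ⟨trivial, hd⟩, fixd _ _ _ _ _ hai haj hak ham⟩
    have bd : invRel Set.univ b (swap i j * swap k m) :=
      ⟨Rb.2.1, ⟨trivial, hd⟩, fixd _ _ _ _ _ hbi hbj hbk hbm⟩
    have ad' : invRel Set.univ a (swap i k * swap j m) :=
      ⟨Ra.1, ⟨trivial, hd'⟩, fixd _ _ _ _ _ hai hak haj ham⟩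
    have bd' : invRel Set.univ b (swap i k * swap j m) :=
      ⟨Rb.2.1, ⟨trivial, hd'⟩, fixd _ _ _ _ _ hbi hbk hbj hbm⟩
    have xd : invRel Set.univ (swap i j) (swap i j * swap k m) := ⟨Ra.2.1, ⟨trivial, hd⟩, by
      rw [mul_assoc, swap_comm_of_ne hik.symm hjk.symm hmi hmj]⟩
    have yd : invRel Set.univ (swap i k * swap j m) (swap i k) := ⟨⟨trivial, hd'⟩, Rc.2.1, by
      rw [mul_assoc, swap_comm_of_ne hij.symm hjk hmi hmk]⟩
    have dd : invRel Set.univ (swap i j * swap k m) (swap i k * swap j m) := by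
      refine ⟨⟨trivial, hd⟩, ⟨trivial, hd'⟩, mul_double_of_map ?_ ?_ ?_ ?_ ?_⟩
      · rw [mul_apply, swap_apply_of_ne_of_ne hik hmi.symm, swap_apply_left]
      · rw [mul_apply, swap_apply_left, swap_apply_of_ne_of_ne hmi hmj]
      · rw [mul_apply, swap_apply_of_ne_of_ne hjk hmj.symm, swap_apply_right]
      · rw [mul_apply, swap_apply_right, swap_apply_of_ne_of_ne hik.symm hjk.symm]
      · exact swap_comm_of_ne hij hmi.symm hjk.symm hmk.symm
    exact (hc.square_eq Ra Rb ad bd.symm xd).trans <|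
      (hc.square_eq ad bd.symm ad' bd'.symm dd).trans (hc.square_eq ad' bd'.symm Rc Rd yd)
  · rintro ⟨a, ha⟩ ⟨v, hv⟩ ⟨w, hw⟩ hvw
    simp only [R, Subtype.exists, exists_prop] at hvw ⊢
    by_cases h : a * v = v * a ∧ a * w = w * a
    · exact ⟨a, ha, rfl, h.1, h.2⟩
    suffices h : ∃ l : List α, l.length ≤ 5 ∧ ∀ m, m ∉ l → a m = m ∧ v m = m ∧ w m = m by
      obtain ⟨l, hl, h⟩ := h
      obtain ⟨m, hm⟩ := exists_notMem hα l (by omega)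
      obtain ⟨m', hm'⟩ := exists_notMem hα (m :: l) (by simp; omega)
      simp only [List.mem_cons, not_or] at hm'
      have h1 := h m hm
      have h2 := h m' hm'.2
      exact ⟨swap m m', ⟨m, m', Ne.symm hm'.1, rfl⟩, (mul_swap_of_fix h1.1 h2.1).symm,
        (mul_swap_of_fix h1.2.1 h2.2.1).symm, (mul_swap_of_fix h1.2.2 h2.2.2).symm⟩
    have main : ∀ v w : Perm α, v.IsSwap → w.IsSwap → a * v ≠ v * a →
        ∃ l : List α, l.length ≤ 5 ∧ ∀ m, m ∉ l → a m = m ∧ v m = m ∧ w m = m := by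
      intro v w hv hw h
      obtain ⟨p, q, r, hpq, hpr, hqr, rfl, rfl⟩ := exists_of_not_comm ha hv h
      obtain ⟨i, j, hij, rfl⟩ := hw
      refine ⟨[p, q, r, i, j], by simp, fun m hm => ?_⟩
      simp only [List.mem_cons, List.not_mem_nil, or_false, not_or] at hm
      exact ⟨swap_apply_of_ne_of_ne hm.1 hm.2.1, swap_apply_of_ne_of_ne hm.1 hm.2.2.1,
        swap_apply_of_ne_of_ne hm.2.2.2.1 hm.2.2.2.2⟩
    by_cases h1 : a * v = v * a
    · obtain ⟨l, hl, h2⟩ := main w v hw hv fun h2 => h ⟨h1, h2⟩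
      exact ⟨l, hl, fun m hm => ⟨(h2 m hm).1, (h2 m hm).2.2, (h2 m hm).2.1⟩⟩
    · exact main v w hv hw h1

theorem simplyConn_perm (hα : 7 ≤ Fintype.card α) :
    SimplyConn (invRel (Set.univ : Set (Perm α))) := by
  classical
  intro Γ _ c hc
  have ex : ∀ s : Perm α, ∃ i, IsInvol s → s i ≠ i := by
    intro s
    have : Nonempty α := Fintype.card_pos_iff.1 (by omega)
    by_cases h : IsInvol s
    · exact h.exists_ne.imp fun _ hi _ => hi
    · exact ⟨Classical.arbitrary α, fun h' => absurd h' h⟩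
  choose p hp using ex
  refine hc.isCobound_of_retract (fun _ _ => invRel.symm) (fun _ _ => invRel.self_left)
    {σ : Perm α | σ.IsSwap} (isCobound_swaps hα hc) (fun s => swap (p s) (s (p s)))
    (fun s hs => ?_) fun s s' hs => ?_
  · have h1 := hp s hs.1.2
    refine ⟨⟨_, _, h1.symm, rfl⟩, ⟨hs.1, ⟨trivial, isInvol_swap h1.symm⟩,
      mul_swap_of_flip rfl (hs.1.2.apply_apply _)⟩, fun b hb hsb => ⟨hsb.2.1,
      ⟨trivial, isInvol_swap h1.symm⟩, ?_⟩⟩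
    have h2 := apply_comm hsb.2.2 (p s)
    by_cases h3 : b (p s) = p s
    · rw [h3] at h2
      exact mul_swap_of_fix h3 h2.symm
    · have h4 := swap_eq_of_flip hb h3
      have h5 : s (p s) = b (p s) := by
        by_contra h5
        rw [h4, swap_apply_of_ne_of_ne h1 h5, swap_apply_left] at h2
        exact h3 (s.injective h2)
      exact mul_swap_of_flip h5.symm (by rw [h5, hsb.2.1.2.apply_apply])
  · have hb : ∀ {i j : α} {s t : Perm α}, i ≠ j → IsInvol s → IsInvol t →
        s * swap i j = swap i j * s → t * swap i j = swap i j * t →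
        ∃ b ∈ {σ : Perm α | σ.IsSwap}, invRel Set.univ b s ∧ invRel Set.univ b t :=
      fun {i j s t} hij hs ht h1 h2 => ⟨swap i j, ⟨i, j, hij, rfl⟩,
        ⟨⟨trivial, isInvol_swap hij⟩, ⟨trivial, hs⟩, h1.symm⟩,
        ⟨⟨trivial, isInvol_swap hij⟩, ⟨trivial, ht⟩, h2.symm⟩⟩
    have hsi := hs.1.2
    have hti := hs.2.1.2
    by_cases h : ∃ b ∈ {σ : Perm α | σ.IsSwap}, invRel Set.univ b s ∧ invRel Set.univ b s'
    · have ⟨b, hb, h1, _⟩ := h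
      exact ⟨s, hs.self_left, hs, ⟨b, hb, h1, h1⟩, h⟩
    obtain ⟨i, hi⟩ := hti.exists_ne
    have e1 := apply_comm hs.2.2 i
    have n1 : s i ≠ i := fun h1 => by
      rw [h1] at e1
      exact h (hb hi.symm hsi hti (mul_swap_of_fix h1 e1)
        (mul_swap_of_flip rfl (hti.apply_apply i)))
    have n2 : s i ≠ s' i := fun h1 => by
      refine h (hb hi.symm hsi hti (mul_swap_of_flip h1 ?_)
        (mul_swap_of_flip rfl (hti.apply_apply i)))
      rw [← h1, hsi.apply_apply]
    have n3 : s (s' i) ≠ s' i := fun h1 => n1 (s'.injective (by rw [← e1, h1]))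
    have n4 : s (s' i) ≠ i := fun h1 => n2 (by
      have := congrArg s h1; rw [hsi.apply_apply] at this; exact this.symm)
    have n5 : s i ≠ s (s' i) := fun h1 => hi (s.injective h1).symm
    have ds := swap_comm_of_ne (i := i) (j := s i) (k := s' i) (l := s (s' i)) hi.symm n4.symm n2 n5
    have hd := isInvol_double n1.symm hi.symm n4.symm n2 n5 n3.symm
    refine ⟨swap i (s i) * swap (s' i) (s (s' i)), ⟨hs.1, ⟨trivial, hd⟩, ?_⟩,
      ⟨⟨trivial, hd⟩, hs.2.1, (mul_double_of_map rfl e1.symm (hti.apply_apply i) ?_ ds).symm⟩,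
      hb n1.symm hsi hd ?_ ?_, ?_⟩
    · rw [← mul_assoc, mul_swap_of_flip rfl (hsi.apply_apply i), mul_assoc,
        mul_swap_of_flip rfl (hsi.apply_apply _), mul_assoc]
    · rw [e1, hti.apply_apply]
    · exact mul_swap_of_flip rfl (hsi.apply_apply i)
    · rw [mul_assoc, ds]
    · have fixd : ∀ m, m ∉ [i, s i, s' i, s (s' i)] →
          (swap i (s i) * swap (s' i) (s (s' i))) m = m := fun m hm => by
        simp only [List.mem_cons, List.not_mem_nil, or_false, not_or] at hm
        rw [mul_apply, swap_apply_of_ne_of_ne hm.2.2.1 hm.2.2.2, swap_apply_of_ne_of_ne hm.1 hm.2.1]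
      by_cases hm : ∃ m, m ∉ [i, s i, s' i, s (s' i)] ∧ s' m ≠ m
      · obtain ⟨m, hm, hm'⟩ := hm
        refine hb hm'.symm hd hti (mul_swap_of_fix (fixd m hm) (fixd _ ?_))
          (mul_swap_of_flip rfl (hti.apply_apply _))
        simp only [List.mem_cons, List.not_mem_nil, or_false, not_or] at hm ⊢
        refine ⟨fun h => hm.2.2.1 ?_, fun h => hm.2.2.2 ?_, fun h => hm.1 ?_, fun h => hm.2.1 ?_⟩
        · rw [← h, hti.apply_apply]
        · rw [e1, ← h, hti.apply_apply]
        · exact s'.injective h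
        · rw [e1] at h; exact s'.injective h
      · push Not at hm
        obtain ⟨m, h1⟩ := exists_notMem hα [i, s i, s' i, s (s' i)] (by simp)
        obtain ⟨m', h2⟩ := exists_notMem hα (m :: [i, s i, s' i, s (s' i)]) (by simp)
        rw [List.mem_cons, not_or] at h2
        exact hb (Ne.symm h2.1) hd hti (mul_swap_of_fix (fixd _ h1) (fixd _ h2.2))
          (mul_swap_of_fix (hm _ h1) (hm _ h2.2))

end Symmetric

section Alternating

open Equiv Equiv.Perm

variable {α : Type} [DecidableEq α] [Fintype α]

theorem sign_eq_neg_one {t : Perm α} (h : t ∉ alternatingGroup α) : sign t = -1 :=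
  (Int.units_eq_one_or _).resolve_left fun h' => h (mem_alternatingGroup.2 h')

theorem mul_mem_of_notMem {t t' : Perm α} (h : t ∉ alternatingGroup α)
    (h' : t' ∉ alternatingGroup α) : t * t' ∈ alternatingGroup α := by
  rw [mem_alternatingGroup, map_mul, sign_eq_neg_one h, sign_eq_neg_one h']; rfl

theorem double_mem_alternatingGroup {i j k l : α} (hij : i ≠ j) (hkl : k ≠ l) :
    swap i j * swap k l ∈ alternatingGroup α := by
  rw [mem_alternatingGroup, map_mul, sign_swap hij, sign_swap hkl]; rfl

/-- Even permutations preserving each orbit of an involution. -/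
def orbitGroup (t : Perm α) : Set (Perm α) :=
  {o | o ∈ alternatingGroup α ∧ ∀ x, o x = x ∨ o x = t x}

theorem flip_of_mem_orbitGroup {t o : Perm α} (ht : IsInvol t) (ho : o ∈ orbitGroup t) {x : α}
    (h : o x = t x) : o (t x) = x := by
  rcases ho.2 (t x) with h1 | h1
  · rw [h1, o.injective (h1.trans h.symm)]
  · rw [h1, ht.apply_apply]

theorem isNormalEA_orbitGroup {t : Perm α} (ht : IsInvol t) (h : ¬ t.IsSwap) :
    IsNormalEA (orbitGroup t) (centIn (alternatingGroup α) t) where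
  subset o ho := ⟨ho.1, Equiv.ext fun x => by
    simp only [mul_apply]
    rcases ho.2 x with h1 | h1
    · rw [h1]
      rcases ho.2 (t x) with h2 | h2
      · exact h2.symm
      · rw [ht.apply_apply] at h2
        rw [h2, o.injective (h2.trans h1.symm)]
    · rw [flip_of_mem_orbitGroup ht ho h1, h1, ht.apply_apply]⟩
  sq o ho := Equiv.ext fun x => by
    simp only [mul_apply, one_apply]
    rcases ho.2 x with h1 | h1
    · rw [h1, h1]
    · rw [h1, flip_of_mem_orbitGroup ht ho h1]
  comm o ho o' ho' := Equiv.ext fun x => by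
    have key : ∀ o ∈ orbitGroup t, o x = x → o (t x) = t x := by
      intro o ho h1
      rcases ho.2 (t x) with h2 | h2
      · exact h2
      · rw [ht.apply_apply] at h2
        rw [h2, ← o.injective (h1.trans h2.symm)]
    simp only [mul_apply]
    rcases ho.2 x with h1 | h1 <;> rcases ho'.2 x with h2 | h2 <;> rw [h1, h2]
    · exact h1
    · exact key o ho h1
    · rw [key o' ho' h2, h1]
    · rw [flip_of_mem_orbitGroup ht ho h1, flip_of_mem_orbitGroup ht ho' h2]
  mul_mem o ho o' ho' := ⟨mul_mem ho.1 ho'.1, fun x => by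
    simp only [mul_apply]
    rcases ho'.2 x with h2 | h2 <;> rw [h2]
    · exact ho.2 x
    · rcases ho.2 (t x) with h1 | h1
      · exact .inr h1
      · rw [ht.apply_apply] at h1; exact .inl h1⟩
  exists_ne := by
    obtain ⟨i, hi⟩ := ht.exists_ne
    have : ∃ j, t j ≠ swap i (t i) j := by
      by_contra! h'
      exact h ⟨i, t i, hi.symm, Equiv.ext h'⟩
    obtain ⟨j, hj⟩ := this
    have h1 : i ≠ j := by rintro rfl; simp at hj
    have h2 : t i ≠ j := by rintro rfl; rw [swap_apply_right, ht.apply_apply] at hj; exact hj rfl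
    have h3 : j ≠ t j := by rw [swap_apply_of_ne_of_ne h1.symm h2.symm] at hj; exact hj.symm
    have h4 : i ≠ t j := by rintro rfl; exact h2 (ht.apply_apply j)
    have h5 : t i ≠ t j := fun h => h1 (t.injective h)
    refine ⟨swap i (t i) * swap j (t j), ⟨double_mem_alternatingGroup hi.symm h3, fun x => ?_⟩,
      (isInvol_double hi.symm h1 h4 h2 h5 h3).1⟩
    rw [mul_apply]
    rcases eq_or_ne x j with rfl | x1
    · rw [swap_apply_left, swap_apply_of_ne_of_ne h4.symm h5.symm]; simp
    rcases eq_or_ne x (t j) with rfl | x2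
    · rw [swap_apply_right, swap_apply_of_ne_of_ne h1.symm h2.symm, ht.apply_apply]; simp
    rw [swap_apply_of_ne_of_ne x1 x2]
    rcases eq_or_ne x i with rfl | x3
    · simp
    rcases eq_or_ne x (t i) with rfl | x4
    · rw [swap_apply_right, ht.apply_apply]; simp
    · rw [swap_apply_of_ne_of_ne x3 x4]; simp
  conj_mem s hs hs2 o ho := by
    have hss : ∀ x, s (s x) = x := fun x => by simpa using congrArg (· x) hs2
    refine ⟨mul_mem (mul_mem hs.1 ho.1) hs.1, fun x => ?_⟩
    simp only [mul_apply]
    rcases ho.2 (s x) with h1 | h1 <;> rw [h1]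
    · rw [hss]; simp
    · rw [apply_comm hs.2 x, hss]; simp

/-- Even permutations commuting with a swap, parametrized by the permutations of its fixed
points. -/
def swapCentHom (i j : α) : Perm {x // x ≠ i ∧ x ≠ j} →* Perm α where
  toFun σ := ofSubtype σ * if sign σ = 1 then 1 else swap i j
  map_one' := by simp
  map_mul' σ τ := by
    have h : ∀ σ : Perm {x // x ≠ i ∧ x ≠ j}, ofSubtype σ * swap i j = swap i j * ofSubtype σ :=
      fun σ => mul_swap_of_fix (ofSubtype_apply_of_not_mem _ (by simp))
        (ofSubtype_apply_of_not_mem _ (by simp))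
    have h1 : (-1 : ℤˣ) ≠ 1 := by decide
    rcases Int.units_eq_one_or (sign σ) with hσ | hσ <;>
      rcases Int.units_eq_one_or (sign τ) with hτ | hτ <;>
      simp only [map_mul, hσ, hτ, mul_one, one_mul, if_true, h1, if_false]
    · rw [mul_assoc]
    · rw [mul_assoc, h, ← mul_assoc]
    · rw [neg_mul_neg, one_mul, if_pos rfl, mul_one, mul_assoc, ← mul_assoc (swap i j), ← h,
        mul_assoc, swap_mul_self, mul_one]

theorem swapCentHom_apply (i j : α) (σ : Perm {x // x ≠ i ∧ x ≠ j}) :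
    swapCentHom i j σ = ofSubtype σ * if sign σ = 1 then 1 else swap i j := rfl

theorem swapCentHom_injective (i j : α) : Injective (swapCentHom i j) := by
  refine (injective_iff_map_eq_one _).2 fun σ h => Equiv.ext fun x => Subtype.ext ?_
  have h1 := congrArg (· x.1) h
  simp only [swapCentHom_apply, mul_apply, one_apply] at h1
  rw [← ofSubtype_apply_coe]
  split_ifs at h1
  · exact h1
  · rwa [swap_apply_of_ne_of_ne x.2.1 x.2.2] at h1

theorem swapCentHom_image {i j : α} (hij : i ≠ j) :
    swapCentHom i j '' Set.univ = centIn (alternatingGroup α) (swap i j) := by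
  have h : ∀ σ : Perm {x // x ≠ i ∧ x ≠ j}, ofSubtype σ * swap i j = swap i j * ofSubtype σ :=
      fun σ => mul_swap_of_fix (ofSubtype_apply_of_not_mem _ (by simp))
        (ofSubtype_apply_of_not_mem _ (by simp))
  have h1 : (-1 : ℤˣ) ≠ 1 := by decide
  ext s
  constructor
  · rintro ⟨σ, -, rfl⟩
    refine ⟨?_, ?_⟩
    · rw [mem_alternatingGroup, swapCentHom_apply, map_mul, sign_ofSubtype]
      rcases Int.units_eq_one_or (sign σ) with hσ | hσ <;> simp [hσ, sign_swap hij, h1]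
    · rw [swapCentHom_apply]
      split_ifs
      · rw [mul_one, h]
      · rw [← mul_assoc, ← h]
  · rintro ⟨hs, hc⟩
    have key : ∀ s : Perm α, s i = i → s j = j →
        ∃ σ : Perm {x // x ≠ i ∧ x ≠ j}, ofSubtype σ = s := by
      intro s hi hj
      have hp : ∀ x, (s x ≠ i ∧ s x ≠ j) ↔ (x ≠ i ∧ x ≠ j) := fun x => by
        rw [Ne, Ne, s.injective.eq_iff' hi, s.injective.eq_iff' hj]
      exact ⟨s.subtypePerm hp, ofSubtype_subtypePerm hp fun x hx =>
        ⟨fun h => hx (by rw [h, hi]), fun h => hx (by rw [h, hj])⟩⟩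
    have hi := apply_comm hc i
    have hj := apply_comm hc j
    rw [swap_apply_left] at hi
    rw [swap_apply_right] at hj
    by_cases h2 : s i = i
    · rw [h2, swap_apply_left] at hi
      obtain ⟨σ, rfl⟩ := key s h2 hi.symm
      refine ⟨σ, trivial, ?_⟩
      rw [mem_alternatingGroup, sign_ofSubtype] at hs
      rw [swapCentHom_apply, if_pos hs, mul_one]
    · have h3 : s i = j := by
        by_contra h3
        rw [swap_apply_of_ne_of_ne h2 h3] at hi
        exact hij (s.injective hi)
      have h4 : s j = i := by rw [← hi, h3, swap_apply_right]
      obtain ⟨σ, hσ⟩ := key (s * swap i j) (by simp [h4]) (by simp [h3])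
      refine ⟨σ, trivial, ?_⟩
      have h5 := congrArg sign hσ
      rw [sign_ofSubtype, map_mul, mem_alternatingGroup.1 hs, sign_swap hij, one_mul] at h5
      rw [swapCentHom_apply, h5, if_neg h1, hσ, mul_assoc, swap_mul_self, mul_one]

theorem simplyConn_alternating (hα : 9 ≤ Fintype.card α) :
    SimplyConn (invRel (alternatingGroup α : Set (Perm α))) := by
  have hcent : ∀ t : Perm α, IsInvol t → SimplyConn (invRel (centIn (alternatingGroup α) t)) := by
    intro t ht
    by_cases h : t.IsSwap
    · obtain ⟨i, j, hij, rfl⟩ := h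
      rw [← swapCentHom_image hij, simplyConn_image (swapCentHom_injective i j)]
      refine simplyConn_perm ?_
      have : Fintype.card {x // ¬ (x ≠ i ∧ x ≠ j)} =
          Fintype.card α - Fintype.card {x // x ≠ i ∧ x ≠ j} :=
        Fintype.card_subtype_compl _
      have h2 : Fintype.card {x // ¬ (x ≠ i ∧ x ≠ j)} ≤ 2 := by
        rw [Fintype.card_subtype]
        refine (Finset.card_le_card (t := {i, j}) fun x hx => ?_).trans Finset.card_le_two
        simp only [Finset.mem_filter, not_and_or, not_not] at hx
        simpa using hx.2
      omega
    · exact (isNormalEA_orbitGroup ht h).simplyConn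
  intro Γ _ c hc
  have ex : ∀ t : Perm α, ∃ k : Perm α → Γ, IsInvol t → ∀ s s',
      invRel (centIn (alternatingGroup α) t) s s' → c s s' = (k s)⁻¹ * k s' := by
    intro t
    by_cases ht : IsInvol t
    · obtain ⟨k, hk⟩ := hcent t ht Γ c fun x y z h1 h2 h3 =>
        hc x y z (h1.mono fun _ h => h.1) (h2.mono fun _ h => h.1) (h3.mono fun _ h => h.1)
      exact ⟨k, fun _ => hk⟩
    · exact ⟨1, fun h => absurd h ht⟩
  choose k hk using ex
  obtain ⟨c', hc', h1, -⟩ := exists_cocycle_extension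
    (fun t t' ht ht' _ _ _ => mul_mem_of_notMem ht ht') hc k fun t _ ht s s' hs h1 h2 => by
      rw [hk t ht s s' ⟨⟨⟨hs.1.1, h1⟩, hs.1.2⟩, ⟨⟨hs.2.1.1, h2⟩, hs.2.1.2⟩, hs.2.2⟩]
      group
  obtain ⟨f, hf⟩ := simplyConn_perm (by omega) Γ c' hc'
  exact ⟨f, fun s t hst => by rw [← h1 s t hst, hf s t (hst.mono (Set.subset_univ _))]⟩

end Alternating

section EightPoints

/-- The four-element subsets of eight points avoiding the last point, as bit masks. -/
def masks : List ℕ := [15, 23, 27, 29, 30, 39, 43, 45, 46, 51, 53, 54, 57, 58, 60, 71, 75, 77, 78,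
  83, 85, 86, 89, 90, 92, 99, 101, 102, 105, 106, 108, 113, 114, 116, 120]

/-- Two masks are related when they meet in an even number of points: the literal is the table of
even bit counts. -/
def evenMeet (m n : ℕ) : Bool :=
  Nat.testBit 68033174967769840440887906939858451149105560803546820641877549596291376780905
    (m &&& n)

theorem evenMeet_comm (m n : ℕ) : evenMeet m n = evenMeet n m := by
  rw [evenMeet, evenMeet, Nat.land_comm]

/-- The members of `l` related to `a`. -/
def links (l : List ℕ) (a : ℕ) : List ℕ := l.filter fun x => evenMeet a x

theorem mem_links {l : List ℕ} {a x : ℕ} : x ∈ links l a ↔ x ∈ l ∧ evenMeet a x = true := by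
  simp [links]

theorem evenMeet_self : ∀ m ∈ masks, evenMeet m m = true := by decide +kernel

theorem card_block : ∀ m ∈ masks, ∀ b : Bool,
    (Finset.univ.filter fun x : Fin 8 => m.testBit x = b).card = 4 := by decide +kernel

theorem exists_evenMeet_ne : ∀ m ∈ masks, ∃ n ∈ masks, m ≠ n ∧ evenMeet m n = true := by
  decide +kernel

theorem card_cell : ∀ m ∈ masks, ∀ n ∈ masks, m = n ∨ evenMeet m n = false ∨ ∀ b c : Bool,
    (Finset.univ.filter fun x : Fin 8 => m.testBit x = b ∧ n.testBit x = c).card = 2 := by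
  decide +kernel

theorem exists_card_cell_eq_one : ∀ m ∈ masks, ∀ n ∈ masks, evenMeet m n = true ∨ ∃ c : Bool,
    ∀ b : Bool,
      (Finset.univ.filter fun x : Fin 8 => m.testBit x = b ∧ n.testBit x = xor b c).card = 1 := by
  decide +kernel

theorem links_square : (masks.all fun a => masks.all fun b => b ≤ a || evenMeet a b ||
    (links (links masks a) b).all fun x => (links (links masks a) b).all fun y => y ≤ x ||
      evenMeet x y || (links (links masks a) b).any fun z => evenMeet x z && evenMeet y z) =
    true := by
  decide +kernel

theorem links_cover : (masks.all fun a => masks.all fun v => evenMeet a v ||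
    (links masks v).all fun w => evenMeet a w || (links (links masks a) v).any fun u =>
      evenMeet u w) = true := by
  decide +kernel

theorem exists_mask_of_card : ∀ A ∈ Finset.powersetCard 4 (Finset.univ : Finset (Fin 8)),
    ∃ m ∈ masks, ∃ b : Bool, ∀ x : Fin 8, m.testBit x = b ↔ x ∈ A := by
  decide +kernel

theorem cell_of_evenMeet {m n : ℕ} (hm : m ∈ masks) (hn : n ∈ masks) (hmn : m ≠ n)
    (h : evenMeet m n = true) (x : Fin 8) :
    ∃ y : Fin 8, y ≠ x ∧ m.testBit y = m.testBit x ∧ n.testBit y = n.testBit x ∧ ∀ z : Fin 8,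
      m.testBit z = m.testBit x → n.testBit z = n.testBit x → z = x ∨ z = y := by
  have h2 := ((card_cell m hm n hn).resolve_left hmn).resolve_left (by simp [h])
    (m.testBit x) (n.testBit x)
  obtain ⟨y, hy, hyx⟩ := Finset.exists_mem_ne (h2.symm ▸ one_lt_two) x
  have hy' := (Finset.mem_filter.1 hy).2
  refine ⟨y, hyx, hy'.1, hy'.2, fun z h1 h2' => ?_⟩
  by_contra! hz
  have h3 : ({x, y, z} : Finset (Fin 8)).card = 3 :=
    Finset.card_eq_three.2 ⟨x, y, z, hyx.symm, hz.1.symm, hz.2.symm, rfl⟩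
  have := Finset.card_le_card (s := {x, y, z}) (t := Finset.univ.filter fun w : Fin 8 =>
    m.testBit w = m.testBit x ∧ n.testBit w = n.testBit x) fun w hw => by
      simp only [Finset.mem_insert, Finset.mem_singleton] at hw
      rcases hw with rfl | rfl | rfl <;> simp [*]
  omega

theorem cell_of_not_evenMeet {m n : ℕ} (hm : m ∈ masks) (hn : n ∈ masks)
    (h : evenMeet m n = false) :
    ∃ x y : Fin 8, m.testBit x ≠ m.testBit y ∧
      (∀ z : Fin 8, m.testBit z = m.testBit x → n.testBit z = n.testBit x → z = x) ∧
      ∀ z : Fin 8, m.testBit z = m.testBit y → n.testBit z = n.testBit y → z = y := by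
  obtain ⟨c, hc⟩ := (exists_card_cell_eq_one m hm n hn).resolve_left (by simp [h])
  have key : ∀ b : Bool, ∃ x : Fin 8, m.testBit x = b ∧
      ∀ z : Fin 8, m.testBit z = m.testBit x → n.testBit z = n.testBit x → z = x := by
    intro b
    obtain ⟨x, hx⟩ := Finset.card_eq_one.1 (hc b)
    have hx' := (Finset.mem_filter.1 (hx ▸ Finset.mem_singleton_self x)).2
    refine ⟨x, hx'.1, fun z h1 h2 => Finset.mem_singleton.1 (hx ▸ ?_)⟩
    simp [h1, h2, hx'.1, hx'.2]
  obtain ⟨x, hx, hx'⟩ := key true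
  obtain ⟨y, hy, hy'⟩ := key false
  exact ⟨x, y, by simp [hx, hy], hx', hy'⟩

theorem evenMeet_square {a b x y : ℕ} (ha : a ∈ masks) (hb : b ∈ masks) (hx : x ∈ masks)
    (hy : y ∈ masks) (hab : evenMeet a b = false) (hxy : evenMeet x y = false)
    (hax : evenMeet a x = true) (hbx : evenMeet b x = true) (hay : evenMeet a y = true)
    (hby : evenMeet b y = true) :
    ∃ z ∈ masks, evenMeet z a = true ∧ evenMeet z b = true ∧ evenMeet z x = true ∧
      evenMeet z y = true := by
  wlog hlt : a < b generalizing a b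
  · obtain ⟨z, hz, h1, h2, h3⟩ := this hb ha (evenMeet_comm b a ▸ hab) hbx hax hby hay
      (lt_of_le_of_ne (not_lt.1 hlt) fun h => by simp [h, evenMeet_self a ha] at hab)
    exact ⟨z, hz, h2, h1, h3⟩
  wlog hlt' : x < y generalizing x y
  · obtain ⟨z, hz, h1, h2, h3, h4⟩ := this hy hx (evenMeet_comm y x ▸ hxy) hay hby hax hbx
      (lt_of_le_of_ne (not_lt.1 hlt') fun h => by simp [h, evenMeet_self x hx] at hxy)
    exact ⟨z, hz, h1, h2, h4, h3⟩
  have h := links_square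
  simp only [List.all_eq_true, Bool.or_eq_true, List.any_eq_true, Bool.and_eq_true, mem_links,
    decide_eq_true_eq] at h
  have h' := (h a ha b hb).resolve_left (by simp [hlt, hab]) x ⟨⟨hx, hax⟩, hbx⟩ y ⟨⟨hy, hay⟩, hby⟩
  obtain ⟨z, ⟨⟨hz, h1⟩, h2⟩, h3, h4⟩ := h'.resolve_left (by simp [hlt', hxy])
  exact ⟨z, hz, evenMeet_comm z a ▸ h1, evenMeet_comm z b ▸ h2, evenMeet_comm z x ▸ h3,
    evenMeet_comm z y ▸ h4⟩

theorem evenMeet_cover {a v w : ℕ} (ha : a ∈ masks) (hv : v ∈ masks) (hw : w ∈ masks)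
    (hvw : evenMeet v w = true) :
    ∃ u ∈ masks, evenMeet u a = true ∧ evenMeet u v = true ∧ evenMeet u w = true := by
  by_cases hav : evenMeet a v = true
  · exact ⟨v, hv, evenMeet_comm v a ▸ hav, evenMeet_self v hv, hvw⟩
  by_cases haw : evenMeet a w = true
  · exact ⟨w, hw, evenMeet_comm w a ▸ haw, evenMeet_comm w v ▸ hvw, evenMeet_self w hw⟩
  have h := links_cover
  simp only [List.all_eq_true, Bool.or_eq_true, List.any_eq_true, mem_links] at h
  obtain ⟨u, ⟨⟨hu, h1⟩, h2⟩, h3⟩ :=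
    ((h a ha v hv).resolve_left hav w ⟨hw, hvw⟩).resolve_left haw
  exact ⟨u, hu, evenMeet_comm u a ▸ h1, evenMeet_comm u v ▸ h2, h3⟩

end EightPoints

section Nerve

variable {V ι : Type} {R : V → V → Prop} {Γ : Type} [Group Γ] {c : V → V → Γ}

/-- A cocycle is a coboundary if the relation is covered by complete pieces whose intersection
pattern has enough fillings of squares. -/
theorem IsCocycle.isCobound_of_cover (hc : IsCocycle R c) (M : ι → ι → Prop) (E : ι → V → Prop)
    (hE : ∀ m s t, E m s → E m t → R s t) (hM : ∀ m n, M m n ↔ ∃ f, E m f ∧ E n f)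
    (hrefl : ∀ m, M m m)
    (hsq : ∀ a b x y, ¬ M a b → ¬ M x y → M a x → M b x → M a y → M b y →
      ∃ z, M z a ∧ M z b ∧ M z x ∧ M z y)
    (hcov : ∀ a v w, M v w → ∃ u, M u a ∧ M u v ∧ M u w)
    (hex : ∀ s, R s s → ∃ m, E m s)
    (hedge : ∀ s t, R s t → (∃ m, E m s ∧ E m t) ∨
      ∃ f, (∃ m, E m s ∧ E m f) ∧ ∃ m, E m f ∧ E m t) : IsCobound R c := by
  rcases isEmpty_or_nonempty ι with hι | hι
  · refine ⟨fun _ => 1, fun s t hst => ?_⟩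
    rcases hedge s t hst with ⟨n, -⟩ | ⟨-, ⟨n, -⟩, -⟩ <;> exact isEmptyElim n
  have hsymm : ∀ m n, M m n → M n m := fun m n h => by
    obtain ⟨f, h1, h2⟩ := (hM m n).1 h
    exact (hM n m).2 ⟨f, h2, h1⟩
  choose b hb _ using fun m => (hM m m).1 (hrefl m)
  have : Nonempty V := hι.map b
  have hk : ∀ m s t, E m s → E m t → c (b m) s * c s t = c (b m) t := fun m s t hs ht =>
    hc _ _ _ (hE m _ _ (hb m) hs) (hE m _ _ hs ht) (hE m _ _ (hb m) ht)
  choose! f hf1 hf2 using fun m n (h : M m n) => (hM m n).1 h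
  let e : ι → ι → Γ := fun m n => c (b m) (f m n) * (c (b n) (f m n))⁻¹
  have he : ∀ m n s, E m s → E n s → e m n = c (b m) s * (c (b n) s)⁻¹ := by
    intro m n s hm hn
    have h := (hM m n).2 ⟨s, hm, hn⟩
    simp only [e]
    rw [← hk m _ s (hf1 m n h) hm, ← hk n _ s (hf2 m n h) hn]
    group
  have hcoc : IsCocycle M e := by
    intro m n p h1 h2 h3
    have k1 := hk m _ _ (hf1 m p h3) (hf1 m n h1)
    have k2 := hk n _ _ (hf2 m n h1) (hf1 n p h2)
    have k3 := hk p _ _ (hf2 m p h3) (hf2 n p h2)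
    have k4 := hc _ _ _ (hE m _ _ (hf1 m p h3) (hf1 m n h1))
      (hE n _ _ (hf2 m n h1) (hf1 n p h2)) (hE p _ _ (hf2 m p h3) (hf2 n p h2))
    simp only [e]
    rw [← k1, ← k2, ← k3, ← k4]
    group
  have hcob : IsCobound M e := by
    refine hcoc.isCobound_of_square hrefl hsymm (fun a b x y h1 h2 h3 h4 => ?_) hcov
    by_cases hab : M a b
    · rw [hcoc a x b h1 h2 hab, hcoc a y b h3 h4 hab]
    by_cases hxy : M x y
    · exact hcoc.square_eq h1 h2 h3 h4 hxy
    obtain ⟨z, za, zb, zx, zy⟩ := hsq a b x y hab hxy h1 (hsymm _ _ h2) h3 (hsymm _ _ h4)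
    rw [hcoc.square_eq h1 h2 (hsymm _ _ za) zb (hsymm _ _ zx),
      hcoc.square_eq h3 h4 (hsymm _ _ za) zb (hsymm _ _ zy)]
  obtain ⟨h, hh⟩ := hcob
  choose! m hm using hex
  have key : ∀ n s t, E n s → E n t →
      c s t = (h (m s) * c (b (m s)) s)⁻¹ * (h (m t) * c (b (m t)) t) := by
    have hH : ∀ n s, E n s → h (m s) * c (b (m s)) s = h n * c (b n) s := by
      intro n s hn
      have hs := hm s (hE n s s hn hn)
      have h1 := hh n (m s) ((hM _ _).2 ⟨s, hn, hs⟩)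
      rw [he n (m s) s hn hs] at h1
      calc h (m s) * c (b (m s)) s = h n * ((h n)⁻¹ * h (m s)) * c (b (m s)) s := by group
        _ = h n * c (b n) s := by rw [← h1]; group
    intro n s t hs ht
    rw [hH n s hs, hH n t ht, ← hk n s t hs ht]
    group
  refine ⟨fun s => h (m s) * c (b (m s)) s, fun s t hst => ?_⟩
  rcases hedge s t hst with ⟨n, h1, h2⟩ | ⟨g, ⟨n, h1, h2⟩, n', h3, h4⟩
  · exact key n s t h1 h2
  · rw [← hc s g t (hE n _ _ h1 h2) (hE n' _ _ h3 h4) hst, key n s g h1 h2, key n' g t h3 h4]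
    group

end Nerve

section Support

open Equiv Equiv.Perm

variable {α : Type} [DecidableEq α] [Fintype α]

theorem IsInvol.exists_card_support {s : Perm α} (h : IsInvol s) :
    ∃ k, s.support.card = 2 * k ∧ sign s = (-1) ^ k := by
  have ho : orderOf s = 2 := orderOf_eq_prime (by rw [pow_two, h.2]) h.1
  obtain ⟨k, hk⟩ := cycleType_prime_order (σ := s) (by rw [ho]; exact Nat.prime_two)
  rw [ho] at hk
  refine ⟨k + 1, by rw [← sum_cycleType, hk]; simp; ring, ?_⟩
  rw [sign_of_cycleType, hk, Multiset.sum_replicate, Multiset.card_replicate, smul_eq_mul,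
    pow_add, mul_comm, pow_mul]
  simp

theorem IsInvol.mem_alternatingGroup_iff {s : Perm α} (h : IsInvol s) :
    s ∈ alternatingGroup α ↔ 4 ∣ s.support.card := by
  obtain ⟨k, h1, h2⟩ := h.exists_card_support
  rw [mem_alternatingGroup, h1, h2]
  rcases Nat.even_or_odd k with hk | hk
  · simp only [hk.neg_one_pow, true_iff]
    obtain ⟨l, rfl⟩ := hk
    omega
  · rw [hk.neg_one_pow]
    obtain ⟨l, rfl⟩ := hk
    simp only [show ¬ (4 ∣ 2 * (2 * l + 1)) by omega, iff_false]
    decide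

end Support

section EightPoints

open Equiv Equiv.Perm

/-- Even involutions preserving both blocks of a mask, fixing every or no point of each block. -/
def IsUniform (m : ℕ) (s : Perm (Fin 8)) : Prop :=
  (s ∈ alternatingGroup (Fin 8) ∧ IsInvol s) ∧
    (∀ x : Fin 8, m.testBit (s x) = m.testBit x) ∧
    ∀ x y : Fin 8, m.testBit x = m.testBit y → s x = x → s y = y

theorem IsUniform.comm {m : ℕ} (hm : m ∈ masks) {s t : Perm (Fin 8)} (hs : IsUniform m s)
    (ht : IsUniform m t) : s * t = t * s := by
  ext1 x
  simp only [Perm.mul_apply]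
  by_cases h1 : s x = x
  · rw [h1, hs.2.2 x (t x) (ht.2.1 x).symm h1]
  by_cases h2 : t x = x
  · rw [h2, ht.2.2 x (s x) (hs.2.1 x).symm h2]
  by_contra hne
  have s1 : ∀ y, s (s y) = y := hs.1.2.apply_apply
  have t1 : ∀ y, t (t y) = y := ht.1.2.apply_apply
  have hs' : ∀ y : Fin 8, m.testBit y = m.testBit x → s y ≠ y := fun y hy h =>
    h1 (hs.2.2 y x hy h)
  have ht' : ∀ y : Fin 8, m.testBit y = m.testBit x → t y ≠ y := fun y hy h =>
    h2 (ht.2.2 y x hy h)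
  have e1 := hs.2.1 x
  have e2 := ht.2.1 x
  have e3 := (hs.2.1 (t x)).trans e2
  have e4 := (ht.2.1 (s x)).trans e1
  have n0 : s x ≠ t x := fun h => hne (by rw [← h, s1, h, t1])
  have n1 : s (t x) ≠ x := fun h => n0 (by rw [← h, s1, h])
  have n2 : t (s x) ≠ x := fun h => n0 (by rw [← h, t1, h])
  have n3 : s (t x) ≠ s x := fun h => h2 (s.injective h)
  have n4 : t (s x) ≠ t x := fun h => h1 (t.injective h)
  have hc : [x, s x, t x, s (t x), t (s x)].toFinset.card = 5 :=
    List.toFinset_card_of_nodup (by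
      simp [Ne.symm h1, Ne.symm h2, n0, n1.symm, n2.symm, n3.symm, n4.symm, hne,
        (ht' _ e1).symm, (hs' _ e2).symm])
  have := Finset.card_le_card (s := [x, s x, t x, s (t x), t (s x)].toFinset)
    (t := Finset.univ.filter fun y : Fin 8 => m.testBit y = m.testBit x) fun y hy => by
      simp only [List.mem_toFinset, List.mem_cons, List.not_mem_nil, or_false] at hy
      rcases hy with rfl | rfl | rfl | rfl | rfl <;> simp [*]
  rw [card_block m hm] at this
  omega

theorem exists_isUniform {m n : ℕ} (hm : m ∈ masks) (hn : n ∈ masks) (h : evenMeet m n = true) :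
    ∃ f, IsUniform m f ∧ IsUniform n f := by
  wlog hmn : m ≠ n generalizing n
  · obtain ⟨n', hn', h1, h2⟩ := exists_evenMeet_ne m hm
    obtain ⟨f, hf, -⟩ := this hn' h2 h1
    exact ⟨f, hf, not_not.1 hmn ▸ hf⟩
  choose f h1 h2 h3 h4 using cell_of_evenMeet hm hn hmn h
  have hf : Involutive f := fun x => ((h4 (f x) x (h2 x).symm (h3 x).symm).resolve_left
    (h1 x).symm).symm
  have hi : IsInvol hf.toPerm := ⟨fun h => h1 0 (congrArg (· 0) h), Equiv.ext hf⟩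
  have hA : hf.toPerm ∈ alternatingGroup (Fin 8) := by
    rw [hi.mem_alternatingGroup_iff, show hf.toPerm.support = Finset.univ from
      Finset.eq_univ_of_forall fun x => mem_support.2 (h1 x)]
    decide
  exact ⟨hf.toPerm, ⟨⟨hA, hi⟩, h2, fun x _ _ hx => absurd hx (h1 x)⟩,
    ⟨hA, hi⟩, h3, fun x _ _ hx => absurd hx (h1 x)⟩

theorem IsUniform.evenMeet {m n : ℕ} (hm : m ∈ masks) (hn : n ∈ masks) {s : Perm (Fin 8)}
    (h1 : IsUniform m s) (h2 : IsUniform n s) : evenMeet m n = true := by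
  by_contra h
  obtain ⟨x, y, hxy, hx, hy⟩ := cell_of_not_evenMeet hm hn (Bool.eq_false_iff.2 h)
  have fx := hx (s x) (h1.2.1 x) (h2.2.1 x)
  have fy := hy (s y) (h1.2.1 y) (h2.2.1 y)
  refine h1.1.2.1 (Equiv.ext fun z => ?_)
  rcases Bool.eq_or_eq_not (m.testBit z) (m.testBit x) with hz | hz
  · exact h1.2.2 x z hz.symm fx
  · exact h1.2.2 y z (by rw [hz]; revert hxy; cases m.testBit x <;> cases m.testBit y <;> simp) fy

theorem exists_isUniform_of_card {A : Finset (Fin 8)} (hA : A.card = 4) :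
    ∃ m : {m // m ∈ masks}, ∀ t : Perm (Fin 8), (t ∈ alternatingGroup (Fin 8) ∧ IsInvol t) →
      (∀ x ∈ A, t x ∈ A) → (∀ x ∈ A, t x = x → ∀ y ∈ A, t y = y) →
      (∀ x ∉ A, t x = x → ∀ y ∉ A, t y = y) → IsUniform m t := by
  obtain ⟨m, hm, b, hb⟩ := exists_mask_of_card A (Finset.mem_powersetCard.2 ⟨A.subset_univ, hA⟩)
  refine ⟨⟨m, hm⟩, ?_⟩
  intro t ht h1 h2 h3
  have hA' : ∀ x y : Fin 8, m.testBit x = m.testBit y ↔ (x ∈ A ↔ y ∈ A) := fun x y => by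
    rw [← hb, ← hb]
    cases m.testBit x <;> cases m.testBit y <;> cases b <;> simp
  refine ⟨ht, fun x => (hA' _ _).2 ⟨fun hx => ?_, h1 x⟩, fun x y hxy hx => ?_⟩
  · simpa [ht.2.apply_apply] using h1 _ hx
  · rw [hA'] at hxy
    by_cases hxA : x ∈ A
    · exact h2 x hxA hx y (hxy.1 hxA)
    · exact h3 x hxA hx y fun h => hxA (hxy.2 h)

end EightPoints

section EightPoints

open Equiv Equiv.Perm

theorem IsInvol.card_support_eight {s : Perm (Fin 8)}
    (hs : s ∈ alternatingGroup (Fin 8) ∧ IsInvol s) : s.support.card = 4 ∨ s.support = .univ := by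
  have h1 := hs.2.mem_alternatingGroup_iff.1 hs.1
  have h2 : s.support.card ≤ 8 := s.support.card_le_univ
  have h3 : s.support.card ≠ 0 := fun h => hs.2.1 (card_support_eq_zero.1 h)
  rcases (show s.support.card = 4 ∨ s.support.card = 8 by omega) with h | h
  · exact Or.inl h
  · exact Or.inr ((Finset.card_eq_iff_eq_univ _).1 h)

theorem apply_mem_support_of_comm {s t : Perm (Fin 8)} (h : s * t = t * s) {x : Fin 8}
    (hx : x ∈ s.support) : t x ∈ s.support := by
  rw [Perm.mem_support] at hx ⊢
  rw [apply_comm h]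
  exact fun h' => hx (t.injective h')

theorem exists_isUniform_edge_of_card {s t : Perm (Fin 8)}
    (hs : s ∈ alternatingGroup (Fin 8) ∧ IsInvol s) (ht : t ∈ alternatingGroup (Fin 8) ∧ IsInvol t)
    (hst : s * t = t * s) (hc : s.support.card = 4) :
    (∃ m : {m // m ∈ masks}, IsUniform m s ∧ IsUniform m t) ∨
      ∃ f, (∃ m : {m // m ∈ masks}, IsUniform m s ∧ IsUniform m f) ∧
        ∃ m : {m // m ∈ masks}, IsUniform m f ∧ IsUniform m t := by
  obtain ⟨m, hm⟩ := exists_isUniform_of_card hc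
  have hsm : IsUniform m s := hm s hs (fun x hx => apply_mem_support.2 hx)
    (fun x hx h => absurd h (mem_support.1 hx)) fun x _ _ y hy => notMem_support.1 hy
  by_cases hu : ∀ x ∈ s.support, t x = x → ∀ y ∈ s.support, t y = y
  · refine Or.inl ⟨m, hsm, hm t ht (fun x hx => apply_mem_support_of_comm hst hx) hu
      fun x hx hfx y hy => ?_⟩
    rcases IsInvol.card_support_eight ht with h4 | h4
    · by_cases hex : ∃ z ∈ s.support, t z = z
      · obtain ⟨z, hz, hz'⟩ := hex
        have hsub : t.support ⊆ s.supportᶜ := fun w hw => Finset.mem_compl.2 fun hw' =>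
          mem_support.1 hw (hu z hz hz' w hw')
        have := Finset.eq_of_subset_of_card_le hsub
          (by rw [Finset.card_compl, hc, h4, Fintype.card_fin])
        exact absurd hfx (mem_support.1 (this ▸ Finset.mem_compl.2 hx))
      · push Not at hex
        have := Finset.eq_of_subset_of_card_le (fun z hz => mem_support.2 (hex z hz) :
          s.support ⊆ t.support) (by rw [hc, h4])
        exact notMem_support.1 (this ▸ hy)
    · exact absurd hfx (mem_support.1 (h4 ▸ Finset.mem_univ x))
  · push Not at hu
    obtain ⟨x, hx, hxt, y, hy, hyt⟩ := hu
    have h4 : t.support.card = 4 := (IsInvol.card_support_eight ht).resolve_right fun h =>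
      mem_support.1 (h ▸ Finset.mem_univ x : x ∈ t.support) hxt
    obtain ⟨z, hzt, hzs⟩ := Finset.not_subset.1 fun h : t.support ⊆ s.support =>
      mem_support.1 ((Finset.eq_of_subset_of_card_le h (by rw [hc, h4])).symm ▸ hx) hxt
    have hyy : ({y, s y} : Finset (Fin 8)) ⊆ s.support ∩ t.support := by
      intro w hw
      have hy' : y ∈ s.support ∩ t.support := Finset.mem_inter.2 ⟨hy, mem_support.2 hyt⟩
      rcases Finset.mem_insert.1 hw with rfl | hw
      · exact hy'
      · rw [Finset.mem_singleton.1 hw]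
        exact Finset.mem_inter.2 ⟨apply_mem_support.2 hy,
          apply_mem_support_of_comm hst.symm (mem_support.2 hyt)⟩
    have hc2 := Finset.card_le_card hyy
    rw [Finset.card_pair (mem_support.1 hy).symm] at hc2
    have hc3 := Finset.card_union_add_card_inter s.support t.support
    have hc4 : 1 < (s.support ∪ t.support)ᶜ.card := by
      rw [Finset.card_compl, Fintype.card_fin]
      omega
    obtain ⟨u, hu, v, hv, huv⟩ := Finset.one_lt_card.1 hc4
    simp only [Finset.mem_compl, Finset.mem_union, not_or] at hu hv
    have hws : t z ∉ s.support := fun h => hzs (by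
      simpa [ht.2.apply_apply] using apply_mem_support_of_comm hst h)
    have hwt : t z ∈ t.support := apply_mem_support.2 hzt
    have n1 : z ≠ t z := (mem_support.1 hzt).symm
    have n2 : z ≠ u := fun h => hu.2 (h ▸ hzt)
    have n3 : z ≠ v := fun h => hv.2 (h ▸ hzt)
    have n4 : t z ≠ u := fun h => hu.2 (h ▸ hwt)
    have n5 : t z ≠ v := fun h => hv.2 (h ▸ hwt)
    have hout : ∀ p, p ∉ s.support → p = z ∨ p = t z ∨ p = u ∨ p = v := by
      intro p hp
      have hsub : [z, t z, u, v].toFinset ⊆ s.supportᶜ := fun q hq => by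
        simp only [List.mem_toFinset, List.mem_cons, List.not_mem_nil, or_false] at hq
        rcases hq with rfl | rfl | rfl | rfl
        exacts [Finset.mem_compl.2 hzs, Finset.mem_compl.2 hws, Finset.mem_compl.2 hu.1,
          Finset.mem_compl.2 hv.1]
      have := Finset.eq_of_subset_of_card_le hsub (by
        rw [Finset.card_compl, hc, List.toFinset_card_of_nodup (by simp [*])]
        simp)
      have hp' := Finset.mem_compl.2 hp
      rw [← this] at hp'
      simpa using hp'
    have fix : ∀ p, p ∉ s.support → s p = p := fun p => notMem_support.1
    have hd := isInvol_double n1 n2 n3 n4 n5 huv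
    have hcomm : s * (swap z (t z) * swap u v) = swap z (t z) * swap u v * s := by
      rw [← mul_assoc, mul_swap_of_fix (fix _ hzs) (fix _ hws), mul_assoc,
        mul_swap_of_fix (fix _ hu.1) (fix _ hv.1), mul_assoc]
    obtain ⟨f, hf⟩ : ∃ f, f = s * (swap z (t z) * swap u v) := ⟨_, rfl⟩
    have f1 : ∀ p ∈ s.support, f p = s p := by
      intro p hp
      have k1 : p ≠ z := fun h => hzs (h ▸ hp)
      have k2 : p ≠ t z := fun h => hws (h ▸ hp)
      have k3 : p ≠ u := fun h => hu.1 (h ▸ hp)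
      have k4 : p ≠ v := fun h => hv.1 (h ▸ hp)
      simp [hf, swap_apply_of_ne_of_ne, k1, k2, k3, k4]
    have fz : f z = t z := by simp [hf, swap_apply_of_ne_of_ne, n2, n3, fix _ hws]
    have fw : f (t z) = z := by simp [hf, swap_apply_of_ne_of_ne, n4, n5, fix _ hzs]
    have fu : f u = v := by simp [hf, swap_apply_of_ne_of_ne, n3.symm, n5.symm, fix _ hv.1]
    have fv : f v = u := by simp [hf, swap_apply_of_ne_of_ne, n2.symm, n4.symm, fix _ hu.1]
    have hfne : ∀ p, f p ≠ p := by
      intro p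
      by_cases hp : p ∈ s.support
      · rw [f1 p hp]
        exact mem_support.1 hp
      rcases hout p hp with rfl | rfl | rfl | rfl
      · rwa [fz, ne_comm]
      · rwa [fw]
      · rwa [fu, ne_comm]
      · rwa [fv]
    have hfA : f ∈ alternatingGroup (Fin 8) ∧ IsInvol f := by
      subst hf
      refine ⟨mul_mem hs.1 (double_mem_alternatingGroup n1 huv), hs.2.mul hd hcomm fun h => ?_⟩
      have := fix z hzs
      rw [h] at this
      simp [swap_apply_of_ne_of_ne, n2, n3] at this
      exact n1 this.symm
    obtain ⟨m', hm'⟩ := exists_isUniform_of_card h4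
    refine Or.inr ⟨f, ⟨m, hsm, hm f hfA (fun p hp => ?_) (fun p _ hp => absurd hp (hfne p))
      fun p _ hp => absurd hp (hfne p)⟩, m', hm' f hfA (fun p hp => ?_)
      (fun p _ hp => absurd hp (hfne p)) (fun p _ hp => absurd hp (hfne p)),
      hm' t ht (fun p hp => apply_mem_support.2 hp) (fun p hp h => absurd h (mem_support.1 hp))
      fun p _ _ q hq => notMem_support.1 hq⟩
    · rw [f1 p hp]
      exact apply_mem_support.2 hp
    · by_cases hps : p ∈ s.support
      · rw [f1 p hps]
        exact apply_mem_support_of_comm hst.symm hp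
      rcases hout p hps with rfl | rfl | rfl | rfl
      · rwa [fz]
      · rwa [fw]
      · exact absurd hp hu.2
      · exact absurd hp hv.2

theorem exists_isUniform_of_orbits {s t : Perm (Fin 8)}
    (hs : s ∈ alternatingGroup (Fin 8) ∧ IsInvol s) (ht : t ∈ alternatingGroup (Fin 8) ∧ IsInvol t)
    (hs' : ∀ x, s x ≠ x) (ht' : ∀ x, t x ≠ x) {x y : Fin 8} (h1 : y ≠ x) (h2 : y ≠ s x)
    (hx : t x = s x ∨ t x = y) (hy : t y = s y ∨ t y = x) (hst : s * t = t * s) :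
    ∃ m : {m // m ∈ masks}, IsUniform m s ∧ IsUniform m t := by
  have h3 : s y ≠ x := fun h => h2 (by rw [← h, hs.2.apply_apply])
  obtain ⟨m, hm⟩ := exists_isUniform_of_card (A := [x, s x, y, s y].toFinset) (by
    rw [List.toFinset_card_of_nodup (by
      simp [(hs' x).symm, h1.symm, h2.symm, h3.symm, (hs' y).symm])]
    rfl)
  have h4 : t (s x) = s (t x) := (apply_comm hst x).symm
  have h5 : t (s y) = s (t y) := (apply_comm hst y).symm
  refine ⟨m, hm s hs (fun p hp => ?_) (fun p _ hp => absurd hp (hs' p))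
    fun p _ hp => absurd hp (hs' p), hm t ht (fun p hp => ?_) (fun p _ hp => absurd hp (ht' p))
    fun p _ hp => absurd hp (ht' p)⟩
  all_goals
    simp only [List.mem_toFinset, List.mem_cons, List.not_mem_nil, or_false] at hp ⊢
    rcases hp with rfl | rfl | rfl | rfl
  · simp
  · simp [hs.2.apply_apply]
  · simp
  · simp [hs.2.apply_apply]
  · rcases hx with h | h <;> simp [h]
  · rcases hx with h | h <;> simp [h4, h, hs.2.apply_apply]
  · rcases hy with h | h <;> simp [h]
  · rcases hy with h | h <;> simp [h5, h, hs.2.apply_apply]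

theorem exists_isUniform_edge {s t : Perm (Fin 8)}
    (hs : s ∈ alternatingGroup (Fin 8) ∧ IsInvol s) (ht : t ∈ alternatingGroup (Fin 8) ∧ IsInvol t)
    (hst : s * t = t * s) :
    (∃ m : {m // m ∈ masks}, IsUniform m s ∧ IsUniform m t) ∨
      ∃ f, (∃ m : {m // m ∈ masks}, IsUniform m s ∧ IsUniform m f) ∧
        ∃ m : {m // m ∈ masks}, IsUniform m f ∧ IsUniform m t := by
  rcases IsInvol.card_support_eight hs with h | h
  · exact exists_isUniform_edge_of_card hs ht hst h
  rcases IsInvol.card_support_eight ht with h' | h'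
  · rcases exists_isUniform_edge_of_card ht hs hst.symm h' with ⟨m, h1, h2⟩ |
      ⟨f, ⟨m, h1, h2⟩, m', h3, h4⟩
    · exact Or.inl ⟨m, h2, h1⟩
    · exact Or.inr ⟨f, ⟨m', h4, h3⟩, m, h2, h1⟩
  have hs' : ∀ x, s x ≠ x := fun x => mem_support.1 (h ▸ Finset.mem_univ x)
  have ht' : ∀ x, t x ≠ x := fun x => mem_support.1 (h' ▸ Finset.mem_univ x)
  left
  by_cases he : s = t
  · subst he
    obtain ⟨y, hy⟩ := exists_notMem (α := Fin 8) (k := 3) (by simp) [0, s 0] (by simp)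
    simp only [List.mem_cons, List.not_mem_nil, or_false, not_or] at hy
    exact exists_isUniform_of_orbits hs hs hs' hs' hy.1 hy.2 (Or.inl rfl) (Or.inl rfl) rfl
  · obtain ⟨x, hx⟩ : ∃ x, s x ≠ t x := by
      by_contra! h0
      exact he (Equiv.ext h0)
    exact exists_isUniform_of_orbits hs ht hs' ht' (ht' x) hx.symm (Or.inr rfl)
      (Or.inr (ht.2.apply_apply x)) hst

theorem simplyConn_alternating_eight :
    SimplyConn (invRel (alternatingGroup (Fin 8) : Set (Perm (Fin 8)))) := by
  intro Γ _ c hc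
  have hedge := fun s t (h : invRel (alternatingGroup (Fin 8) : Set (Perm (Fin 8))) s t) =>
    exists_isUniform_edge h.1 h.2.1 h.2.2
  refine hc.isCobound_of_cover (ι := {m // m ∈ masks}) (fun m n => evenMeet m n = true)
    (fun m s => IsUniform m s) (fun m s t hs ht => ⟨hs.1, ht.1, hs.comm m.2 ht⟩)
    (fun m n => ⟨exists_isUniform m.2 n.2, fun ⟨f, h1, h2⟩ => h1.evenMeet m.2 n.2 h2⟩)
    (fun m => evenMeet_self m m.2) (fun a b x y hab hxy h1 h2 h3 h4 => ?_) (fun a v w h => ?_)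
    (fun s hs => ?_) hedge
  · obtain ⟨z, hz, h⟩ := evenMeet_square a.2 b.2 x.2 y.2 (Bool.eq_false_iff.2 hab)
      (Bool.eq_false_iff.2 hxy) h1 h2 h3 h4
    exact ⟨⟨z, hz⟩, h⟩
  · obtain ⟨u, hu, h⟩ := evenMeet_cover a.2 v.2 w.2 h
    exact ⟨⟨u, hu⟩, h⟩
  · rcases hedge s s hs with ⟨m, h, -⟩ | ⟨-, ⟨m, h, -⟩, -⟩ <;> exact ⟨m, h⟩

end EightPoints

section RankTwo

theorem eq_mul_of_isInvol {H : Type} [Group H] [Finite H]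
    (h : ¬ 8 ∣ Nat.card H ∨ ¬ 16 ∣ Nat.card H ∧ ∃ g : H, g * g ≠ 1 ∧ g * g * (g * g) = 1)
    {s t u : H} (hs : IsInvol s) (ht : IsInvol t) (hu : IsInvol u) (hst : s * t = t * s)
    (htu : t * u = u * t) (hsu : s * u = u * s) (h1 : s ≠ t) (h2 : t ≠ u) (h3 : s ≠ u) :
    u = s * t := by
  classical
  by_contra hne
  have hprime : Fact (Nat.Prime 2) := ⟨Nat.prime_two⟩
  have hcomm : ∀ x ∈ ({s, t, u} : Set H), ∀ y ∈ ({s, t, u} : Set H), x * y = y * x := by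
    rintro x (rfl | rfl | rfl) y (rfl | rfl | rfl) <;> simp [*]
  obtain ⟨V, hV⟩ : ∃ V, V = Subgroup.closure ({s, t, u} : Set H) := ⟨_, rfl⟩
  have hsq : ∀ x ∈ V, x * x = 1 := by
    have hcen := Subgroup.closure_le_centralizer_centralizer ({s, t, u} : Set H)
    have hc : ∀ x ∈ V, ∀ y ∈ V, x * y = y * x := by
      subst hV
      refine fun x hx y hy => ?_
      have hy' : y ∈ Subgroup.centralizer ({s, t, u} : Set H) := by
        refine (Subgroup.closure_le _).2 (fun z hz => ?_) hy
        exact Subgroup.mem_centralizer_iff.2 fun w hw => hcomm w hw z hz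
      exact (Subgroup.mem_centralizer_iff.1 (hcen hx) y hy').symm
    intro x hx
    rw [hV] at hx
    induction hx using Subgroup.closure_induction with
    | mem x hx => rcases hx with rfl | rfl | rfl; exacts [hs.2, ht.2, hu.2]
    | one => simp
    | mul x y hx hy ex ey =>
      rw [← hV] at hx hy
      rw [mul_assoc, ← mul_assoc y, hc y hy x hx, mul_assoc x, ey, mul_one, ex]
    | inv x hx ex => rw [← mul_inv_rev, ex, inv_one]
  have hp : IsPGroup 2 V := fun x => ⟨1, Subtype.ext (by simpa [pow_two] using hsq x x.2)⟩
  obtain ⟨k, hk⟩ := IsPGroup.iff_card.1 hp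
  have hsV : s ∈ V := hV ▸ Subgroup.subset_closure (by simp)
  have htV : t ∈ V := hV ▸ Subgroup.subset_closure (by simp)
  have huV : u ∈ V := hV ▸ Subgroup.subset_closure (by simp)
  have h5 : 5 ≤ Nat.card V := by
    have hc : ([1, s, t, u, s * t].toFinset : Finset H).card = 5 :=
      List.toFinset_card_of_nodup (by
        have n1 : s * t ≠ 1 := fun h => h1 (by rw [← ht.inv_eq]; exact eq_inv_of_mul_eq_one_left h)
        simp [hs.1.symm, ht.1.symm, hu.1.symm, n1.symm, h1, h2, h3, hne, hs.1, ht.1])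
    rw [← hc, ← SetLike.coe_sort_coe, ← Set.ncard_coe_finset, Nat.card_coe_set_eq]
    refine Set.ncard_le_ncard (fun x hx => ?_) (Set.toFinite _)
    simp only [List.coe_toFinset, List.mem_cons, List.not_mem_nil, or_false,
      Set.mem_ofPred_eq] at hx
    rcases hx with rfl | rfl | rfl | rfl | rfl
    exacts [V.one_mem, hsV, htV, huV, V.mul_mem hsV htV]
  have hk3 : 3 ≤ k := by
    by_contra! h
    have : 2 ^ k ≤ 2 ^ 2 := Nat.pow_le_pow_right two_pos (by omega)
    omega
  obtain ⟨P, hP⟩ := hp.exists_le_sylow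
  obtain ⟨j, hj⟩ := IsPGroup.iff_card.1 P.isPGroup'
  rcases h with h | ⟨h, g, hg, hg'⟩
  · exact h ((pow_dvd_pow 2 hk3).trans (hk ▸ V.card_subgroup_dvd_card))
  · have hj3 : j ≤ 3 := by
      by_contra! h'
      exact h ((pow_dvd_pow 2 h').trans (hj ▸ P.card_subgroup_dvd_card))
    have hVP : V = P := Subgroup.eq_of_le_of_card_ge hP (by
      rw [hk, hj]; exact Nat.pow_le_pow_right two_pos (hj3.trans hk3))
    have hgp : IsPGroup 2 (Subgroup.zpowers g) := by
      rw [IsPGroup.iff_card]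
      have : orderOf g ∣ 2 ^ 2 := orderOf_dvd_of_pow_eq_one (by
        rw [← hg', ← pow_two, ← pow_two, ← pow_mul]
        norm_num)
      obtain ⟨i, -, hi⟩ := (Nat.dvd_prime_pow Nat.prime_two).1 this
      exact ⟨i, by rw [Nat.card_zpowers, hi]⟩
    obtain ⟨Q, hQ⟩ := hgp.exists_le_sylow
    obtain ⟨x, hx⟩ := MulAction.exists_smul_eq H Q P
    have hgV : x * g * x⁻¹ ∈ V := by
      rw [hVP, ← hx]
      exact Subgroup.smul_mem_pointwise_smul g (MulAut.conj x) _ (hQ (Subgroup.mem_zpowers g))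
    have := hsq _ hgV
    exact hg (conj_eq_one_iff.1 (by rwa [conj_mul] at this))

theorem freeDatum_of_card {G : Type} [Group G] [Finite G] {L : Subgroup G}
    (h : ¬ 8 ∣ Nat.card L ∨ ¬ 16 ∣ Nat.card L ∧ ∃ g ∈ L, g * g ≠ 1 ∧ g * g * (g * g) = 1) :
    FreeDatum (invRel (L : Set G)) := by
  have h' : ¬ 8 ∣ Nat.card L ∨ ¬ 16 ∣ Nat.card L ∧ ∃ g : L, g * g ≠ 1 ∧ g * g * (g * g) = 1 :=
    h.imp_right fun ⟨h, g, hg, h1, h2⟩ => ⟨h, ⟨g, hg⟩, fun h => h1 (congrArg Subtype.val h),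
      Subtype.ext h2⟩
  have hi : ∀ (s : G) (hs : s ∈ L), IsInvol s → IsInvol (⟨s, hs⟩ : L) := fun s hs h =>
    ⟨fun h1 => h.1 (congrArg Subtype.val h1), Subtype.ext h.2⟩
  refine freeDatum_of_rank_le_two fun s t u h1 h2 h3 h4 h5 h6 => ?_
  exact congrArg Subtype.val (eq_mul_of_isInvol h' (hi s h1.1.1 h1.1.2) (hi t h2.1.1 h2.1.2)
    (hi u h3.2.1.1 h3.2.1.2) (Subtype.ext h1.2.2) (Subtype.ext h2.2.2) (Subtype.ext h3.2.2)
    (fun h => h4 (congrArg Subtype.val h)) (fun h => h5 (congrArg Subtype.val h))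
    fun h => h6 (congrArg Subtype.val h))

open Equiv Equiv.Perm

theorem freeDatum_alternating {n : ℕ} (hn : n = 5 ∨ n = 6 ∨ n = 7) :
    FreeDatum (invRel (alternatingGroup (Fin n) : Set (Perm (Fin n)))) := by
  have hc : ∀ n, 2 ≤ n → Nat.card (alternatingGroup (Fin n)) = n.factorial / 2 := fun n hn => by
    have : Nontrivial (Fin n) := Fin.nontrivial_iff_two_le.2 hn
    rw [nat_card_alternatingGroup, Nat.card_eq_fintype_card, Fintype.card_fin]
  apply freeDatum_of_card
  rcases hn with rfl | rfl | rfl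
  · left; rw [hc 5 (by norm_num)]; decide
  · right
    refine ⟨by rw [hc 6 (by norm_num)]; decide,
      Equiv.swap 0 1 * Equiv.swap 0 2 * Equiv.swap 0 3 * Equiv.swap 4 5, ?_⟩
    rw [mem_alternatingGroup]
    decide +kernel
  · right
    refine ⟨by rw [hc 7 (by norm_num)]; decide,
      Equiv.swap 0 1 * Equiv.swap 0 2 * Equiv.swap 0 3 * Equiv.swap 4 5, ?_⟩
    rw [mem_alternatingGroup]
    decide +kernel

theorem freeDatum_perm_five : FreeDatum (invRel (Set.univ : Set (Perm (Fin 5)))) := by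
  rw [← Subgroup.coe_top]
  refine freeDatum_of_card (Or.inr ⟨?_, Equiv.swap 0 1 * Equiv.swap 0 2 * Equiv.swap 0 3, ?_⟩)
  · rw [Subgroup.card_top, Nat.card_perm, Nat.card_eq_fintype_card, Fintype.card_fin]
    decide
  · refine ⟨trivial, ?_⟩
    decide +kernel

end RankTwo

section ThreeCycles

open Equiv Equiv.Perm

theorem viaEmbedding_swap {β γ : Type} [DecidableEq β] [DecidableEq γ] (e : β ↪ γ) (i j : β) :
    viaEmbeddingHom e (Equiv.swap i j) = Equiv.swap (e i) (e j) := by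
  ext1 x
  rw [viaEmbeddingHom_apply]
  by_cases hx : x ∈ Set.range e
  · obtain ⟨k, rfl⟩ := hx
    rw [viaEmbedding_apply, e.injective.map_swap]
  · rw [viaEmbedding_apply_of_notMem _ _ _ hx, swap_apply_of_ne_of_ne] <;> rintro rfl <;>
      exact hx ⟨_, rfl⟩

variable {α : Type} [DecidableEq α] [Fintype α]

theorem Equiv.Perm.IsThreeCycle.exists_eq_swap {g : Perm α} (hg : g.IsThreeCycle) :
    ∃ a b c, a ≠ b ∧ a ≠ c ∧ b ≠ c ∧ g = Equiv.swap a b * Equiv.swap b c := by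
  obtain ⟨a, ha⟩ := hg.isCycle.nonempty_support
  have h := hg.nodup_iff_mem_support.2 ha
  simp only [List.nodup_cons, List.mem_cons, List.not_mem_nil, or_false, not_or] at h
  exact ⟨a, g a, g (g a), h.1.1, h.1.2, h.2.1, hg.eq_swap_mul_swap_iff_mem_support.2 ha⟩

theorem isThreeCycle_swap_mul_swap {a b c : α} (hab : a ≠ b) (hac : a ≠ c) (hbc : b ≠ c) :
    (Equiv.swap a b * Equiv.swap b c).IsThreeCycle := by
  rw [Equiv.swap_comm a b]
  exact isThreeCycle_swap_mul_swap_same hab.symm hbc hac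

/-- Two 3-cycles are simultaneously images of 3-cycles of six points. -/
theorem exists_viaEmbedding (hα : 6 ≤ Fintype.card α) {g k : Perm α} (hg : g.IsThreeCycle)
    (hk : k.IsThreeCycle) : ∃ (e : Fin 6 ↪ α) (l m n : Fin 6), l ≠ m ∧ l ≠ n ∧ m ≠ n ∧
      g = viaEmbeddingHom e (Equiv.swap 0 1 * Equiv.swap 1 2) ∧
      k = viaEmbeddingHom e (Equiv.swap l m * Equiv.swap m n) := by
  obtain ⟨a, b, c, hab, hac, hbc, rfl⟩ := hg.exists_eq_swap
  obtain ⟨a', b', c', hab', hac', hbc', rfl⟩ := hk.exists_eq_swap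
  obtain ⟨T, hT, hT6⟩ := Finset.exists_superset_card_eq (n := 6)
    (s := [a, b, c, a', b', c'].toFinset) (List.toFinset_card_le _) hα
  have hmem : ∀ x ∈ [a, b, c, a', b', c'], x ∈ T := fun x hx => hT (List.mem_toFinset.2 hx)
  obtain ⟨g, hg⟩ := Finset.exists_equiv_extend_of_card_eq (α := Fin 6) (t := T) (by simp [hT6])
    (s := {0, 1, 2}) (f := ![a, b, c, a, a, a])
    (fun x hx => by
      obtain ⟨i, hi, rfl⟩ := Finset.mem_image.1 hx
      fin_cases hi <;> simp [hmem]) (by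
      intro i hi j hj hij
      simp only [Finset.coe_insert, Finset.coe_singleton, Set.mem_insert_iff,
        Set.mem_singleton_iff] at hi hj
      rcases hi with rfl | rfl | rfl <;> rcases hj with rfl | rfl | rfl <;>
        simp_all [eq_comm])
  let e : Fin 6 ↪ α := g.toEmbedding.trans (Embedding.subtype _)
  have hsurj : ∀ x ∈ T, ∃ i, e i = x := fun x hx =>
    ⟨g.symm ⟨x, hx⟩, by simp [e]⟩
  obtain ⟨l, rfl⟩ := hsurj a' (hmem _ (by simp))
  obtain ⟨m, rfl⟩ := hsurj b' (hmem _ (by simp))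
  obtain ⟨n, rfl⟩ := hsurj c' (hmem _ (by simp))
  refine ⟨e, l, m, n, fun h => hab' (h ▸ rfl), fun h => hac' (h ▸ rfl), fun h => hbc' (h ▸ rfl),
    ?_, ?_⟩
  · have h0 : e 0 = a := hg 0 (by simp)
    have h1 : e 1 = b := hg 1 (by simp)
    have h2 : e 2 = c := hg 2 (by simp)
    rw [map_mul, viaEmbedding_swap, viaEmbedding_swap, h0, h1, h2]
  · rw [map_mul, viaEmbedding_swap, viaEmbedding_swap]

theorem threeCycle_mul_pow_six (l m n : Fin 6) (hlm : l ≠ m) (hln : l ≠ n) (hmn : m ≠ n) :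
    ∃ i : Fin 6, (i = 2 ∨ i = 3 ∨ i = 5) ∧
    (Equiv.swap 0 1 * Equiv.swap 1 2 * (Equiv.swap l m * Equiv.swap m n) : Perm (Fin 6)) ^
      (i : ℕ) = 1 := by
  revert l m n
  decide +kernel

theorem threeCycle_common_six (l m n : Fin 6) (hlm : l ≠ m) (hln : l ≠ n) (hmn : m ≠ n) :
    (Equiv.swap 0 1 * Equiv.swap 1 2 * (Equiv.swap l m * Equiv.swap m n) : Perm (Fin 6)) ^ 2 = 1 →
    (Equiv.swap 0 1 * Equiv.swap 1 2 * (Equiv.swap l m * Equiv.swap m n) : Perm (Fin 6)) ≠ 1 →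
    ∃ p : Fin 6, (Equiv.swap 0 1 * Equiv.swap 1 2 : Perm (Fin 6)) p ≠ p ∧
      (Equiv.swap l m * Equiv.swap m n : Perm (Fin 6)) p =
        (Equiv.swap 0 1 * Equiv.swap 1 2 : Perm (Fin 6)) p := by
  revert l m n
  decide +kernel

theorem threeCycle_mul_pow (hα : 6 ≤ Fintype.card α) {g k : Perm α} (hg : g.IsThreeCycle)
    (hk : k.IsThreeCycle) : (g * k) ^ 2 = 1 ∨ (g * k) ^ 3 = 1 ∨ (g * k) ^ 5 = 1 := by
  obtain ⟨e, l, m, n, h1, h2, h3, rfl, rfl⟩ := exists_viaEmbedding hα hg hk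
  obtain ⟨i, hi, h⟩ := threeCycle_mul_pow_six l m n h1 h2 h3
  replace h := congrArg (viaEmbeddingHom e) h
  rw [map_pow, map_mul, map_one] at h
  rcases hi with rfl | rfl | rfl
  · exact Or.inl h
  · exact Or.inr (Or.inl h)
  · exact Or.inr (Or.inr h)

/-- Two 3-cycles whose product is an involution share an arrow. -/
theorem threeCycle_common {g k : Perm α} (hg : g.IsThreeCycle) (hk : k.IsThreeCycle)
    (h2 : (g * k) ^ 2 = 1) (h1 : g * k ≠ 1) : ∃ p, g p ≠ p ∧ k p = g p := by
  wlog hα : 6 ≤ Fintype.card α generalizing α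
  · let ι : α ↪ α ⊕ Fin 6 := Embedding.inl
    have h3 : ∀ {g : Perm α}, g.IsThreeCycle → (viaEmbeddingHom ι g).IsThreeCycle := by
      intro g hg
      obtain ⟨a, b, c, hab, hac, hbc, rfl⟩ := hg.exists_eq_swap
      rw [map_mul, viaEmbedding_swap, viaEmbedding_swap]
      exact isThreeCycle_swap_mul_swap (ι.injective.ne hab) (ι.injective.ne hac)
        (ι.injective.ne hbc)
    obtain ⟨p, hp, hp'⟩ := this (h3 hg) (h3 hk) (by rw [← map_mul, ← map_pow, h2, map_one])
      (by rw [← map_mul]; exact (map_ne_one_iff _ (viaEmbeddingHom_injective ι)).2 h1) (by simp)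
    simp only [viaEmbeddingHom_apply] at hp hp'
    by_cases hx : p ∈ Set.range ι
    · obtain ⟨x, rfl⟩ := hx
      rw [viaEmbedding_apply, viaEmbedding_apply] at hp'
      rw [viaEmbedding_apply] at hp
      exact ⟨x, fun h => hp (congrArg ι h), ι.injective hp'⟩
    · exact absurd (viaEmbedding_apply_of_notMem _ _ _ hx) hp
  obtain ⟨e, l, m, n, h3, h4, h5, rfl, rfl⟩ := exists_viaEmbedding hα hg hk
  rw [← map_mul] at h1 h2
  rw [← map_pow] at h2
  obtain ⟨p, hp, hp'⟩ := threeCycle_common_six l m n h3 h4 h5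
    (viaEmbeddingHom_injective e (by rw [h2, map_one])) fun h => h1 (by rw [h, map_one])
  refine ⟨e p, ?_, ?_⟩ <;> rw [viaEmbeddingHom_apply, viaEmbedding_apply]
  · exact e.injective.ne hp
  · rw [viaEmbeddingHom_apply, viaEmbedding_apply, hp']

end ThreeCycles

section Automorphisms

open Equiv Equiv.Perm

variable {α : Type} [DecidableEq α] [Fintype α]

theorem eq_swap_mul_swap_of_pow_three {β : Type} [DecidableEq β] {g : Perm β}
    (h3 : ∀ x, g (g (g x)) = x) {x : β} (h : ∀ y, y ≠ x → y ≠ g x → y ≠ g (g x) → g y = y)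
    (hx : g x ≠ x) :
    g = Equiv.swap x (g x) * Equiv.swap (g x) (g (g x)) := by
  have h1 : g (g x) ≠ x := fun h => hx ((congrArg g h).symm.trans (h3 x))
  have h2 : g (g x) ≠ g x := fun h => hx (g.injective h)
  ext1 y
  rw [Perm.mul_apply]
  by_cases hy : y = x
  · rw [hy, swap_apply_of_ne_of_ne hx.symm h1.symm, swap_apply_left]
  by_cases hy1 : y = g x
  · rw [hy1, swap_apply_left, swap_apply_of_ne_of_ne h1 h2]
  by_cases hy2 : y = g (g x)
  · rw [hy2, swap_apply_right, swap_apply_right, h3]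
  rw [swap_apply_of_ne_of_ne hy1 hy2, swap_apply_of_ne_of_ne hy hy1, h y hy hy1 hy2]

theorem isThreeCycle_or_exists {g : Perm α} (h1 : g ≠ 1) (h3 : ∀ x, g (g (g x)) = x) :
    g.IsThreeCycle ∨ ∃ x y, g x ≠ x ∧ g y ≠ y ∧ y ≠ x ∧ y ≠ g x ∧ y ≠ g (g x) ∧
      g (g x) ≠ x ∧ g (g y) ≠ y := by
  obtain ⟨x, hx⟩ : ∃ x, g x ≠ x := by
    by_contra! h
    exact h1 (Perm.ext h)
  have hne2 : ∀ x, g x ≠ x → g (g x) ≠ x := fun x hx h => hx ((congrArg g h).symm.trans (h3 x))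
  have hx2 := hne2 x hx
  by_cases hy : ∀ y, y ≠ x → y ≠ g x → y ≠ g (g x) → g y = y
  · left
    rw [eq_swap_mul_swap_of_pow_three h3 hy hx]
    exact isThreeCycle_swap_mul_swap hx.symm hx2.symm fun h => hx (g.injective h).symm
  push Not at hy
  obtain ⟨y, hyx, hygx, hyggx, hy⟩ := hy
  exact Or.inr ⟨x, y, hx, hy, hyx, hygx, hyggx, hx2, hne2 y hy⟩

theorem isThreeCycle_of_pow_three_of_card_le (hα : Fintype.card α ≤ 5) {g : Perm α} (h1 : g ≠ 1)
    (hg3 : g ^ 3 = 1) : g.IsThreeCycle := by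
  have h3 : ∀ x, g (g (g x)) = x := fun x => by
    simpa [pow_succ] using Perm.ext_iff.1 hg3 x
  refine (isThreeCycle_or_exists h1 h3).resolve_right ?_
  rintro ⟨x, y, hx, hy, hyx, hygx, hyggx, hx2, hy2⟩
  have : [x, g x, g (g x), y, g y, g (g y)].Nodup := by
    simp only [List.nodup_cons, List.mem_cons, List.not_mem_nil, or_false, not_or, List.nodup_nil,
      not_false_eq_true, and_true]
    grind
  have := this.length_le_card
  simp only [List.length_cons, List.length_nil] at this
  omega

/-- An element of order three whose commutators with even permutations have order dividing
2, 3 or 5 is a 3-cycle. -/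
theorem isThreeCycle_of_commutator_pow (hα : 7 ≤ Fintype.card α)
    {g : Perm α} (h1 : g ≠ 1) (hg3 : g ^ 3 = 1)
    (hc : ∀ h ∈ alternatingGroup α, (g * (h * g⁻¹ * h⁻¹)) ^ 2 = 1 ∨ (g * (h * g⁻¹ * h⁻¹)) ^ 3 = 1 ∨
      (g * (h * g⁻¹ * h⁻¹)) ^ 5 = 1) : g.IsThreeCycle := by
  have h3 : ∀ x, g (g (g x)) = x := fun x => by
    simpa [pow_succ] using Perm.ext_iff.1 hg3 x
  have hinv : ∀ x, g⁻¹ x = g (g x) := fun x => by rw [Perm.inv_eq_iff_eq, h3]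
  refine (isThreeCycle_or_exists h1 h3).resolve_right ?_
  rintro ⟨x, y, hx, hy, hyx, hygx, hyggx, hx2, hy2⟩
  obtain ⟨z, hz⟩ := exists_notMem hα [x, g x, g (g x), y, g y, g (g y)] (by simp)
  simp only [List.mem_cons, List.not_mem_nil, or_false, not_or] at hz
  obtain ⟨hz1, hz2, hz3, hz4, hz5, hz6⟩ := hz
  set h : Perm α := Equiv.swap x y * Equiv.swap (g x) z with hh
  have hA : h ∈ alternatingGroup α := double_mem_alternatingGroup (Ne.symm hyx) (Ne.symm hz2)
  have hinvol : IsInvol h := isInvol_double (Ne.symm hyx) hx.symm (Ne.symm hz1) hygx (Ne.symm hz4)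
    (Ne.symm hz2)
  have hh1 : ∀ w, w ≠ x → w ≠ y → w ≠ g x → w ≠ z → h w = w := fun w e1 e2 e3 e4 => by
    rw [hh, Perm.mul_apply, swap_apply_of_ne_of_ne e3 e4, swap_apply_of_ne_of_ne e1 e2]
  have hhx : h x = y := by
    rw [hh, Perm.mul_apply, swap_apply_of_ne_of_ne hx.symm (Ne.symm hz1), swap_apply_left]
  have hhg : h (g x) = z := by
    rw [hh, Perm.mul_apply, swap_apply_left, swap_apply_of_ne_of_ne hz1 hz4]
  have hhy : h y = x := by rw [← hhx, hinvol.apply_apply]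
  have hhz : h z = g x := by rw [← hhg, hinvol.apply_apply]
  have hcx : ∀ w, (g * (h * g⁻¹ * h⁻¹)) w = g (h (g (g (h w)))) := fun w => by
    rw [hinvol.inv_eq, ← hinv]; simp only [Perm.mul_apply]
  have c1 : (g * (h * g⁻¹ * h⁻¹)) x = y := by
    rw [hcx, hhx, hh1 (g (g y)), h3] <;> grind
  have c2 : (g * (h * g⁻¹ * h⁻¹)) y = x := by
    rw [hcx, hhy, hh1 (g (g x)), h3] <;> grind
  rcases hc h hA with h' | h' | h'
  · replace h' := Perm.ext_iff.1 h' (g x)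
    rw [pow_two, Perm.mul_apply, Perm.one_apply] at h'
    by_cases hgz : g z = z
    · have c3 : (g * (h * g⁻¹ * h⁻¹)) (g x) = g (g x) := by
        rw [hcx, hhg, hgz, hgz, hhz]
      rw [c3, hcx, hh1 (g (g x)) hx2 (Ne.symm hyggx) (by grind) (Ne.symm hz3), h3, hhg, hgz] at h'
      exact hz2 h'
    · have c3 : (g * (h * g⁻¹ * h⁻¹)) (g x) = z := by
        rw [hcx, hhg, hh1 (g (g z)), h3] <;> grind
      rw [c3, hcx, hhz, h3, hhx] at h'
      exact hyx (g.injective h')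
  · replace h' := Perm.ext_iff.1 h' x
    simp only [pow_succ, pow_zero, one_mul, Perm.mul_apply _ (g * (h * g⁻¹ * h⁻¹)), c1, c2,
      Perm.one_apply] at h'
    exact hyx h'
  · replace h' := Perm.ext_iff.1 h' x
    simp only [pow_succ, pow_zero, one_mul, Perm.mul_apply _ (g * (h * g⁻¹ * h⁻¹)), c1, c2,
      Perm.one_apply] at h'
    exact hyx h'

theorem Equiv.Perm.IsThreeCycle.conj {g : Perm α} (hg : g.IsThreeCycle) (k : Perm α) :
    (k * g * k⁻¹).IsThreeCycle := by
  rwa [IsThreeCycle, cycleType_conj]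

theorem Equiv.Perm.IsThreeCycle.pow_three {g : Perm α} (hg : g.IsThreeCycle) : g ^ 3 = 1 := by
  rw [← hg.orderOf, pow_orderOf_eq_one]

theorem isThreeCycle_map (hα : Fintype.card α = 5 ∨ 7 ≤ Fintype.card α)
    (φ : alternatingGroup α ≃* alternatingGroup α) {g : alternatingGroup α}
    (hg : (g : Perm α).IsThreeCycle) : (φ g : Perm α).IsThreeCycle := by
  have h1 : (φ g : Perm α) ≠ 1 := fun h => by
    have : g = 1 := φ.injective (by rw [map_one]; exact Subtype.ext h)
    rw [this] at hg
    exact hg.isCycle.ne_one rfl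
  have h3 : (φ g : Perm α) ^ 3 = 1 := by
    have : g ^ 3 = 1 := Subtype.ext hg.pow_three
    rw [← SubgroupClass.coe_pow, ← map_pow, this, map_one]; rfl
  rcases hα with hα | hα
  · refine isThreeCycle_of_pow_three_of_card_le hα.le h1 h3
  refine isThreeCycle_of_commutator_pow hα h1 h3 fun h hh => ?_
  obtain ⟨k, hk⟩ := φ.surjective ⟨h, hh⟩
  replace hk : h = φ k := (congrArg Subtype.val hk).symm
  have hk3 : ((k * g⁻¹ * k⁻¹ : alternatingGroup α) : Perm α).IsThreeCycle :=
    hg.inv.conj k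
  have key : ∀ m, ((g : Perm α) * (k * g⁻¹ * k⁻¹ : alternatingGroup α)) ^ m = 1 →
      ((φ g : Perm α) * (h * (φ g : Perm α)⁻¹ * h⁻¹)) ^ m = 1 := fun m hm => by
    have : (g * (k * g⁻¹ * k⁻¹)) ^ m = 1 := Subtype.ext hm
    have := congrArg (fun x => (φ x : Perm α)) this
    simpa [hk] using this
  exact (threeCycle_mul_pow (by omega) hg hk3).imp (key 2) (Or.imp (key 3) (key 5))

end Automorphisms

section Automorphisms

open Equiv Equiv.Perm

variable {α : Type} [DecidableEq α] [Fintype α]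

theorem Equiv.Perm.IsThreeCycle.eq_of_apply_ne {g : Perm α} (hg : g.IsThreeCycle) {p : α}
    (hp : g p ≠ p) : g (g p) ≠ p ∧ g (g p) ≠ g p ∧ g (g (g p)) = p ∧
      g = Equiv.swap p (g p) * Equiv.swap (g p) (g (g p)) ∧
      ∀ t, g t ≠ t → t = p ∨ t = g p ∨ t = g (g p) := by
  have hs := hg.eq_swap_mul_swap_iff_mem_support.2 (Perm.mem_support.2 hp)
  have h3 : g (g (g p)) = p := by
    simpa [pow_succ] using Perm.ext_iff.1 hg.pow_three p
  have hn : g (g p) ≠ g p := g.injective.ne hp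
  refine ⟨fun h => hp ((congrArg g h).symm.trans h3), hn, h3, hs, fun t ht => ?_⟩
  by_contra! h
  refine ht ?_
  rw [hs, Perm.mul_apply, swap_apply_of_ne_of_ne h.2.1 h.2.2, swap_apply_of_ne_of_ne h.1 h.2.1]

theorem swap_mul_swap_conj {β : Type} [DecidableEq β] {a b i : β} (hib : i ≠ b) (hia : i ≠ a) :
    Equiv.swap a b * Equiv.swap b i * Equiv.swap a b = Equiv.swap a i := by
  rw [Equiv.swap_comm b i, Equiv.swap_comm a b, swap_mul_swap_mul_swap hib hia]

/-- A third 3-cycle sharing an arrow with each of `(p q r)` and `(p q s)` has the arrow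
`p → q`. -/
theorem Equiv.Perm.IsThreeCycle.apply_eq_of_common {y₁ y₂ y₃ : Perm α} (h₁ : y₁.IsThreeCycle)
    (h₂ : y₂.IsThreeCycle) (h₃ : y₃.IsThreeCycle) (hne : y₁ ≠ y₂) {p u v : α} (hp : y₁ p ≠ p)
    (hp2 : y₂ p = y₁ p) (hu : y₁ u ≠ u) (hu3 : y₃ u = y₁ u) (hv : y₂ v ≠ v) (hv3 : y₃ v = y₂ v) :
    y₃ p = y₁ p := by
  obtain ⟨a1, a2, a3, a4, a5⟩ := h₁.eq_of_apply_ne hp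
  obtain ⟨b1, b2, b3, b4, b5⟩ := h₂.eq_of_apply_ne (hp2 ▸ hp)
  have hrs : y₁ (y₁ p) ≠ y₂ (y₂ p) := fun h => hne (by rw [a4, b4, ← h, hp2])
  obtain ⟨c1, c2, c3, c4, c5⟩ := h₃.eq_of_apply_ne (hu3 ▸ hu)
  have := a5 u hu
  have := b5 v hv
  have := c5 v (hv3 ▸ hv)
  grind

variable {f : Perm α → Perm α}

/-- A monomorphism from the alternating group to the symmetric group which preserves 3-cycles is
conjugation by a permutation. -/
theorem exists_conj (hα : 5 ≤ Fintype.card α)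
    (hmul : ∀ g ∈ alternatingGroup α, ∀ k ∈ alternatingGroup α, f (g * k) = f g * f k)
    (hinj : ∀ g ∈ alternatingGroup α, f g = 1 → g = 1)
    (h3 : ∀ g, g.IsThreeCycle → (f g).IsThreeCycle) :
    ∃ σ : Perm α, ∀ g ∈ alternatingGroup α, f g = σ * g * σ⁻¹ := by
  have hone : f 1 = 1 := by simpa using hmul 1 (one_mem _) 1 (one_mem _)
  have hinv : ∀ g ∈ alternatingGroup α, f g⁻¹ = (f g)⁻¹ := fun g hg => by
    rw [eq_inv_iff_mul_eq_one, ← hmul _ (inv_mem hg) _ hg, inv_mul_cancel, hone]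
  have hinj' : ∀ g ∈ alternatingGroup α, ∀ k ∈ alternatingGroup α, f g = f k → g = k := by
    intro g hg k hk h
    rw [← mul_inv_eq_one]
    refine hinj _ (mul_mem hg (inv_mem hk)) ?_
    rw [hmul _ hg _ (inv_mem hk), hinv _ hk, h, mul_inv_cancel]
  obtain ⟨a, -⟩ := exists_notMem (k := 5) hα [] (by simp)
  obtain ⟨b, hb⟩ := exists_notMem (k := 5) hα [a] (by simp)
  obtain ⟨i₁, hi₁⟩ := exists_notMem (k := 5) hα [a, b] (by simp)
  obtain ⟨i₂, hi₂⟩ := exists_notMem (k := 5) hα [a, b, i₁] (by simp)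
  simp only [List.mem_cons, List.not_mem_nil, or_false, not_or] at hb hi₁ hi₂
  have hab : a ≠ b := Ne.symm hb
  set x : α → Perm α := fun i => Equiv.swap a b * Equiv.swap b i with hx
  have hx3 : ∀ i, i ≠ a → i ≠ b → (x i).IsThreeCycle := fun i h1 h2 =>
    isThreeCycle_swap_mul_swap hab h1.symm h2.symm
  have hxA : ∀ i, i ≠ b → x i ∈ alternatingGroup α := fun i h2 =>
    double_mem_alternatingGroup hab h2.symm
  have hxx : ∀ i j, i ≠ a → i ≠ b → x i * x j = Equiv.swap a i * Equiv.swap b j := by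
    intro i j h1 h2
    rw [← swap_mul_swap_conj h2 h1]
    simp only [hx, mul_assoc]
  have hxinj : ∀ i j, x i = x j → i = j := fun i j h => by
    have := congrArg (fun g => g b) (mul_left_cancel h)
    simpa using this
  have hcommon : ∀ i j, i ≠ a → i ≠ b → j ≠ a → j ≠ b → i ≠ j →
      ∃ p, f (x i) p ≠ p ∧ f (x j) p = f (x i) p := by
    intro i j h1 h2 h3' h4 h5
    have hd : IsInvol (x i * x j) := by
      rw [hxx i j h1 h2]
      exact isInvol_double h1.symm hab h3'.symm h2 h5 h4.symm
    rw [IsInvol] at hd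
    refine threeCycle_common (h3 _ (hx3 i h1 h2)) (h3 _ (hx3 j h3' h4)) ?_ ?_
    · rw [← hmul _ (hxA i h2) _ (hxA j h4), pow_two,
        ← hmul _ (mul_mem (hxA i h2) (hxA j h4)) _ (mul_mem (hxA i h2) (hxA j h4)), hd.2, hone]
    · rw [← hmul _ (hxA i h2) _ (hxA j h4)]
      exact fun h => hd.1 (hinj _ (mul_mem (hxA i h2) (hxA j h4)) h)
  obtain ⟨p, hp, hp2⟩ := hcommon i₁ i₂ hi₁.1 hi₁.2 hi₂.1 hi₂.2.1 (Ne.symm hi₂.2.2)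
  obtain ⟨q, hq⟩ : ∃ q, q = f (x i₁) p := ⟨_, rfl⟩
  rw [← hq] at hp hp2
  have hpq : ∀ i, i ≠ a → i ≠ b → f (x i) p = q := by
    intro i h1 h2
    by_cases e1 : i = i₁
    · rw [e1, hq]
    by_cases e2 : i = i₂
    · rw [e2, hp2]
    obtain ⟨u, hu, hu'⟩ := hcommon i₁ i hi₁.1 hi₁.2 h1 h2 (Ne.symm e1)
    obtain ⟨v, hv, hv'⟩ := hcommon i₂ i hi₂.1 hi₂.2.1 h1 h2 (Ne.symm e2)
    rw [hq]
    refine IsThreeCycle.apply_eq_of_common (h3 _ (hx3 _ hi₁.1 hi₁.2)) (h3 _ (hx3 _ hi₂.1 hi₂.2.1))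
      (h3 _ (hx3 i h1 h2)) (fun h => ?_) (hq ▸ hp) (hp2.trans hq) hu hu' hv hv'
    exact hi₂.2.2 (hxinj _ _ (hinj' _ (hxA _ hi₁.2) _ (hxA _ hi₂.2.1) h)).symm
  have hy : ∀ i, i ≠ a → i ≠ b → f (x i) q ≠ p ∧ f (x i) q ≠ q ∧
      f (x i) = Equiv.swap p q * Equiv.swap q (f (x i) q) := by
    intro i h1 h2
    have := (h3 _ (hx3 i h1 h2)).eq_of_apply_ne (p := p) (by rwa [hpq i h1 h2])
    rw [hpq i h1 h2] at this
    exact ⟨this.1, this.2.1, this.2.2.2.1⟩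
  have hyinj : ∀ i j, i ≠ a → i ≠ b → j ≠ a → j ≠ b → f (x i) q = f (x j) q → i = j := by
    intro i j h1 h2 h3 h4 h
    refine hxinj _ _ (hinj' _ (hxA _ h2) _ (hxA _ h4) ?_)
    rw [(hy i h1 h2).2.2, (hy j h3 h4).2.2, h]
  let s : α → α := fun i => if i = a then p else if i = b then q else f (x i) q
  have sa : s a = p := if_pos rfl
  have sb : s b = q := by simp [s, hb]
  have si : ∀ i, i ≠ a → i ≠ b → s i = f (x i) q := fun i h1 h2 => by simp [s, h1, h2]
  have hs : Injective s := by
    intro i j hij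
    by_cases h1 : i = a <;> by_cases h2 : j = a <;> by_cases h3 : i = b <;>
      by_cases h4 : j = b <;> grind
  let σ : Perm α := Equiv.ofBijective s (Finite.injective_iff_bijective.1 hs)
  have hσ : ∀ i, σ i = s i := fun i => rfl
  refine ⟨σ, ?_⟩
  let K : Subgroup (Perm α) :=
    { carrier := {g | g ∈ alternatingGroup α ∧ f g = σ * g * σ⁻¹}
      mul_mem' := fun {g k} hg hk => ⟨mul_mem hg.1 hk.1, by
        rw [hmul _ hg.1 _ hk.1, hg.2, hk.2]; group⟩
      one_mem' := ⟨one_mem _, by rw [hone]; group⟩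
      inv_mem' := fun {g} hg => ⟨inv_mem hg.1, by rw [hinv _ hg.1, hg.2]; group⟩ }
  have hxK : ∀ i, i ≠ a → i ≠ b → x i ∈ K := fun i h1 h2 => ⟨hxA i h2, by
    rw [(hy i h1 h2).2.2, ← si i h1 h2, ← sa, ← sb, ← hσ, ← hσ, ← hσ, Equiv.swap_apply_apply,
      Equiv.swap_apply_apply]
    simp only [hx]
    group⟩
  have hZ : ∀ i, i ≠ b → Equiv.swap b i * Equiv.swap a b ∈ K := by
    intro i h
    by_cases h1 : i = a
    · rw [h1, Equiv.swap_comm, swap_mul_self]; exact one_mem K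
    · simpa [hx] using inv_mem (hxK i h1 h)
  have hW : ∀ i, i ≠ a → Equiv.swap a i * Equiv.swap a b ∈ K := by
    intro i h
    by_cases h1 : i = b
    · rw [h1, swap_mul_self]; exact one_mem K
    · rw [← swap_mul_swap_conj h1 h, mul_assoc, swap_mul_self, mul_one]
      exact hxK i h h1
  have hT : ∀ i j, i ≠ j → Equiv.swap i j * Equiv.swap a b ∈ K := by
    intro i j hij
    by_cases h1 : i = a
    · rw [h1]; exact hW j (h1 ▸ hij.symm)
    by_cases h2 : j = a
    · rw [h2, Equiv.swap_comm]; exact hW i h1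
    by_cases h3 : i = b
    · rw [h3]; exact hZ j (h3 ▸ hij.symm)
    by_cases h4 : j = b
    · rw [h4, Equiv.swap_comm]; exact hZ i h3
    have : Equiv.swap i j * Equiv.swap a b = Equiv.swap b i * Equiv.swap a b * x j *
        (Equiv.swap b i * Equiv.swap a b) := by
      rw [← swap_mul_swap_conj h4 hij.symm, Equiv.swap_comm i b]
      simp only [hx, mul_assoc, swap_mul_self_mul]
    rw [this]
    exact mul_mem (mul_mem (hZ i h3) (hxK j h2 h4)) (hZ i h3)
  have hK : alternatingGroup α ≤ K := by
    rw [← closure_three_cycles_eq_alternating, Subgroup.closure_le]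
    intro g hg
    obtain ⟨u, v, w, huv, huw, hvw, rfl⟩ := IsThreeCycle.exists_eq_swap hg
    have := mul_mem (hT u v huv) (inv_mem (hT v w hvw))
    simpa [mul_assoc] using this
  exact fun g hg => (hK hg).2

end Automorphisms

section Action

open Equiv Equiv.Perm

variable {α : Type} [DecidableEq α] [Fintype α]

theorem eq_of_forall_alternatingGroup_conj (hα : 4 ≤ Fintype.card α) {σ τ : Perm α}
    (h : ∀ g ∈ alternatingGroup α, σ * g * σ⁻¹ = τ * g * τ⁻¹) : σ = τ := by
  by_contra hne
  obtain ⟨i, hi⟩ : ∃ i, σ i ≠ τ i := by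
    by_contra! h'
    exact hne (Perm.ext h')
  obtain ⟨m, hm⟩ := τ.surjective (σ i)
  have him : i ≠ m := fun h => hi (by rw [← hm, h])
  obtain ⟨j, hj⟩ := exists_notMem hα [i, m] (by simp)
  obtain ⟨k, hk⟩ := exists_notMem hα [i, m, j] (by simp)
  simp only [List.mem_cons, List.not_mem_nil, or_false, not_or] at hj hk
  have hg := Perm.ext_iff.1 (h (Equiv.swap m j * Equiv.swap j k)
    (double_mem_alternatingGroup (Ne.symm hj.2) (Ne.symm hk.2.2))) (σ i)
  have h1 : σ⁻¹ (σ i) = i := by rw [Perm.inv_eq_iff_eq]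
  have h2 : τ⁻¹ (σ i) = m := by rw [Perm.inv_eq_iff_eq, hm]
  simp only [Perm.mul_apply, h1, h2] at hg
  rw [swap_apply_of_ne_of_ne (Ne.symm hj.2) (Ne.symm hk.2.1),
    swap_apply_left, swap_apply_of_ne_of_ne (Ne.symm hj.1) (Ne.symm hk.1),
    swap_apply_of_ne_of_ne him (Ne.symm hj.1), ← hm] at hg
  exact hj.2 (τ.injective hg.symm)

variable {G : Type} [Group G] {L : Subgroup G} [L.Normal] (e : L ≃* alternatingGroup α)

/-- The automorphism of the alternating group induced by conjugation by `g`. -/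
def conjAut (g : G) : alternatingGroup α ≃* alternatingGroup α :=
  e.symm.trans ((MulAut.conjNormal g).trans e)

theorem conjAut_apply (g : G) (l : L) : conjAut e g (e l) = e (MulAut.conjNormal g l) := by
  simp [conjAut]

theorem conjAut_mul (g h : G) (x : alternatingGroup α) :
    conjAut e (g * h) x = conjAut e g (conjAut e h x) := by
  simp [conjAut]

theorem conjAut_one (x : alternatingGroup α) : conjAut e 1 x = x := by
  simp [conjAut]

theorem conjAut_coe (l : L) (x : alternatingGroup α) : conjAut e l x = e l * x * (e l)⁻¹ := by
  obtain ⟨m, rfl⟩ := e.surjective x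
  rw [conjAut_apply, ← map_mul, ← map_inv, ← map_mul]
  exact congrArg e (Subtype.ext (by simp))

/-- Conjugation by `g` induces conjugation by the permutation `σ`. -/
def ActsAs (g : G) (σ : Perm α) : Prop :=
  ∀ x : alternatingGroup α, (conjAut e g x : Perm α) = σ * x * σ⁻¹

variable {e} {g h : G} {σ τ : Perm α}

theorem ActsAs.mul (hg : ActsAs e g σ) (hh : ActsAs e h τ) : ActsAs e (g * h) (σ * τ) := fun x => by
  rw [conjAut_mul, hg, hh]
  group

theorem actsAs_coe (l : L) : ActsAs e l (e l) := fun x => by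
  rw [conjAut_coe]; rfl

theorem actsAs_one : ActsAs e 1 1 := fun x => by
  rw [conjAut_one]; group

theorem ActsAs.unique (hα : 4 ≤ Fintype.card α) (hg : ActsAs e g σ) (hg' : ActsAs e g τ) :
    σ = τ :=
  eq_of_forall_alternatingGroup_conj hα fun k hk => by rw [← hg ⟨k, hk⟩, ← hg' ⟨k, hk⟩]

theorem ActsAs.eq_one (hcent : Subgroup.centralizer (L : Set G) = ⊥) (hg : ActsAs e g 1) :
    g = 1 := by
  rw [← Subgroup.mem_bot, ← hcent, Subgroup.mem_centralizer_iff]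
  intro l hl
  have := hg (e ⟨l, hl⟩)
  rw [one_mul, inv_one, mul_one, conjAut_apply] at this
  have := congrArg Subtype.val (e.injective (Subtype.ext this))
  rw [MulAut.conjNormal_apply, mul_inv_eq_iff_eq_mul] at this
  exact this.symm

theorem ActsAs.mem (hcent : Subgroup.centralizer (L : Set G) = ⊥) (hg : ActsAs e g σ)
    (hσ : σ ∈ alternatingGroup α) : g ∈ L := by
  have h1 : ActsAs e ((e.symm ⟨σ, hσ⟩ : L) : G)⁻¹ σ⁻¹ := by
    have := actsAs_coe (e := e) (e.symm ⟨σ, hσ⟩)⁻¹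
    simpa using this
  have h2 := h1.mul hg
  rw [inv_mul_cancel] at h2
  rw [← inv_mul_eq_one.1 (h2.eq_one hcent)]
  exact Subtype.property _

theorem exists_actsAs (hα : 5 ≤ Fintype.card α) (h3 : ∀ x : alternatingGroup α,
    (x : Perm α).IsThreeCycle → (conjAut e g x : Perm α).IsThreeCycle) : ∃ σ, ActsAs e g σ := by
  classical
  obtain ⟨σ, hσ⟩ := exists_conj (f := fun k => if h : k ∈ alternatingGroup α then
      (conjAut e g ⟨k, h⟩ : Perm α) else 1) hα
    (fun k hk l hl => by
      simp only [hk, hl, mul_mem hk hl, dif_pos]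
      rw [← Subgroup.coe_mul, ← map_mul]
      rfl)
    (fun k hk h => by
      simp only [hk, dif_pos] at h
      have : (⟨k, hk⟩ : alternatingGroup α) = 1 :=
        (conjAut e g).injective (by rw [map_one]; exact Subtype.ext h)
      exact congrArg Subtype.val this)
    (fun k hk => by
      simp only [hk.mem_alternatingGroup, dif_pos]
      exact h3 ⟨k, _⟩ hk)
  refine ⟨σ, fun x => ?_⟩
  rw [← hσ x x.2]
  simp

theorem exists_injective_of_forall_actsAs (hα : 4 ≤ Fintype.card α)
    (hcent : Subgroup.centralizer (L : Set G) = ⊥) (h : ∀ g : G, ∃ σ, ActsAs e g σ) :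
    ∃ φ : G →* Perm α, Injective φ ∧
      (Set.range φ = (alternatingGroup α : Set (Perm α)) ∨ Set.range φ = Set.univ) := by
  choose φ hφ using h
  have hmul : ∀ g h, φ (g * h) = φ g * φ h := fun g h => (hφ _).unique hα ((hφ g).mul (hφ h))
  have hA : ∀ k ∈ alternatingGroup α, ∃ g, φ g = k := fun k hk =>
    ⟨(e.symm ⟨k, hk⟩ : L), (hφ _).unique hα (by
      have := actsAs_coe (e := e) (e.symm ⟨k, hk⟩)
      rwa [e.apply_symm_apply] at this)⟩
  refine ⟨MonoidHom.mk' φ hmul, ?_, ?_⟩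
  · rw [injective_iff_map_eq_one]
    exact fun g hg => ActsAs.eq_one hcent (by rw [← show φ g = 1 from hg]; exact hφ g)
  · by_cases hr : ∃ g, φ g ∉ alternatingGroup α
    · right
      obtain ⟨g, hg⟩ := hr
      refine Set.eq_univ_of_forall fun k => ?_
      by_cases hk : k ∈ alternatingGroup α
      · exact hA k hk
      · obtain ⟨g', hg'⟩ := hA _ (mul_mem_of_notMem hk hg)
        exact ⟨g' * g⁻¹, by rw [map_mul, map_inv]; change φ g' * (φ g)⁻¹ = k; rw [hg',
          mul_inv_cancel_right]⟩
    · left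
      push Not at hr
      ext k
      exact ⟨fun ⟨g, hg⟩ => hg ▸ hr g, hA k⟩

end Action

section NotSix

open Equiv Equiv.Perm

theorem simplyConn_or_freeDatum_alternating {n : ℕ} (hn : 5 ≤ n) :
    SimplyConn (invRel (alternatingGroup (Fin n) : Set (Perm (Fin n)))) ∨
      FreeDatum (invRel (alternatingGroup (Fin n) : Set (Perm (Fin n)))) := by
  by_cases h9 : 9 ≤ n
  · exact Or.inl (simplyConn_alternating (by simpa using h9))
  by_cases h8 : n = 8
  · subst h8
    exact Or.inl simplyConn_alternating_eight
  · exact Or.inr (freeDatum_alternating (by omega))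

theorem simplyConn_or_freeDatum_perm {n : ℕ} (hn : n = 5 ∨ 7 ≤ n) :
    SimplyConn (invRel (Set.univ : Set (Perm (Fin n)))) ∨
      FreeDatum (invRel (Set.univ : Set (Perm (Fin n)))) := by
  rcases hn with rfl | hn
  · exact Or.inr freeDatum_perm_five
  · exact Or.inl (simplyConn_perm (by simpa using hn))

theorem simplyConn_or_freeDatum_of_ne_six {n : ℕ} (hn : n = 5 ∨ 7 ≤ n) {G : Type} [Group G]
    {L : Subgroup G} [L.Normal] (e : L ≃* alternatingGroup (Fin n))
    (hcent : Subgroup.centralizer (L : Set G) = ⊥) :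
    SimplyConn (invRel (Set.univ : Set G)) ∨ FreeDatum (invRel (Set.univ : Set G)) := by
  obtain ⟨φ, hφ, hr⟩ := exists_injective_of_forall_actsAs (e := e)
    (by rw [Fintype.card_fin]; omega) hcent fun g =>
    exists_actsAs (by rw [Fintype.card_fin]; omega) fun x hx =>
      isThreeCycle_map (by rwa [Fintype.card_fin]) _ hx
  rw [← Set.image_univ] at hr
  have h : SimplyConn (invRel (φ '' Set.univ)) ∨ FreeDatum (invRel (φ '' Set.univ)) := by
    rcases hr with hr | hr <;> rw [hr]
    · exact simplyConn_or_freeDatum_alternating (by omega)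
    · exact simplyConn_or_freeDatum_perm hn
  exact h.imp (simplyConn_image hφ).1 (freeDatum_of_image hφ)

end NotSix

section SixPoints

open Equiv Equiv.Perm

variable {α : Type} [DecidableEq α] [Fintype α]

theorem IsInvol.exists_fixed_of_card_eq_six (hα : Fintype.card α = 6) {a : Perm α} (ha : IsInvol a)
    (haA : a ∈ alternatingGroup α) : ∃ i j, i ≠ j ∧ ∀ x, a x = x ↔ x = i ∨ x = j := by
  have h1 := ha.mem_alternatingGroup_iff.1 haA
  have h2 := Finset.card_compl a.support
  have h3 : a.support.card ≠ 0 := fun h => ha.1 (support_eq_empty_iff.1 (Finset.card_eq_zero.1 h))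
  have h4 := Finset.card_le_univ a.support
  obtain ⟨i, j, hij, h⟩ := Finset.card_eq_two.1 (show (a.supportᶜ).card = 2 by omega)
  refine ⟨i, j, hij, fun x => ?_⟩
  simpa using Finset.ext_iff.1 h x

theorem not_nodup_of_card_eq_six {β : Type} [Fintype β] (hβ : Fintype.card β = 6)
    (x₁ x₂ x₃ x₄ x₅ x₆ x₇ : β) :
    ¬ [x₁, x₂, x₃, x₄, x₅, x₆, x₇].Nodup := fun h => by
  have := h.length_le_card
  simp only [List.length_cons, List.length_nil] at this
  omega

theorem comm_of_fixed_of_card_eq_six (hα : Fintype.card α = 6) {i j : α} (hij : i ≠ j)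
    {a b : Perm α} (ha : IsInvol a) (hb : IsInvol b) (hai : ∀ x, a x = x ↔ x = i ∨ x = j)
    (hbi : ∀ x, b x = x ↔ x = i ∨ x = j) : a * b = b * a := by
  ext1 x
  rw [Perm.mul_apply, Perm.mul_apply]
  have ha2 := ha.apply_apply
  have hb2 := hb.apply_apply
  by_cases hx : x = i ∨ x = j
  · rw [(hai x).2 hx, (hbi x).2 hx, (hai x).2 hx]
  by_cases hxy : a x = b x
  · rw [← hxy, ha2, hxy, hb2]
  by_contra hne
  have h1 := hai (a x)
  have h2 := hbi (b x)
  have h3 := hai (b x)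
  have h4 := hbi (a x)
  have h5 := hai x
  have h6 := hbi x
  have h7 := hai (a (b x))
  have h8 := hbi (b (a x))
  refine not_nodup_of_card_eq_six hα i j x (a x) (b x) (a (b x)) (b (a x)) ?_
  simp only [List.nodup_cons, List.mem_cons, List.not_mem_nil, or_false, not_or, List.nodup_nil,
    not_false_eq_true, and_true]
  grind

theorem isNormalEA_of_swap (hα : Fintype.card α = 6) {i j : α} (hij : i ≠ j) :
    IsNormalEA {o : Perm α | o ∈ alternatingGroup α ∧ o * o = 1 ∧ o i = i ∧ o j = j}
      (centIn (alternatingGroup α) (Equiv.swap i j)) := by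
  have hcomm : ∀ o : Perm α, o ∈ alternatingGroup α → o * o = 1 → o i = i → o j = j →
      ∀ o' : Perm α, o' ∈ alternatingGroup α → o' * o' = 1 → o' i = i → o' j = j →
      o * o' = o' * o := by
    intro o h1 h2 h3 h4 o' h1' h2' h3' h4'
    by_cases h : o = 1
    · rw [h, one_mul, mul_one]
    by_cases h' : o' = 1
    · rw [h', one_mul, mul_one]
    have key : ∀ o : Perm α, o ∈ alternatingGroup α → o * o = 1 → o i = i → o j = j → o ≠ 1 →
        ∀ x, o x = x ↔ x = i ∨ x = j := by
      intro o h1 h2 h3 h4 h5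
      obtain ⟨k, l, hkl, hfix⟩ := IsInvol.exists_fixed_of_card_eq_six hα ⟨h5, h2⟩ h1
      have := (hfix i).1 h3
      have := (hfix j).1 h4
      grind
    exact comm_of_fixed_of_card_eq_six hα hij ⟨h, h2⟩ ⟨h', h2'⟩ (key o h1 h2 h3 h4 h)
      (key o' h1' h2' h3' h4' h')
  refine ⟨?_, fun o h => h.2.1, fun o h o' h' => hcomm o h.1 h.2.1 h.2.2.1 h.2.2.2 o' h'.1 h'.2.1
    h'.2.2.1 h'.2.2.2, ?_, ?_, ?_⟩
  · rintro o ⟨h1, h2, h3, h4⟩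
    exact ⟨h1, by rw [Equiv.mul_swap_eq_swap_mul, h3, h4]⟩
  · rintro o ⟨h1, h2, h3, h4⟩ o' ⟨h1', h2', h3', h4'⟩
    refine ⟨mul_mem h1 h1', ?_, by rw [Perm.mul_apply, h3', h3], by rw [Perm.mul_apply, h4', h4]⟩
    refine (congrArg (o * o' * ·) (hcomm o h1 h2 h3 h4 o' h1' h2' h3' h4')).trans ?_
    rw [mul_assoc, ← mul_assoc o', h2', one_mul, h2]
  · obtain ⟨k, hk⟩ := exists_notMem hα.ge [i, j] (by simp)
    obtain ⟨l, hl⟩ := exists_notMem hα.ge [i, j, k] (by simp)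
    obtain ⟨m, hm⟩ := exists_notMem hα.ge [i, j, k, l] (by simp)
    obtain ⟨n, hn⟩ := exists_notMem hα.ge [i, j, k, l, m] (by simp)
    simp only [List.mem_cons, List.not_mem_nil, or_false, not_or] at hk hl hm hn
    have h := isInvol_double (i := k) (j := l) (k := m) (l := n) (by grind) (by grind) (by grind)
      (by grind) (by grind) (by grind)
    refine ⟨_, ⟨double_mem_alternatingGroup (by grind) (by grind), h.2, ?_, ?_⟩, h.1⟩ <;>
      rw [Perm.mul_apply, swap_apply_of_ne_of_ne, swap_apply_of_ne_of_ne] <;> grind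
  · rintro s ⟨hs, hst⟩ hs2 o ⟨h1, h2, h3, h4⟩
    have hs2' : ∀ x, s (s x) = x := fun x => Perm.ext_iff.1 hs2 x
    have hsi : s i = i ∨ s i = j := by
      have := apply_comm hst i
      rw [swap_apply_left] at this
      refine (swap_apply_ne_self_iff.1 (show Equiv.swap i j (s i) ≠ s i from ?_)).2
      rw [this]
      exact s.injective.ne hij.symm
    have hsj : s j = i ∨ s j = j := by
      have := apply_comm hst j
      rw [swap_apply_right] at this
      refine (swap_apply_ne_self_iff.1 (show Equiv.swap i j (s j) ≠ s j from ?_)).2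
      rw [this]
      exact s.injective.ne hij
    refine ⟨mul_mem (mul_mem hs h1) hs, ?_, ?_, ?_⟩
    · rw [mul_assoc s o s, mul_assoc s, mul_assoc o, ← mul_assoc s s, hs2, one_mul, ← mul_assoc o,
        h2, one_mul, hs2]
    · simp only [Perm.mul_apply]; grind
    · simp only [Perm.mul_apply]; grind

variable {g a b : Perm α}

theorem isThreeCycle_of_fixed_of_card_eq_six (hα : Fintype.card α = 6) (h1 : g ≠ 1)
    (h3 : ∀ x, g (g (g x)) = x) {i : α} (hi : g i = i) : g.IsThreeCycle := by
  refine (isThreeCycle_or_exists h1 h3).resolve_right ?_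
  rintro ⟨x, y, hx, hy, hyx, hygx, hyggx, hx2, hy2⟩
  refine not_nodup_of_card_eq_six hα x (g x) (g (g x)) y (g y) (g (g y)) i ?_
  simp only [List.nodup_cons, List.mem_cons, List.not_mem_nil, or_false, not_or, List.nodup_nil,
    not_false_eq_true, and_true]
  and_intros <;> grind

theorem isThreeCycle_of_pair_of_card_eq_six (hα : Fintype.card α = 6) (h1 : g ≠ 1)
    (h3 : ∀ x, g (g (g x)) = x) {i j : α} (hg : ∀ x, x = i ∨ x = j → g x = i ∨ g x = j) :
    g.IsThreeCycle := by
  refine isThreeCycle_of_fixed_of_card_eq_six hα h1 h3 (i := i) ?_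
  have := hg i
  have := hg j
  have := h3 i
  grind

theorem Equiv.Perm.IsThreeCycle.exists_fixed_of_card_eq_six (hα : Fintype.card α = 6)
    (hg : g.IsThreeCycle) : ∃ p, g p = p := by
  by_contra! h
  have h1 : g.support = Finset.univ := Finset.eq_univ_of_forall fun x => Perm.mem_support.2 (h x)
  have h2 := hg.card_support
  rw [h1, Finset.card_univ, hα] at h2
  omega

/-- A 3-cycle does not commute with a fixed point free involution. -/
theorem not_isThreeCycle_of_commute {t : Perm α} (ht : IsInvol t) (hfix : ∀ x, t x ≠ x)
    (hc : t * g = g * t) : ¬ g.IsThreeCycle := fun h => by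
  obtain ⟨u, hu⟩ : ∃ u, g u ≠ u := by
    by_contra! h'
    exact h.isCycle.ne_one (Perm.ext h')
  obtain ⟨h1, h2, h3, h4, h5⟩ := h.eq_of_apply_ne hu
  have := h5 (t u) fun h => hu (t.injective (by rw [apply_comm hc, h]))
  have := apply_comm hc
  have := ht.apply_apply u
  grind

end SixPoints

section SixPoints

open Equiv Equiv.Perm

variable {α : Type} [DecidableEq α] [Fintype α]

theorem apply_apply_apply_of_pow_three {β : Type} {g : Perm β} (h : g ^ 3 = 1) (x : β) :
    g (g (g x)) = x := by
  simpa [pow_succ] using Perm.ext_iff.1 h x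

theorem cycleType_of_not_isThreeCycle (hα : Fintype.card α = 6) {g : Perm α} (h1 : g ≠ 1)
    (h3 : g ^ 3 = 1) (h : ¬ g.IsThreeCycle) : g.cycleType = {3, 3} := by
  have ho : orderOf g = 3 := orderOf_eq_prime h3 h1
  obtain ⟨n, hn⟩ := cycleType_prime_order (σ := g) (by rw [ho]; exact Nat.prime_three)
  rw [ho] at hn
  have hs := sum_cycleType g
  have hs' := Finset.card_le_univ g.support
  rw [hn, Multiset.sum_replicate, smul_eq_mul] at hs
  have hn0 : n ≠ 0 := fun h0 => h (by rw [IsThreeCycle, hn, h0]; rfl)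
  obtain rfl : n = 1 := by omega
  exact hn

theorem isConj_of_not_isThreeCycle (hα : Fintype.card α = 6) {g h : alternatingGroup α}
    (hg1 : g ≠ 1) (hg3 : g ^ 3 = 1) (hg : ¬ (g : Perm α).IsThreeCycle) (hh1 : h ≠ 1)
    (hh3 : h ^ 3 = 1) (hh : ¬ (h : Perm α).IsThreeCycle) : IsConj g h := by
  have hcg := cycleType_of_not_isThreeCycle hα (fun h => hg1 (Subtype.ext h))
    (congrArg Subtype.val hg3) hg
  have hch := cycleType_of_not_isThreeCycle hα (fun h => hh1 (Subtype.ext h))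
    (congrArg Subtype.val hh3) hh
  obtain ⟨k, hk⟩ := isConj_iff.1 (isConj_iff_cycleType_eq.2 (hcg.trans hch.symm))
  by_cases hkA : k ∈ alternatingGroup α
  · exact isConj_iff.2 ⟨⟨k, hkA⟩, Subtype.ext hk⟩
  obtain ⟨w, hw, hwA⟩ : ∃ w ∈ Subgroup.centralizer {(g : Perm α)}, w ∉ alternatingGroup α := by
    by_contra! h
    have := (centralizer_le_alternating_iff.1 h).2.2 3
    rw [hcg] at this
    simp at this
  refine isConj_iff.2 ⟨⟨k * w, mul_mem_of_notMem hkA hwA⟩, Subtype.ext ?_⟩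
  change k * w * g * (k * w)⁻¹ = h
  rw [Subgroup.mem_centralizer_singleton_iff] at hw
  rw [mul_inv_rev, mul_assoc k, hw, ← hk]
  group

/-- An involutive automorphism of the alternating group on six points which does not preserve
3-cycles interchanges the two classes of elements of order three. -/
theorem isThreeCycle_map_iff (hα : Fintype.card α = 6)
    {φ : alternatingGroup α ≃* alternatingGroup α} (hφ : ∀ x, φ (φ x) = x) {c : alternatingGroup α}
    (hc : (c : Perm α).IsThreeCycle) (hc' : ¬ (φ c : Perm α).IsThreeCycle) {g : alternatingGroup α}
    (hg1 : g ≠ 1) (hg3 : g ^ 3 = 1) :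
    (φ g : Perm α).IsThreeCycle ↔ ¬ (g : Perm α).IsThreeCycle := by
  have hconj : ∀ {x y : alternatingGroup α}, IsConj x y →
      ((φ x : Perm α).IsThreeCycle ↔ (φ y : Perm α).IsThreeCycle) := by
    intro x y h
    have : (φ x : Perm α).cycleType = (φ y : Perm α).cycleType := isConj_iff_cycleType_eq.1
      (((alternatingGroup α).subtype.comp φ.toMonoidHom).map_isConj h)
    rw [IsThreeCycle, IsThreeCycle, this]
  by_cases hg : (g : Perm α).IsThreeCycle
  · have := alternatingGroup.isThreeCycle_isConj (by rw [Nat.card_eq_fintype_card]; omega) hg hc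
    simp only [hconj this, hc', hg, not_true]
  · have hc1 : φ c ≠ 1 := (map_ne_one_iff _ φ.injective).2 fun h =>
      hc.isCycle.ne_one (congrArg Subtype.val h)
    have hc3 : φ c ^ 3 = 1 := by
      rw [← map_pow, show c ^ 3 = 1 from Subtype.ext hc.pow_three, map_one]
    simp only [hconj (isConj_of_not_isThreeCycle hα hg1 hg3 hg hc1 hc3 hc'), hφ, hc, hg,
      not_false_eq_true]

theorem exists_isThreeCycle_mul_eq (hα : Fintype.card α = 6) {i j : α} (hij : i ≠ j)
    {a b : Perm α} (ha : IsInvol a) (hb : IsInvol b) (hab : a ≠ b)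
    (hai : ∀ x, a x = x ↔ x = i ∨ x = j)
    (hbi : ∀ x, b x = x ↔ x = i ∨ x = j) : ∃ g : Perm α, g.IsThreeCycle ∧ g * a = b * g := by
  have hcomm := apply_comm (comm_of_fixed_of_card_eq_six hα hij ha hb hai hbi)
  have ha2 := ha.apply_apply
  have hb2 := hb.apply_apply
  obtain ⟨x, hx⟩ : ∃ x, a x ≠ b x := by
    by_contra! h
    exact hab (Perm.ext h)
  have hxi : x ≠ i ∧ x ≠ j := by
    have := hai x
    have := hbi x
    grind
  have h1 := hai (a x)
  have h2 := hbi (b x)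
  have h3 := hai (b x)
  have h4 := hbi (a x)
  have h5 := hai x
  have h6 := hbi x
  have h7 := hai (a (b x))
  have h8 := hbi (a (b x))
  have hall : ∀ y, y = i ∨ y = j ∨ y = x ∨ y = a x ∨ y = b x ∨ y = a (b x) := by
    intro y
    by_contra! hy
    refine not_nodup_of_card_eq_six hα i j x (a x) (b x) (a (b x)) y ?_
    simp only [List.nodup_cons, List.mem_cons, List.not_mem_nil, or_false, not_or, List.nodup_nil,
      not_false_eq_true, and_true]
    and_intros <;> grind
  have n1 : a x ≠ b x := hx
  have n2 : a x ≠ a (b x) := by grind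
  have n3 : b x ≠ a (b x) := by grind
  refine ⟨Equiv.swap (a x) (b x) * Equiv.swap (b x) (a (b x)), isThreeCycle_swap_mul_swap n1 n2 n3,
    ?_⟩
  ext1 y
  simp only [Perm.mul_apply]
  rcases hall y with rfl | rfl | rfl | rfl | rfl | rfl <;> grind

theorem isThreeCycle_of_mul_eq (hα : Fintype.card α = 6) {i j : α} {a b g : Perm α} (h1 : g ≠ 1)
    (h3 : g ^ 3 = 1) (hai : ∀ x, a x = x ↔ x = i ∨ x = j) (hbi : ∀ x, b x = x ↔ x = i ∨ x = j)
    (hg : g * a = b * g) : g.IsThreeCycle := by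
  refine isThreeCycle_of_pair_of_card_eq_six hα h1 (apply_apply_apply_of_pow_three h3) (i := i)
    (j := j) fun x hx => (hbi _).1 ?_
  have := Perm.ext_iff.1 hg x
  rw [Perm.mul_apply, Perm.mul_apply, (hai x).2 hx] at this
  exact this.symm

theorem not_isThreeCycle_of_mul_eq (hα : Fintype.card α = 6) {i j k : α} {a b g : Perm α}
    (hij : i ≠ j) (ha : IsInvol a) (hb : IsInvol b) (hab : a * b = b * a)
    (hai : ∀ x, a x = x ↔ x = i ∨ x = j) (hbi : b i = j) (hbk : b k = k)
    (hg : g * a = b * g) (hg' : g * b = a * b * g) : ¬ g.IsThreeCycle := by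
  intro h
  obtain ⟨p, hp⟩ := h.exists_fixed_of_card_eq_six hα
  have hcomm := apply_comm hab
  have ha2 := ha.apply_apply
  have hb2 := hb.apply_apply
  have e1 := fun x => Perm.ext_iff.1 hg x
  have e2 := fun x => Perm.ext_iff.1 hg' x
  simp only [Perm.mul_apply] at e1 e2
  have hinj : ∀ x y, g x = g y → x = y := fun x y h => g.injective h
  have p1 : b p ≠ p := by grind
  have p2 : a p ≠ p := by grind
  have p3 : a p ≠ b p := by grind
  refine not_nodup_of_card_eq_six hα i j p (a p) (b p) (a (b p)) k ?_
  have h1 := hai (a p)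
  have h3 := hai (b p)
  have h5 := hai p
  have h7 := hai (a (b p))
  simp only [List.nodup_cons, List.mem_cons, List.not_mem_nil, or_false, not_or, List.nodup_nil,
    not_false_eq_true, and_true]
  and_intros <;> grind

theorem exists_mul_eq (hα : Fintype.card α = 6) {i j k l : α} {a b : Perm α}
    (hij : i ≠ j) (hkl : k ≠ l) (ha : IsInvol a) (hb : IsInvol b)
    (hai : ∀ x, a x = x ↔ x = i ∨ x = j) (hbk : ∀ x, b x = x ↔ x = k ∨ x = l) (hbi : b i = j)
    (hak : a k = l) : ∃ g ∈ alternatingGroup α, g ^ 3 = 1 ∧ g ≠ 1 ∧ g * a = b * g ∧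
      g * b = a * b * g := by
  have ha2 := ha.apply_apply
  have hb2 := hb.apply_apply
  have hai1 := (hai i).2 (Or.inl rfl)
  have hai2 := (hai j).2 (Or.inr rfl)
  have hbk1 := (hbk k).2 (Or.inl rfl)
  have hbk2 := (hbk l).2 (Or.inr rfl)
  obtain ⟨m, hm⟩ := exists_notMem hα.ge [i, j, k, l] (by simp)
  simp only [List.mem_cons, List.not_mem_nil, or_false, not_or] at hm
  obtain ⟨n, hn⟩ : ∃ n, a m = n := ⟨_, rfl⟩
  have hnm : n ≠ m := by grind
  have hni : n ≠ i ∧ n ≠ j ∧ n ≠ k ∧ n ≠ l := by grind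
  have hik : i ≠ k ∧ i ≠ l ∧ j ≠ k ∧ j ≠ l := by grind
  have hall : ∀ y, y = i ∨ y = j ∨ y = k ∨ y = l ∨ y = m ∨ y = n := by
    intro y
    by_contra! hy
    refine not_nodup_of_card_eq_six hα i j k l m n y ?_
    simp only [List.nodup_cons, List.mem_cons, List.not_mem_nil, or_false, not_or, List.nodup_nil,
      not_false_eq_true, and_true]
    and_intros <;> grind
  have hbm : b m = n := by
    have := hall (b m)
    have := hbk m
    grind
  obtain ⟨g, hg⟩ : ∃ g : Perm α, g = Equiv.swap i k * Equiv.swap k m *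
    (Equiv.swap j l * Equiv.swap l n) := ⟨_, rfl⟩
  have g1 : g i = k := by rw [hg]; simp only [Perm.mul_apply]; grind
  have g2 : g j = l := by rw [hg]; simp only [Perm.mul_apply]; grind
  have g3 : g k = m := by rw [hg]; simp only [Perm.mul_apply]; grind
  have g4 : g l = n := by rw [hg]; simp only [Perm.mul_apply]; grind
  have g5 : g m = i := by rw [hg]; simp only [Perm.mul_apply]; grind
  have g6 : g n = j := by rw [hg]; simp only [Perm.mul_apply]; grind
  refine ⟨g, ?_, ?_, ?_, ?_, ?_⟩
  · rw [hg]
    exact mul_mem (double_mem_alternatingGroup hik.1 (Ne.symm hm.2.2.1))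
      (double_mem_alternatingGroup hik.2.2.2 hni.2.2.2.symm)
  · ext1 y
    simp only [pow_succ, pow_zero, one_mul, Perm.mul_apply, Perm.one_apply]
    have := hall y
    grind
  · intro h
    rw [h] at g1
    exact hik.1 g1
  · ext1 y
    simp only [Perm.mul_apply]
    have := hall y
    grind
  · ext1 y
    simp only [Perm.mul_apply]
    have := hall y
    grind

end SixPoints

section Six

open Equiv Equiv.Perm

variable {α : Type} [DecidableEq α] [Fintype α]

/-- The automorphism fixes no two distinct commuting involutions. -/
theorem eq_of_map_eq (hα : Fintype.card α = 6)
    {φ : alternatingGroup α ≃* alternatingGroup α} (hφ : ∀ x, φ (φ x) = x) {c : alternatingGroup α}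
    (hc : (c : Perm α).IsThreeCycle) (hc' : ¬ (φ c : Perm α).IsThreeCycle)
    {a b : alternatingGroup α} (ha : IsInvol (a : Perm α)) (hb : IsInvol (b : Perm α))
    (hab : a * b = b * a) (hφa : φ a = a) (hφb : φ b = b) : a = b := by
  by_contra hne
  have hne' : (a : Perm α) ≠ b := fun h => hne (Subtype.ext h)
  have hab' : (a : Perm α) * b = b * a := congrArg Subtype.val hab
  have key : ∀ (g : alternatingGroup α), (g : Perm α) * a = b * g → (φ g : Perm α) * a = b * φ g :=
    fun g hg => by
      have : g * a = b * g := Subtype.ext hg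
      have := congrArg φ this
      rw [map_mul, map_mul, hφa, hφb] at this
      exact congrArg Subtype.val this
  have key' : ∀ (g : alternatingGroup α), (g : Perm α) * b = a * b * g →
      (φ g : Perm α) * b = a * b * φ g :=
    fun g hg => by
      have : g * b = a * b * g := Subtype.ext hg
      have := congrArg φ this
      rw [map_mul, map_mul, map_mul, hφa, hφb] at this
      exact congrArg Subtype.val this
  have hord : ∀ {g : alternatingGroup α}, g ≠ 1 → g ^ 3 = 1 → (φ g : Perm α) ≠ 1 ∧
      (φ g : Perm α) ^ 3 = 1 := fun {g} h1 h3 =>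
    ⟨fun h => h1 (φ.injective (by rw [map_one]; exact Subtype.ext h)), by
      rw [← SubgroupClass.coe_pow, ← map_pow, h3, map_one]; rfl⟩
  obtain ⟨i, j, hij, hai⟩ := ha.exists_fixed_of_card_eq_six hα a.2
  obtain ⟨k, l, hkl, hbk⟩ := hb.exists_fixed_of_card_eq_six hα b.2
  have hcomm := apply_comm hab'
  have hai1 := (hai i).2 (Or.inl rfl)
  have hai2 := (hai j).2 (Or.inr rfl)
  have hbk1 := (hbk k).2 (Or.inl rfl)
  have hbk2 := (hbk l).2 (Or.inr rfl)
  have hbi : (b : Perm α) i = i ∨ (b : Perm α) i = j := (hai _).1 (by rw [hcomm, hai1])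
  rcases hbi with hbi | hbi
  · have hbj : (b : Perm α) j = j := by
      have : (b : Perm α) j = i ∨ (b : Perm α) j = j := (hai _).1 (by rw [hcomm, hai2])
      exact this.resolve_left fun h => hij ((b : Perm α).injective (hbi.trans h.symm))
    have hbi' : ∀ x, (b : Perm α) x = x ↔ x = i ∨ x = j := by
      have := (hbk i).1 hbi
      have := (hbk j).1 hbj
      grind
    obtain ⟨g, hg, hg'⟩ := exists_isThreeCycle_mul_eq hα hij ha hb hne' hai hbi'
    lift g to alternatingGroup α using hg.mem_alternatingGroup
    have h1 : g ≠ 1 := fun h => hg.isCycle.ne_one (congrArg Subtype.val h)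
    have h3 : g ^ 3 = 1 := Subtype.ext hg.pow_three
    have := (isThreeCycle_map_iff hα hφ hc hc' h1 h3).1
      (isThreeCycle_of_mul_eq hα (hord h1 h3).1 (hord h1 h3).2 hai hbi' (key g hg'))
    exact this hg
  · have hak : (a : Perm α) k = l := by
      have h1 : (a : Perm α) k = k ∨ (a : Perm α) k = l := (hbk _).1 (by rw [← hcomm, hbk1])
      refine h1.resolve_left fun h => ?_
      have := (hai k).1 h
      have := hb.apply_apply i
      grind
    obtain ⟨g, hgA, h3, h1, hg, hgb⟩ := exists_mul_eq hα hij hkl ha hb hai hbk hbi hak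
    lift g to alternatingGroup α using hgA
    replace h1 : g ≠ 1 := fun h => h1 (congrArg Subtype.val h)
    replace h3 : g ^ 3 = 1 := Subtype.ext h3
    refine not_isThreeCycle_of_mul_eq hα hij ha hb hab' hai hbi hbk1 (key g hg) (key' g hgb) ?_
    exact (isThreeCycle_map_iff hα hφ hc hc' h1 h3).2
      (not_isThreeCycle_of_mul_eq hα hij ha hb hab' hai hbi hbk1 hg hgb)

/-- Odd involutions in six points commute with elements of order three of only one kind. -/
theorem exists_order_three_of_odd (hα : Fintype.card α = 6) {σ : Perm α} (hσ : IsInvol σ)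
    (hσA : σ ∉ alternatingGroup α) : ∃ g ∈ alternatingGroup α, g ≠ 1 ∧ g ^ 3 = 1 ∧
      σ * g = g * σ ∧ ∀ h : Perm α, h ≠ 1 → h ^ 3 = 1 → σ * h = h * σ →
        (h.IsThreeCycle ↔ g.IsThreeCycle) := by
  by_cases hsw : σ.IsSwap
  · obtain ⟨i, j, hij, rfl⟩ := hsw
    obtain ⟨k, hk⟩ := exists_notMem hα.ge [i, j] (by simp)
    obtain ⟨l, hl⟩ := exists_notMem hα.ge [i, j, k] (by simp)
    obtain ⟨m, hm⟩ := exists_notMem hα.ge [i, j, k, l] (by simp)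
    simp only [List.mem_cons, List.not_mem_nil, or_false, not_or] at hk hl hm
    have hg : (Equiv.swap k l * Equiv.swap l m).IsThreeCycle :=
      isThreeCycle_swap_mul_swap (Ne.symm hl.2.2) (Ne.symm hm.2.2.1) (Ne.symm hm.2.2.2)
    refine ⟨_, hg.mem_alternatingGroup, hg.isCycle.ne_one, hg.pow_three, ?_, ?_⟩
    · rw [← mul_assoc, swap_comm_of_ne (Ne.symm hk.1) (Ne.symm hl.1) (Ne.symm hk.2)
        (Ne.symm hl.2.1), mul_assoc, swap_comm_of_ne (Ne.symm hl.1) (Ne.symm hm.1)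
        (Ne.symm hl.2.1) (Ne.symm hm.2.1), mul_assoc]
    · intro h h1 h3 hc
      refine iff_of_true (isThreeCycle_of_pair_of_card_eq_six hα h1
        (apply_apply_apply_of_pow_three h3) (i := i) (j := j) fun x hx => ?_) hg
      refine (swap_apply_ne_self_iff.1 (show Equiv.swap i j (h x) ≠ h x from ?_)).2
      rw [apply_comm hc]
      exact h.injective.ne (swap_apply_ne_self_iff.2 ⟨hij, hx⟩)
  · have hfix : ∀ x, σ x ≠ x := by
      obtain ⟨k, hk, hsign⟩ := hσ.exists_card_support
      have hodd : ¬ Even k := fun h => hσA (mem_alternatingGroup.2 (by rw [hsign, h.neg_one_pow]))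
      have h1 : k ≠ 1 := fun h => hsw (card_support_eq_two.1 (by omega))
      have hle := hα ▸ Finset.card_le_univ σ.support
      have h6 : σ.support = Finset.univ := by
        rw [← Finset.card_eq_iff_eq_univ]
        grind
      intro x
      rw [← Perm.mem_support, h6]
      exact Finset.mem_univ x
    have hσ2 := hσ.apply_apply
    obtain ⟨x, -⟩ := exists_notMem hα.ge [] (by simp)
    obtain ⟨y, hy⟩ := exists_notMem hα.ge [x, σ x] (by simp)
    obtain ⟨z, hz⟩ := exists_notMem hα.ge [x, σ x, y, σ y] (by simp)
    simp only [List.mem_cons, List.not_mem_nil, or_false, not_or] at hy hz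
    obtain ⟨g, hgdef⟩ : ∃ g, g = Equiv.swap x y * Equiv.swap y z := ⟨_, rfl⟩
    have hg : g.IsThreeCycle :=
      hgdef ▸ isThreeCycle_swap_mul_swap (Ne.symm hy.1) (Ne.symm hz.1) (Ne.symm hz.2.2.1)
    have hinv := hσ.inv_eq
    have hgfix : ∀ w, w ≠ x → w ≠ y → w ≠ z → g w = w := fun w h1 h2 h3 => by
      rw [hgdef, Perm.mul_apply, swap_apply_of_ne_of_ne h2 h3, swap_apply_of_ne_of_ne h1 h2]
    have hgfix' : ∀ w, σ w ≠ x → σ w ≠ y → σ w ≠ z → (σ * g * σ) w = w := fun w h1 h2 h3 => by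
      rw [Perm.mul_apply, Perm.mul_apply, hgfix _ h1 h2 h3, hσ2]
    have hcomm : g * (σ * g * σ) = σ * g * σ * g := by
      refine Disjoint.commute fun w => ?_
      by_cases hw : w = x ∨ w = y ∨ w = z
      · refine Or.inr (hgfix' w ?_ ?_ ?_) <;> grind
      · exact Or.inl (hgfix w (by grind) (by grind) (by grind))
    have hcomm' : σ * (g * (σ * g * σ)) = g * (σ * g * σ) * σ := by
      rw [hcomm]
      have := hσ.2
      grind
    have hne : g * (σ * g * σ) ≠ 1 := fun h => by
      have hx := Perm.ext_iff.1 h x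
      rw [Perm.mul_apply, hgfix' x (hfix x) (Ne.symm hy.2) (Ne.symm hz.2.1), hgdef, Perm.mul_apply,
        swap_apply_of_ne_of_ne (Ne.symm hy.1) (Ne.symm hz.1), swap_apply_left] at hx
      exact hy.1 hx
    have h3 : (g * (σ * g * σ)) ^ 3 = 1 := by
      rw [Commute.mul_pow hcomm, hg.pow_three, one_mul]
      nth_rw 2 [← hinv]
      rw [conj_pow, hg.pow_three, mul_one, mul_inv_cancel]
    refine ⟨g * (σ * g * σ), ?_, hne, h3, hcomm', fun h h1 h3 hc => iff_of_false
      (not_isThreeCycle_of_commute hσ hfix hc) (not_isThreeCycle_of_commute hσ hfix hcomm')⟩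
    refine mul_mem hg.mem_alternatingGroup ?_
    nth_rw 2 [← hinv]
    exact (inferInstance : (alternatingGroup α).Normal).conj_mem _ hg.mem_alternatingGroup _

end Six

section Six

open Equiv Equiv.Perm

theorem IsNormalEA.connected {G : Type} [Group G] {O K : Set G} (h : IsNormalEA O K) :
    ∃ s₀, invRel K s₀ s₀ ∧ ∀ s, invRel K s s → Relation.ReflTransGen (invRel K) s₀ s := by
  obtain ⟨o, ho, ho1⟩ := h.exists_ne
  have hoI : IsInvol o := ⟨ho1, h.sq o ho⟩
  refine ⟨o, ⟨⟨h.subset ho, hoI⟩, ⟨h.subset ho, hoI⟩, rfl⟩, fun s hs => ?_⟩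
  obtain ⟨p, hp, hpI, hsp, -⟩ := h.exists_comm hs.1.1 hs.1.2.2 hs.1.1 hs.1.2.2 rfl
  exact (Relation.ReflTransGen.single
    ⟨⟨h.subset ho, hoI⟩, ⟨h.subset hp, hpI⟩, h.comm o ho p hp⟩).tail
    ⟨⟨h.subset hp, hpI⟩, hs.1, hsp.symm⟩

variable {α : Type} [DecidableEq α] [Fintype α] {G : Type} [Group G] {L : Subgroup G} [L.Normal]
  {e : L ≃* alternatingGroup α} {t t' : G} {σ τ : Perm α}

theorem conjAut_eq_self_iff (t : G) (l : L) : conjAut e t (e l) = e l ↔ t * l = l * t := by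
  rw [conjAut_apply, e.injective.eq_iff, Subtype.ext_iff, MulAut.conjNormal_apply,
    mul_inv_eq_iff_eq_mul]

theorem ActsAs.conjAut_eq_self_iff (h : ActsAs e t σ) (x : alternatingGroup α) :
    conjAut e t x = x ↔ σ * x = x * σ := by
  rw [Subtype.ext_iff, h, mul_inv_eq_iff_eq_mul]

theorem ActsAs.isInvol (hα : 4 ≤ Fintype.card α)
    (hcent : Subgroup.centralizer (L : Set G) = ⊥) (h : ActsAs e t σ) (ht : IsInvol t) :
    IsInvol σ := by
  refine ⟨fun h1 => ht.1 (ActsAs.eq_one hcent (e := e) (h1 ▸ h)), ?_⟩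
  exact (h.mul h).unique hα (ht.2 ▸ actsAs_one)

theorem ActsAs.isNormalEA (h : ActsAs e t σ) {O : Set (Perm α)}
    (hO : IsNormalEA O (centIn (alternatingGroup α) σ)) :
    IsNormalEA {g : G | ∃ l : L, (e l : Perm α) ∈ O ∧ (l : G) = g} (centIn L t) where
  subset := by
    rintro _ ⟨l, hl, rfl⟩
    refine ⟨l.2, ?_⟩
    rw [← _root_.conjAut_eq_self_iff (e := e), h.conjAut_eq_self_iff]
    exact (hO.subset hl).2
  sq := by
    rintro _ ⟨l, hl, rfl⟩
    have := hO.sq _ hl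
    have : l * l = 1 := e.injective (by rw [map_mul, map_one]; exact Subtype.ext this)
    exact congrArg Subtype.val this
  comm := by
    rintro _ ⟨l, hl, rfl⟩ _ ⟨m, hm, rfl⟩
    have : l * m = m * l := e.injective (by
      rw [map_mul, map_mul]; exact Subtype.ext (hO.comm _ hl _ hm))
    exact congrArg Subtype.val this
  mul_mem := by
    rintro _ ⟨l, hl, rfl⟩ _ ⟨m, hm, rfl⟩
    exact ⟨l * m, by rw [map_mul]; exact hO.mul_mem _ hl _ hm, rfl⟩
  exists_ne := by
    obtain ⟨o, ho, ho1⟩ := hO.exists_ne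
    obtain ⟨l, hl⟩ := e.surjective ⟨o, (hO.subset ho).1⟩
    refine ⟨l, ⟨l, by rwa [hl], rfl⟩, fun h1 => ho1 ?_⟩
    have h1 : l = 1 := Subtype.ext h1
    rw [h1, map_one] at hl
    exact (congrArg Subtype.val hl).symm
  conj_mem := by
    rintro s ⟨hs, hst⟩ hs2 _ ⟨l, hl, rfl⟩
    lift s to L using hs
    refine ⟨s * l * s, ?_, rfl⟩
    rw [map_mul, map_mul]
    refine hO.conj_mem (e s) ⟨(e s).2, ?_⟩ ?_ _ hl
    · rwa [← h.conjAut_eq_self_iff, _root_.conjAut_eq_self_iff]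
    · rw [← Subgroup.coe_mul, ← map_mul, show s * s = 1 from Subtype.ext hs2, map_one]
      rfl

theorem ActsAs.exists_isNormalEA (hα : Fintype.card α = 6)
    (hcent : Subgroup.centralizer (L : Set G) = ⊥) (h : ActsAs e t σ) (ht : IsInvol t) :
    ∃ O, IsNormalEA O (centIn L t) := by
  by_cases hσ : σ.IsSwap
  · obtain ⟨i, j, hij, rfl⟩ := hσ
    exact ⟨_, h.isNormalEA (isNormalEA_of_swap hα hij)⟩
  · exact ⟨_, h.isNormalEA (isNormalEA_orbitGroup (h.isInvol (by omega) hcent ht) hσ)⟩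

theorem conjAut_conjAut (ht : IsInvol t) (x : alternatingGroup α) :
    conjAut e t (conjAut e t x) = x := by
  rw [← conjAut_mul, ht.2, conjAut_one]

theorem exists_not_isThreeCycle (hα : 5 ≤ Fintype.card α) (h : ¬ ∃ σ, ActsAs e t σ) :
    ∃ c : alternatingGroup α,
      (c : Perm α).IsThreeCycle ∧ ¬ (conjAut e t c : Perm α).IsThreeCycle := by
  by_contra! h3
  exact h (exists_actsAs hα h3)

theorem exists_actsAs_of_comm (hα : Fintype.card α = 6)
    (hcent : Subgroup.centralizer (L : Set G) = ⊥) (ht : IsInvol t) (htL : t ∉ L) (ht' : IsInvol t')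
    (htt : t * t' = t' * t) (h : ActsAs e t σ) : ∃ τ, ActsAs e t' τ := by
  by_contra h'
  obtain ⟨c, hc, hc'⟩ := exists_not_isThreeCycle (by omega) h'
  obtain ⟨g, hgA, hg1, hg3, hσg, hg⟩ := exists_order_three_of_odd hα
    (h.isInvol (by omega) hcent ht) fun hσ => htL (h.mem hcent hσ)
  lift g to alternatingGroup α using hgA
  replace hg1 : g ≠ 1 := fun h => hg1 (congrArg Subtype.val h)
  replace hg3 : g ^ 3 = 1 := Subtype.ext hg3
  have h1 := isThreeCycle_map_iff hα (conjAut_conjAut ht') hc hc' hg1 hg3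
  have h2 := hg (conjAut e t' g) (fun h => hg1 ((conjAut e t').injective (by
    rw [map_one]; exact Subtype.ext h))) (by
    rw [← SubgroupClass.coe_pow, ← map_pow, hg3, map_one]; rfl) (by
    rw [← h.conjAut_eq_self_iff, ← conjAut_mul, htt, conjAut_mul, (h.conjAut_eq_self_iff g).2 hσg])
  tauto

theorem mul_mem_of_isInvol (hα : Fintype.card α = 6) (e : L ≃* alternatingGroup α)
    (hcent : Subgroup.centralizer (L : Set G) = ⊥) (ht : IsInvol t) (htL : t ∉ L) (ht' : IsInvol t')
    (htL' : t' ∉ L) (htt : t * t' = t' * t) : t * t' ∈ L := by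
  by_cases h : ∃ σ, ActsAs e t σ
  · obtain ⟨σ, h⟩ := h
    obtain ⟨τ, h'⟩ := exists_actsAs_of_comm hα hcent ht htL ht' htt h
    exact (h.mul h').mem hcent (mul_mem_of_notMem (fun hσ => htL (h.mem hcent hσ))
      fun hσ => htL' (h'.mem hcent hσ))
  · have h' : ¬ ∃ σ, ActsAs e t' σ := fun ⟨τ, h'⟩ =>
      h (exists_actsAs_of_comm hα hcent ht' htL' ht htt.symm h')
    obtain ⟨c, hc, hc'⟩ := exists_not_isThreeCycle (by omega) h
    obtain ⟨d, hd, hd'⟩ := exists_not_isThreeCycle (by omega) h'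
    have hord : ∀ {g : alternatingGroup α}, (g : Perm α).IsThreeCycle → g ≠ 1 ∧ g ^ 3 = 1 :=
      fun {g} hg => ⟨fun h => hg.isCycle.ne_one (congrArg Subtype.val h), Subtype.ext hg.pow_three⟩
    obtain ⟨ρ, hρ⟩ := exists_actsAs (e := e) (g := t * t') (by omega) fun x hx => by
      obtain ⟨h1, h3⟩ := hord hx
      rw [conjAut_mul, isThreeCycle_map_iff hα (conjAut_conjAut ht) hc hc',
        isThreeCycle_map_iff hα (conjAut_conjAut ht') hd hd' h1 h3, not_not]
      · exact hx
      · exact fun h => h1 ((conjAut e t').injective (by rw [map_one]; exact h))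
      · rw [← map_pow, h3, map_one]
    by_contra hL
    have hI : IsInvol (t * t') := ht.mul ht' htt fun h => hL (by
      rw [← h, ht.2]
      exact one_mem L)
    refine h' (exists_actsAs_of_comm hα hcent hI hL ht' ?_ hρ)
    rw [htt, mul_assoc, htt]

theorem freeDatum_of_six {L : Subgroup G} [L.Normal] [Finite G] (e : L ≃* alternatingGroup (Fin 6))
    (hcent : Subgroup.centralizer (L : Set G) = ⊥) : FreeDatum (invRel (Set.univ : Set G)) := by
  have hα : Fintype.card (Fin 6) = 6 := Fintype.card_fin 6
  refine freeDatum_of_extension (L := L) (fun t t' htL htL' ht ht' htt =>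
    mul_mem_of_isInvol hα e hcent ht htL ht' htL' htt) ?_ fun t htL ht => ?_
  · refine freeDatum_of_card (Or.inr ⟨?_, ?_⟩)
    · rw [Nat.card_congr e.toEquiv, nat_card_alternatingGroup]
      rw [Nat.card_eq_fintype_card, Fintype.card_fin]
      decide
    · obtain ⟨g, hg⟩ : ∃ g : alternatingGroup (Fin 6), g * g ≠ 1 ∧ g * g * (g * g) = 1 := by
        refine ⟨⟨Equiv.swap 0 1 * Equiv.swap 0 2 * Equiv.swap 0 3 * Equiv.swap 4 5, ?_⟩, ?_⟩
        · rw [mem_alternatingGroup]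
          decide +kernel
        · decide +kernel
      refine ⟨e.symm g, Subtype.property _, fun h => hg.1 (e.symm.injective ?_), ?_⟩
      · rw [map_mul, map_one]
        exact Subtype.ext h
      · rw [← Subgroup.coe_mul, ← Subgroup.coe_mul, ← map_mul, ← map_mul, hg.2, map_one]
        rfl
  · by_cases h : ∃ σ, ActsAs e t σ
    · obtain ⟨σ, h⟩ := h
      obtain ⟨O, hO⟩ := h.exists_isNormalEA hα hcent ht
      exact Or.inl ⟨hO.simplyConn, hO.connected⟩
    · obtain ⟨c, hc, hc'⟩ := exists_not_isThreeCycle (by simp) h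
      refine Or.inr fun s s' hs => ?_
      obtain ⟨⟨⟨hsL, hst⟩, hsI⟩, ⟨⟨hsL', hst'⟩, hsI'⟩, hss⟩ := hs
      lift s to L using hsL
      lift s' to L using hsL'
      have hI : ∀ {l : L}, IsInvol (l : G) → IsInvol (e l : Perm (Fin 6)) := fun {l} hl =>
        ⟨fun h => hl.1 (congrArg Subtype.val (e.injective (a₁ := l) (a₂ := 1) (by
          rw [map_one]; exact Subtype.ext h))), by
          rw [← Subgroup.coe_mul, ← map_mul, show l * l = 1 from Subtype.ext hl.2, map_one]
          rfl⟩
      refine congrArg Subtype.val (e.injective (eq_of_map_eq hα (conjAut_conjAut ht) hc hc'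
        (hI hsI) (hI hsI') ?_ ((conjAut_eq_self_iff t s).2 hst)
          ((conjAut_eq_self_iff t s').2 hst')))
      rw [← map_mul, ← map_mul, show s * s' = s' * s from Subtype.ext hss]

end Six

/-- Let `n ≥ 5` and let `G` be a finite group with a normal subgroup
isomorphic to the alternating group `A_n` having trivial centralizer in `G` (i.e.
`A_n ≤ G ≤ Aut(A_n)`). Then every connected component of the realization of
`K(A_2(G))` has free fundamental group. -/
theorem stmt17 (n : ℕ) (hn : 5 ≤ n) (G : Type) [Group G] [Finite G]
    (L : Subgroup G) (hLnormal : L.Normal)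
    (hiso : Nonempty (↥L ≃* ↥(alternatingGroup (Fin n))))
    (hcent : Subgroup.centralizer (L : Set G) = ⊥) :
    ∀ x : ↥(geomRealOn (apSet 2 G)), ∃ S : Type,
      Nonempty (FundamentalGroup ↥(geomRealOn (apSet 2 G)) x ≃* FreeGroup S) := by
  obtain ⟨e⟩ := hiso
  refine exists_freeGroup_of_invRel ?_
  by_cases h6 : n = 6
  · subst h6
    exact Or.inr (freeDatum_of_six e hcent)
  · exact simplyConn_or_freeDatum_of_ne_six (by omega) e hcent
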